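/- arXiv:1405.2742 — 2 statements merged into one kernel-verified Lean document; each statement's English description precedes it below -/
import Mathlib

section
/- Let d ≥ 2 and let B be a collision kernel satisfying the standing assumptions (1.1) and the Lipschitz assumption (1.2). Let p ∈ (2,∞) and let μ_0 ∈ 𝒮(p). Then there exists a unique measure solution (μ_t)_{t≥0} of the spatially homogeneous Boltzmann equation starting from μ_0 which is locally bounded in 𝒮(p). -/
open MeasureTheory ProbabilityTheory Filter
open scoped ENNReal NNReal RealInnerProductSpace

noncomputable section

abbrev Vd (d : ℕ) := EuclideanSpace ℝ (Fin d)

namespace KacModel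

variable {d : ℕ}

/-- Post-collision velocity `v' = (v+v*)/2 + |v-v*|σ/2`. -/
def postV (v vs σ : Vd d) : Vd d := (2:ℝ)⁻¹ • (v + vs) + ((2:ℝ)⁻¹ * ‖v - vs‖) • σ

/-- Post-collision velocity `v'_* = (v+v*)/2 - |v-v*|σ/2`. -/
def postVs (v vs σ : Vd d) : Vd d := (2:ℝ)⁻¹ • (v + vs) - ((2:ℝ)⁻¹ * ‖v - vs‖) • σ

/-- The unit sphere `S^{d-1}` regarded as a subset of `ℝ^d`. -/
def unitSphere (d : ℕ) : Set (Vd d) := {σ | ‖σ‖ = 1}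

/-- Standing assumptions (1.1) on a collision kernel, regarded as a family of
measures on `ℝ^d` carried by the unit sphere. -/
structure IsCollisionKernel (B : Vd d → Measure (Vd d)) : Prop where
  measurable : ∀ s : Set (Vd d), MeasurableSet s → Measurable fun v => B v s
  prob : ∀ u : Vd d, ‖u‖ = 1 → IsProbabilityMeasure (B u)
  support : ∀ u : Vd d, ‖u‖ = 1 → B u ((unitSphere d \ {u, -u})ᶜ) = 0
  scaling : ∀ (c : ℝ), 0 ≤ c → ∀ u : Vd d, ‖u‖ = 1 →
    B (c • u) = ENNReal.ofReal c • B u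
  symm : ∀ (R : Vd d ≃ₗᵢ[ℝ] Vd d) (u : Vd d), ‖u‖ = 1 → B (R u) = (B u).map R

/-- Total variation distance between two finite measures (dual formulation). -/
def tvDist {E : Type*} [MeasurableSpace E] (μ ν : Measure E) : ℝ :=
  ⨆ f : {f : E → ℝ // Measurable f ∧ ∀ x, |f x| ≤ 1},
    ((∫ x, f.1 x ∂μ) - ∫ x, f.1 x ∂ν)

/-- The Lipschitz assumption (1.2). -/
def IsLipschitzKernel (B : Vd d → Measure (Vd d)) (κ : ℝ) : Prop :=
  1 ≤ κ ∧ ∀ v v' : Vd d, tvDist (B v) (B v') ≤ κ * ‖v - v'‖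

/-- The Boltzmann sphere 𝒮. -/
def boltzmannSphere (d : ℕ) : Set (Measure (Vd d)) :=
  {μ | IsProbabilityMeasure μ ∧ (∫ v, v ∂μ) = 0 ∧ (∫ v, ‖v‖ ^ 2 ∂μ) = 1}

/-- 𝒮_N : normalized empirical measures in the Boltzmann sphere. -/
def empiricalSphere (d N : ℕ) : Set (Measure (Vd d)) :=
  {μ | μ ∈ boltzmannSphere d ∧
    ∃ x : Fin N → Vd d, μ = (N : ℝ≥0∞)⁻¹ • ∑ i, Measure.dirac (x i)}

/-- The class ℱ of test functions. -/
def testF (d : ℕ) : Set (Vd d → ℝ) :=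
  {f | (∀ v, |f v / (1 + ‖v‖ ^ 2)| ≤ 1) ∧
    ∀ v v', |f v / (1 + ‖v‖ ^ 2) - f v' / (1 + ‖v'‖ ^ 2)| ≤ ‖v - v'‖}

/-- The weighted Wasserstein distance W. -/
def Wdist (μ ν : Measure (Vd d)) : ℝ :=
  ⨆ f : testF d, ((∫ v, (f : Vd d → ℝ) v ∂μ) - ∫ v, (f : Vd d → ℝ) v ∂ν)

/-- The p-th moment `∫ |v|^p dμ`, as a lower integral. -/
def momentL (p : ℝ) (μ : Measure (Vd d)) : ℝ≥0∞ :=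
  ∫⁻ v, (‖v‖₊ : ℝ≥0∞) ^ p ∂μ

/-- Total variation measure |μ - ν| of the difference of two finite measures. -/
def tvMeasure {E : Type*} [MeasurableSpace E] (μ ν : Measure E) : Measure E :=
  (μ - ν) + (ν - μ)

/-- The post-collision update `μ^{v,v_*,σ}` of an empirical measure. -/
def collUpdate (N : ℕ) (μ : Measure (Vd d)) (v vs σ : Vd d) : Measure (Vd d) :=
  μ + (N : ℝ≥0∞)⁻¹ • (Measure.dirac (postV v vs σ) + Measure.dirac (postVs v vs σ))
    - (N : ℝ≥0∞)⁻¹ • (Measure.dirac v + Measure.dirac vs)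

/-- The generator 𝒢 of the Kac process. -/
def kacGen (B : Vd d → Measure (Vd d)) (N : ℕ) (F : Measure (Vd d) → ℝ)
    (μ : Measure (Vd d)) : ℝ :=
  N * ∫ v, (∫ vs, (∫ σ, (F (collUpdate N μ v vs σ) - F μ) ∂(B (v - vs))) ∂μ) ∂μ

/-- A Kac process with collision kernel `B` and particle number `N`:
a càdlàg adapted 𝒮_N-valued process solving the martingale problem for 𝒢. -/
structure IsKacProcess {Ω : Type*} [m : MeasurableSpace Ω]
    (B : Vd d → Measure (Vd d)) (N : ℕ) (P : Measure Ω)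
    (𝓕 : Filtration ℝ m) (μp : ℝ → Ω → Measure (Vd d)) : Prop where
  mem : ∀ t ω, μp t ω ∈ empiricalSphere d N
  adapted : ∀ f ∈ testF d, Adapted 𝓕 fun t ω => ∫ v, f v ∂(μp t ω)
  rightCont : ∀ ω, ∀ f ∈ testF d, ∀ t : ℝ,
    ContinuousWithinAt (fun s => ∫ v, f v ∂(μp s ω)) (Set.Ici t) t
  leftLim : ∀ ω, ∀ f ∈ testF d, ∀ t : ℝ, 0 < t →
    ∃ L : ℝ, Tendsto (fun s => ∫ v, f v ∂(μp s ω)) (nhdsWithin t (Set.Iio t)) (nhds L)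
  martingale : ∀ G : Measure (Vd d) → ℝ, Measurable G → (∃ M : ℝ, ∀ ν, |G ν| ≤ M) →
    Martingale (fun t ω => G (μp t ω) - ∫ s in Set.Ioc (0:ℝ) t, kacGen B N G (μp s ω)) 𝓕 P

/-- `⟨f, Q(μ,ν)⟩`, the Boltzmann collision integral. -/
def QInt (B : Vd d → Measure (Vd d)) (f : Vd d → ℝ) (μ ν : Measure (Vd d)) : ℝ :=
  ∫ v, (∫ vs, (∫ σ, (f (postV v vs σ) + f (postVs v vs σ) - f v - f vs) ∂(B (v - vs))) ∂ν) ∂μ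

/-- Measure solution of the spatially homogeneous Boltzmann equation, started at time τ. -/
def IsBoltzmannSolutionFrom (B : Vd d → Measure (Vd d)) (τ : ℝ)
    (μt : ℝ → Measure (Vd d)) : Prop :=
  (∀ t, τ ≤ t → μt t ∈ boltzmannSphere d) ∧
  ∀ f : Vd d → ℝ, Measurable f → (∃ M, ∀ v, |f v| ≤ M) → HasCompactSupport f →
    ∀ t, τ ≤ t →
      (∫ v, f v ∂(μt t)) = (∫ v, f v ∂(μt τ)) + ∫ s in Set.Ioc τ t, QInt B f (μt s) (μt s)

/-- Measure solution of the spatially homogeneous Boltzmann equation (start time 0). -/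
def IsBoltzmannSolution (B : Vd d → Measure (Vd d)) (μt : ℝ → Measure (Vd d)) : Prop :=
  IsBoltzmannSolutionFrom B 0 μt

/-- Local boundedness in 𝒮(p) from time τ on. -/
def LocBddMomentFrom (p τ : ℝ) (μt : ℝ → Measure (Vd d)) : Prop :=
  ∀ T, τ ≤ T → ∃ M : ℝ≥0∞, M ≠ ⊤ ∧ ∀ t ∈ Set.Icc τ T, momentL p (μt t) ≤ M

/-- Sample mean. -/
def sampleMean {Ω : Type*} {N : ℕ} (Vs : Fin N → Ω → Vd d) (ω : Ω) : Vd d :=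
  (N : ℝ)⁻¹ • ∑ i, Vs i ω

/-- Sample mean square. -/
def sampleQ {Ω : Type*} {N : ℕ} (Vs : Fin N → Ω → Vd d) (ω : Ω) : ℝ :=
  (N : ℝ)⁻¹ * ∑ i, ‖Vs i ω‖ ^ 2

/-- Sample variance. -/
def sampleS {Ω : Type*} {N : ℕ} (Vs : Fin N → Ω → Vd d) (ω : Ω) : ℝ :=
  sampleQ Vs ω - ‖sampleMean Vs ω‖ ^ 2

/-- The rescaled empirical distribution μ̃^N. -/
def rescaledEmpirical {Ω : Type*} {N : ℕ} (Vs : Fin N → Ω → Vd d)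
    (μdef : Measure (Vd d)) (ω : Ω) : Measure (Vd d) :=
  if 0 < sampleS Vs ω then
    (N : ℝ≥0∞)⁻¹ • ∑ i, Measure.dirac
      ((Real.sqrt (sampleS Vs ω))⁻¹ • (Vs i ω - sampleMean Vs ω))
  else μdef

/-- The N-sample empirical distribution. -/
def empMeasure {Ω : Type*} {N : ℕ} (Vs : Fin N → Ω → Vd d) (ω : Ω) : Measure (Vd d) :=
  (N : ℝ≥0∞)⁻¹ • ∑ i, Measure.dirac (Vs i ω)

end KacModel

open KacModel

set_option linter.all false
set_option linter.deprecated false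
namespace BE

section Abstract
variable {V : Type*} [MeasurableSpace V]

/-- exponential decay factor -/
def ee (L : V → ℝ) (t : ℝ) (v : V) : ℝ≥0∞ := ENNReal.ofReal (Real.exp (-(L v * t)))

lemma measurable_ee {L : V → ℝ} (hL : Measurable L) :
    Measurable (fun x : ℝ × V => ee L x.1 x.2) := by
  unfold ee; fun_prop

lemma ee_ne_top (L : V → ℝ) (t : ℝ) (v : V) : ee L t v ≠ ∞ := ENNReal.ofReal_ne_top

/-- density on (s,v) -/
def dens (L : V → ℝ) (t : ℝ) (x : ℝ × V) : ℝ≥0∞ :=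
  (Set.Ioc 0 t).indicator (fun s => ee L (t - s) x.2) x.1

lemma dens_ne_top (L : V → ℝ) (t : ℝ) (x : ℝ × V) : dens L t x ≠ ∞ := by
  unfold dens Set.indicator
  split_ifs
  · exact ee_ne_top _ _ _
  · simp

lemma measurable_dens {L : V → ℝ} (hL : Measurable L) :
    Measurable (Function.uncurry (dens L)) := by
  have : Function.uncurry (dens L) = fun x : ℝ × (ℝ × V) =>
      ({x : ℝ × (ℝ × V) | 0 < x.2.1 ∧ x.2.1 ≤ x.1}).indicator
        (fun x => ee L (x.1 - x.2.1) x.2.2) x := by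
    ext ⟨t, s, v⟩
    simp only [Function.uncurry, dens, Set.indicator, Set.mem_Ioc, Set.mem_ofPred_eq]
  rw [this]
  refine Measurable.indicator ?_ ?_
  · exact (measurable_ee hL).comp (by fun_prop : Measurable fun x : ℝ × (ℝ × V) => (x.1 - x.2.1, x.2.2))
  · have m1 : MeasurableSet {x : ℝ × (ℝ × V) | 0 < x.2.1} :=
      measurableSet_lt measurable_const (by fun_prop)
    have m2 : MeasurableSet {x : ℝ × (ℝ × V) | x.2.1 ≤ x.1} :=
      measurableSet_le (by fun_prop) (by fun_prop)
    exact m1.inter m2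

variable (L : V → ℝ) (μ0 : Measure V) [SFinite μ0] (q : Kernel ℝ V) [IsSFiniteKernel q]

/-- Duhamel kernel -/
def duh : Kernel ℝ V :=
  (Kernel.const ℝ μ0).withDensity (fun t v => ee L t v) +
  ((Kernel.const ℝ ((volume : Measure ℝ) ⊗ₘ q)).withDensity (dens L)).snd

instance : IsSFiniteKernel (duh L μ0 q) := by
  unfold duh
  have h1 : IsSFiniteKernel ((Kernel.const ℝ μ0).withDensity (fun t v => ee L t v)) :=
    Kernel.IsSFiniteKernel.withDensity _ (fun t v => ee_ne_top L t v)
  have h2 : IsSFiniteKernel ((Kernel.const ℝ ((volume : Measure ℝ) ⊗ₘ q)).withDensity (dens L)) :=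
    Kernel.IsSFiniteKernel.withDensity _ (fun t v => dens_ne_top L t v)
  infer_instance

variable {L}

lemma lintegral_duh (hL : Measurable L) (t : ℝ) {f : V → ℝ≥0∞} (hf : Measurable f) :
    ∫⁻ v, f v ∂(duh L μ0 q t) = ∫⁻ v, ee L t v * f v ∂μ0 +
      ∫⁻ s in Set.Ioc 0 t, ∫⁻ v, ee L (t - s) v * f v ∂(q s) := by
  have hd : Measurable (dens L t) := (measurable_dens hL).comp (measurable_const.prodMk measurable_id)
  rw [duh, add_apply, lintegral_add_measure,
    Kernel.lintegral_withDensity _ (measurable_ee hL) _ hf, Kernel.const_apply,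
    Kernel.lintegral_snd _ _ hf,
    Kernel.lintegral_withDensity _ (measurable_dens hL) _ (g := fun x => f x.2)
      (hf.comp measurable_snd),
    Kernel.const_apply, Measure.lintegral_compProd (f := fun x => dens L t x * f x.2)
      (hd.mul (hf.comp measurable_snd)),
    ← lintegral_indicator measurableSet_Ioc]
  congr 1
  refine lintegral_congr fun s => ?_
  by_cases hs : s ∈ Set.Ioc 0 t <;> simp [dens, hs]

lemma duh_mono (hL : Measurable L) {q q' : Kernel ℝ V} [IsSFiniteKernel q] [IsSFiniteKernel q']
    {t : ℝ} (h : ∀ s ∈ Set.Ioc 0 t, q s ≤ q' s) : duh L μ0 q t ≤ duh L μ0 q' t := by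
  refine Measure.le_iff.2 fun s hs => ?_
  rw [← lintegral_indicator_one hs, ← lintegral_indicator_one hs,
    lintegral_duh μ0 q hL t (measurable_one.indicator hs),
    lintegral_duh μ0 q' hL t (measurable_one.indicator hs)]
  gcongr 1
  refine setLIntegral_mono' measurableSet_Ioc fun r hr => lintegral_mono' (h r hr) le_rfl

lemma measurable_duh_integrand (hL : Measurable L) {f : V → ℝ≥0∞} (hf : Measurable f) (t : ℝ) :
    Measurable fun s => ∫⁻ v, ee L (t - s) v * f v ∂(q s) := by
  apply Measurable.lintegral_kernel_prod_right (κ := q)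
    (f := fun s v => ee L (t - s) v * f v)
  exact ((measurable_ee hL).comp
      (by fun_prop : Measurable fun x : ℝ × V => (t - x.1, x.2))).mul (hf.comp measurable_snd)

/-- `∫_0^t L e^{-L r} dr = 1 - e^{-L t}` in additive form. -/
lemma ee_int (hL0 : ∀ v, 0 ≤ L v) (v : V) {a t : ℝ} (ht : a ≤ t) :
    ∫⁻ r in Set.Ioc a t, ENNReal.ofReal (L v) * ee L (r - a) v = 1 - ee L (t - a) v := by
  have h1 : ∀ r : ℝ, ENNReal.ofReal (L v) * ee L (r - a) v =
      ENNReal.ofReal (L v * Real.exp (-(L v * (r - a)))) := fun r => by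
    rw [ee, ENNReal.ofReal_mul (hL0 v)]
  simp_rw [h1]
  rw [← ofReal_integral_eq_lintegral_ofReal, ← intervalIntegral.integral_of_le ht,
    intervalIntegral.integral_eq_sub_of_hasDerivAt (f := fun r => - Real.exp (-(L v * (r - a))))]
  · rw [ee, ← ENNReal.ofReal_one, ← ENNReal.ofReal_sub _ (Real.exp_pos _).le]
    congr 1; simp; ring
  · intro x _
    have := ((((hasDerivAt_id x).sub_const a).const_mul (L v)).neg.exp).neg
    refine this.congr_deriv ?_
    simp [mul_comm]
  · apply Continuous.intervalIntegrable; fun_prop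
  · exact (Continuous.integrableOn_Ioc (by fun_prop))
  · exact Eventually.of_forall fun r => mul_nonneg (hL0 v) (Real.exp_pos _).le

lemma ee_le_one (hL0 : ∀ v, 0 ≤ L v) (v : V) {t : ℝ} (ht : 0 ≤ t) : ee L t v ≤ 1 := by
  rw [ee, ← ENNReal.ofReal_one]
  apply ENNReal.ofReal_le_ofReal
  rw [Real.exp_le_one_iff]
  have := mul_nonneg (hL0 v) ht
  linarith

lemma ee_int' (hL0 : ∀ v, 0 ≤ L v) (v : V) {a t : ℝ} (ht : a ≤ t) :
    (∫⁻ r in Set.Ioc a t, ENNReal.ofReal (L v) * ee L (r - a) v) + ee L (t - a) v = 1 := by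
  rw [ee_int hL0 v ht, tsub_add_cancel_of_le (ee_le_one hL0 v (by linarith))]

/-- Tonelli: swap of a triangular double integral against a kernel. -/
lemma tri_swap {t : ℝ} {g : ℝ → ℝ → V → ℝ≥0∞}
    (hg : Measurable fun x : ℝ × ℝ × V => g x.1 x.2.1 x.2.2) :
    ∫⁻ r in Set.Ioc 0 t, ∫⁻ s in Set.Ioc 0 r, ∫⁻ v, g r s v ∂(q s) =
    ∫⁻ s in Set.Ioc 0 t, ∫⁻ v, ∫⁻ r in Set.Ioc s t, g r s v ∂volume ∂(q s) := by
  have hgm : Measurable fun x : ℝ × ℝ => ∫⁻ v, g x.1 x.2 v ∂(q x.2) := by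
    have := Measurable.lintegral_kernel_prod_right' (κ := q.comap (fun x : ℝ × ℝ => x.2) measurable_snd)
      (f := fun y : (ℝ × ℝ) × V => g y.1.1 y.1.2 y.2)
      (hg.comp (by fun_prop : Measurable fun y : (ℝ × ℝ) × V => (y.1.1, y.1.2, y.2)))
    simpa using this
  set G : ℝ → ℝ → ℝ≥0∞ := fun r s => ({x : ℝ × ℝ | x.2 ≤ x.1}).indicator
    (fun x => ∫⁻ v, g x.1 x.2 v ∂(q x.2)) (r, s) with hG
  have hGm : Measurable (Function.uncurry G) :=
    hgm.indicator (measurableSet_le measurable_snd measurable_fst)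
  have e1 : ∀ r ∈ Set.Ioc 0 t, ∫⁻ s in Set.Ioc 0 r, ∫⁻ v, g r s v ∂(q s) =
      ∫⁻ s in Set.Ioc 0 t, G r s := by
    intro r hr
    rw [← lintegral_indicator measurableSet_Ioc, ← lintegral_indicator measurableSet_Ioc]
    refine lintegral_congr fun s => ?_
    simp only [hG, Set.indicator, Set.mem_Ioc, Set.mem_ofPred_eq]
    have := hr.2
    by_cases h1 : 0 < s <;> by_cases h2 : s ≤ r <;> simp [h1, h2]
    intro h3; exact absurd (h2.trans hr.2) (not_le.2 h3)
  rw [setLIntegral_congr_fun measurableSet_Ioc e1, lintegral_lintegral_swap hGm.aemeasurable]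
  refine setLIntegral_congr_fun measurableSet_Ioc fun s hs => ?_
  show ∫⁻ r in Set.Ioc 0 t, G r s = _
  have e2 : ∫⁻ r in Set.Ioc 0 t, G r s = ∫⁻ r in Set.Ioc s t, ∫⁻ v, g r s v ∂(q s) := by
    rw [← lintegral_indicator measurableSet_Ioc, ← lintegral_indicator measurableSet_Ioc]
    have : ∀ᵐ r : ℝ, r ≠ s := by simp [ae_iff]
    refine lintegral_congr_ae (this.mono fun r hr => ?_)
    simp only [hG, Set.indicator, Set.mem_Ioc, Set.mem_ofPred_eq]
    have h0 := hs.1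
    by_cases h1 : s < r
    · simp [h1, h1.le, h0.trans h1]
    · have : ¬ s ≤ r := fun h => h1 (lt_of_le_of_ne h (Ne.symm hr))
      simp [h1, this]
  rw [e2]
  exact lintegral_lintegral_swap (Measurable.aemeasurable
    (hg.comp (by fun_prop : Measurable fun y : ℝ × V => (y.1, s, y.2))))

end Abstract

section Abstract2
variable {V : Type*} [MeasurableSpace V] {L : V → ℝ}

lemma ee_int2 (hL0 : ∀ v, 0 ≤ L v) (v : V) {a t : ℝ} (ht : a ≤ t) :
    (∫⁻ r in Set.Ioc a t, ENNReal.ofReal (L v) * ee L (t - r) v) + ee L (t - a) v = 1 := by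
  have h1 : ∀ r : ℝ, ENNReal.ofReal (L v) * ee L (t - r) v =
      ENNReal.ofReal (L v * Real.exp (-(L v * (t - r)))) := fun r => by
    rw [ee, ENNReal.ofReal_mul (hL0 v)]
  have : ∫⁻ r in Set.Ioc a t, ENNReal.ofReal (L v) * ee L (t - r) v = 1 - ee L (t - a) v := by
    simp_rw [h1]
    rw [← ofReal_integral_eq_lintegral_ofReal, ← intervalIntegral.integral_of_le ht,
      intervalIntegral.integral_eq_sub_of_hasDerivAt (f := fun r => Real.exp (-(L v * (t - r))))]
    · rw [ee, ← ENNReal.ofReal_one, ← ENNReal.ofReal_sub _ (Real.exp_pos _).le]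
      congr 1; simp
    · intro x _
      have := ((((hasDerivAt_id x).const_sub t).const_mul (L v)).neg.exp)
      refine this.congr_deriv ?_
      simp [mul_comm]
    · apply Continuous.intervalIntegrable; fun_prop
    · exact (Continuous.integrableOn_Ioc (by fun_prop))
    · exact Eventually.of_forall fun r => mul_nonneg (hL0 v) (Real.exp_pos _).le
  rw [this, tsub_add_cancel_of_le (ee_le_one hL0 v (by linarith))]

lemma measurable_ee_t (hL : Measurable L) (t : ℝ) : Measurable fun v => ee L t v :=
  (measurable_ee hL).comp (measurable_const.prodMk measurable_id)

lemma measurable_ee_v (v : V) : Measurable fun r => ee L r v := by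
  unfold ee; fun_prop

lemma collapse (hL : Measurable L) (hL0 : ∀ v, 0 ≤ L v) (m : Measure V) {s t : ℝ} (hst : s ≤ t)
    {f : V → ℝ≥0∞} (hf : Measurable f) :
    ∫⁻ v, (∫⁻ r in Set.Ioc s t, ENNReal.ofReal (L v) * ee L (r - s) v * f v) ∂m +
      ∫⁻ v, ee L (t - s) v * f v ∂m = ∫⁻ v, f v ∂m := by
  rw [← lintegral_add_right (g := fun v => ee L (t - s) v * f v) _ ((measurable_ee_t hL _).mul hf)]
  refine lintegral_congr fun v => ?_
  have hm : Measurable fun r => ENNReal.ofReal (L v) * ee L (r - s) v :=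
    ((measurable_ee_v v).comp (measurable_id.sub_const s)).const_mul _
  rw [lintegral_mul_const _ hm, ← add_mul, ee_int' hL0 v hst, one_mul]

lemma collapse2 (hL : Measurable L) (hL0 : ∀ v, 0 ≤ L v) (m : Measure V) {s t : ℝ} (hst : s ≤ t)
    {f : V → ℝ≥0∞} (hf : Measurable f) :
    ∫⁻ v, (∫⁻ r in Set.Ioc s t, ENNReal.ofReal (L v) * ee L (t - r) v * f v) ∂m +
      ∫⁻ v, ee L (t - s) v * f v ∂m = ∫⁻ v, f v ∂m := by
  rw [← lintegral_add_right (g := fun v => ee L (t - s) v * f v) _ ((measurable_ee_t hL _).mul hf)]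
  refine lintegral_congr fun v => ?_
  have hm : Measurable fun r => ENNReal.ofReal (L v) * ee L (t - r) v :=
    ((measurable_ee_v v).comp (measurable_id.const_sub t)).const_mul _
  rw [lintegral_mul_const _ hm, ← add_mul, ee_int2 hL0 v hst, one_mul]

lemma measurable_lint (q : Kernel ℝ V) {f : V → ℝ≥0∞} (hf : Measurable f) :
    Measurable fun s => ∫⁻ v, f v ∂(q s) := Measurable.lintegral_kernel hf

variable (μ0 : Measure V) [SFinite μ0] (q : Kernel ℝ V) [IsSFiniteKernel q]

lemma mild_to_weak (hL : Measurable L) (hL0 : ∀ v, 0 ≤ L v) {t : ℝ} (ht : 0 ≤ t)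
    {f : V → ℝ≥0∞} (hf : Measurable f) :
    ∫⁻ v, f v ∂(duh L μ0 q t) +
      ∫⁻ s in Set.Ioc 0 t, ∫⁻ v, ENNReal.ofReal (L v) * f v ∂(duh L μ0 q s) =
    ∫⁻ v, f v ∂μ0 + ∫⁻ s in Set.Ioc 0 t, ∫⁻ v, f v ∂(q s) := by
  have hLf : Measurable fun v => ENNReal.ofReal (L v) * f v := by fun_prop
  have e1 : ∫⁻ s in Set.Ioc 0 t, ∫⁻ v, ENNReal.ofReal (L v) * f v ∂(duh L μ0 q s) =
      ∫⁻ v, (∫⁻ r in Set.Ioc 0 t, ENNReal.ofReal (L v) * ee L (r - 0) v * f v) ∂μ0 +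
      ∫⁻ s in Set.Ioc 0 t, ∫⁻ v, (∫⁻ r in Set.Ioc s t,
        ENNReal.ofReal (L v) * ee L (r - s) v * f v) ∂(q s) := by
    simp_rw [lintegral_duh μ0 q hL _ hLf]
    have hm1 : Measurable fun x : ℝ × V => ee L x.1 x.2 * (ENNReal.ofReal (L x.2) * f x.2) :=
      (measurable_ee hL).mul (hLf.comp measurable_snd)
    rw [lintegral_add_left hm1.lintegral_prod_right', lintegral_lintegral_swap hm1.aemeasurable]
    have hm2 : Measurable fun x : ℝ × ℝ × V =>
        ee L (x.1 - x.2.1) x.2.2 * (ENNReal.ofReal (L x.2.2) * f x.2.2) :=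
      ((measurable_ee hL).comp
        (by fun_prop : Measurable fun x : ℝ × ℝ × V => (x.1 - x.2.1, x.2.2))).mul
        (hLf.comp (by fun_prop : Measurable fun x : ℝ × ℝ × V => x.2.2))
    rw [tri_swap q (g := fun r s v => ee L (r - s) v * (ENNReal.ofReal (L v) * f v)) hm2]
    simp only [sub_zero, mul_comm, mul_left_comm, mul_assoc]
  have hm3 := measurable_duh_integrand q hL hf t
  rw [e1, lintegral_duh μ0 q hL _ hf,
    ← collapse hL hL0 μ0 ht hf, sub_zero,
    setLIntegral_congr_fun measurableSet_Ioc
      (fun s hs => (collapse hL hL0 (q s) hs.2 hf).symm), lintegral_add_right _ hm3]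
  ring

/-- weak equation at time `r` for test function `g`. -/
def Weak (L : V → ℝ) (μ0 : Measure V) (q N : Kernel ℝ V) (r : ℝ) (g : V → ℝ≥0∞) : Prop :=
  ∫⁻ v, g v ∂(N r) + ∫⁻ s in Set.Ioc 0 r, ∫⁻ v, ENNReal.ofReal (L v) * g v ∂(N s) =
    ∫⁻ v, g v ∂μ0 + ∫⁻ s in Set.Ioc 0 r, ∫⁻ v, g v ∂(q s)

lemma weak_to_mild (hL : Measurable L) (hL0 : ∀ v, 0 ≤ L v) {t : ℝ} (ht : 0 ≤ t)
    (N : Kernel ℝ V) [IsSFiniteKernel N]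
    {f : V → ℝ≥0∞} (hf : Measurable f)
    (hW : ∀ r ∈ Set.Ioc 0 t, Weak L μ0 q N r fun v => ENNReal.ofReal (L v) * ee L (t - r) v * f v)
    (hWt : Weak L μ0 q N t f)
    (hfin : ∫⁻ s in Set.Ioc 0 t, ∫⁻ v, ENNReal.ofReal (L v) * f v ∂(N s) ≠ ∞) :
    ∫⁻ v, f v ∂(N t) = ∫⁻ v, f v ∂(duh L μ0 q t) := by
  unfold Weak at hW hWt
  have hLf : Measurable fun v => ENNReal.ofReal (L v) * f v := by fun_prop
  have hm1 : Measurable fun x : ℝ × V => ENNReal.ofReal (L x.2) * ee L (t - x.1) x.2 * f x.2 := by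
    have := (measurable_ee hL).comp (by fun_prop : Measurable fun x : ℝ × V => (t - x.1, x.2))
    exact ((by fun_prop : Measurable fun x : ℝ × V => ENNReal.ofReal (L x.2)).mul this).mul
      (hf.comp measurable_snd)
  have hm1' : Measurable fun x : ℝ × ℝ × V =>
      ENNReal.ofReal (L x.2.2) * ee L (t - x.1) x.2.2 * f x.2.2 :=
    hm1.comp (by fun_prop : Measurable fun x : ℝ × ℝ × V => (x.1, x.2.2))
  have hm2' : Measurable fun x : ℝ × ℝ × V => ENNReal.ofReal (L x.2.2) *
      (ENNReal.ofReal (L x.2.2) * ee L (t - x.1) x.2.2 * f x.2.2) :=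
    (by fun_prop : Measurable fun x : ℝ × ℝ × V => ENNReal.ofReal (L x.2.2)).mul hm1'
  have key := setLIntegral_congr_fun (μ := volume) measurableSet_Ioc hW
  have mN : Measurable fun r => ∫⁻ v, ENNReal.ofReal (L v) * ee L (t - r) v * f v ∂(N r) :=
    Measurable.lintegral_kernel_prod_right (κ := N)
      (f := fun r v => ENNReal.ofReal (L v) * ee L (t - r) v * f v) hm1
  rw [lintegral_add_left mN, lintegral_add_left hm1.lintegral_prod_right',
    tri_swap N (g := fun r s v => ENNReal.ofReal (L v) * 
      (ENNReal.ofReal (L v) * ee L (t - r) v * f v)) hm2',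
    tri_swap q (g := fun r s v => ENNReal.ofReal (L v) * ee L (t - r) v * f v) hm1',
    lintegral_lintegral_swap (f := fun r v => ENNReal.ofReal (L v) * ee L (t - r) v * f v)
      hm1.aemeasurable] at key
  have e1 : (∫⁻ r in Set.Ioc 0 t, ∫⁻ v, ENNReal.ofReal (L v) * ee L (t - r) v * f v ∂(N r)) +
      (∫⁻ s in Set.Ioc 0 t, ∫⁻ v, (∫⁻ r in Set.Ioc s t, ENNReal.ofReal (L v) *
        (ENNReal.ofReal (L v) * ee L (t - r) v * f v)) ∂(N s)) =
      ∫⁻ s in Set.Ioc 0 t, ∫⁻ v, ENNReal.ofReal (L v) * f v ∂(N s) := by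
    rw [← lintegral_add_left mN]
    refine setLIntegral_congr_fun measurableSet_Ioc fun s hs => ?_
    have := collapse2 hL hL0 (N s) hs.2 hLf
    rw [← this, add_comm]
    simp only [mul_comm, mul_left_comm, mul_assoc]
  rw [e1] at key
  have e2 := collapse2 hL hL0 μ0 ht hf
  have hm3 := measurable_duh_integrand q hL hf t
  have e3 : (∫⁻ s in Set.Ioc 0 t, ∫⁻ v, (∫⁻ r in Set.Ioc s t,
        (ENNReal.ofReal (L v) * ee L (t - r) v * f v)) ∂(q s)) +
      (∫⁻ s in Set.Ioc 0 t, ∫⁻ v, ee L (t - s) v * f v ∂(q s)) =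
      ∫⁻ s in Set.Ioc 0 t, ∫⁻ v, f v ∂(q s) := by
    rw [← lintegral_add_right _ hm3]
    exact setLIntegral_congr_fun measurableSet_Ioc fun s hs => collapse2 hL hL0 (q s) hs.2 hf
  rw [lintegral_duh μ0 q hL t hf]
  rw [← e2, ← e3, sub_zero] at hWt
  refine (ENNReal.add_left_inj hfin).1 ?_
  rw [hWt, key]
  ring

/-- limit of a monotone sequence of measures -/
lemma exists_lim (m : ℕ → Measure V) (hm : Monotone m) :
    ∃ M : Measure V, ∀ s, MeasurableSet s → M s = ⨆ k, m k s := by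
  refine ⟨Measure.ofMeasurable (fun s _ => ⨆ k, m k s) (by simp) ?_, fun s hs => by
    rw [Measure.ofMeasurable_apply _ hs]⟩
  intro f hf hd
  simp_rw [measure_iUnion hd hf]
  rw [← lintegral_count, lintegral_iSup (fun k => measurable_of_countable _)]
  · simp_rw [lintegral_count]
  · exact fun i j hij n => hm hij _

lemma lintegral_lim {m : ℕ → Measure V} (hm : Monotone m) {M : Measure V}
    (hM : ∀ s, MeasurableSet s → M s = ⨆ k, m k s) {f : V → ℝ≥0∞} (hf : Measurable f) :
    ∫⁻ v, f v ∂M = ⨆ k, ∫⁻ v, f v ∂(m k) := by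
  refine Measurable.ennreal_induction
    (motive := fun f => ∫⁻ v, f v ∂M = ⨆ k, ∫⁻ v, f v ∂(m k)) ?_ ?_ ?_ hf
  · intro c s hs
    simp_rw [lintegral_indicator_const hs, hM s hs, ENNReal.mul_iSup]
  · intro f g hd hf hg ihf ihg
    simp only [Pi.add_apply]
    simp_rw [lintegral_add_left hf]
    rw [ihf, ihg, ENNReal.iSup_add_iSup_of_monotone]
    · exact fun i j h => lintegral_mono' (hm h) le_rfl
    · exact fun i j h => lintegral_mono' (hm h) le_rfl
  · intro f hf hmono ih
    simp_rw [lintegral_iSup hf hmono, ih]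
    rw [iSup_comm]

end Abstract2

section Abstract3
variable {V : Type*} [MeasurableSpace V] {L : V → ℝ}

/-- gain kernel -/
def qk (C : Kernel (V × V) V) (μ : Kernel ℝ V) : Kernel ℝ V := C ∘ₖ (μ ×ₖ μ)

instance (C : Kernel (V × V) V) [IsSFiniteKernel C] (μ : Kernel ℝ V) [IsSFiniteKernel μ] :
    IsSFiniteKernel (qk C μ) := by unfold qk; infer_instance

variable (C : Kernel (V × V) V) [IsSFiniteKernel C]

lemma lintegral_qk (μ : Kernel ℝ V) [IsSFiniteKernel μ] (s : ℝ) {f : V → ℝ≥0∞}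
    (hf : Measurable f) :
    ∫⁻ v, f v ∂(qk C μ s) = ∫⁻ v, ∫⁻ vs, ∫⁻ x, f x ∂(C (v, vs)) ∂(μ s) ∂(μ s) := by
  rw [qk, Kernel.lintegral_comp _ _ _ hf, Kernel.lintegral_prod _ _ _ (hf.lintegral_kernel)]

lemma qk_mono {μ μ' : Kernel ℝ V} [IsSFiniteKernel μ] [IsSFiniteKernel μ'] {s : ℝ}
    (h : μ s ≤ μ' s) : qk C μ s ≤ qk C μ' s := by
  refine Measure.le_iff.2 fun A hA => ?_
  rw [← lintegral_indicator_one hA, ← lintegral_indicator_one hA,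
    lintegral_qk C μ s (measurable_one.indicator hA),
    lintegral_qk C μ' s (measurable_one.indicator hA)]
  exact lintegral_mono' h fun v => lintegral_mono' h le_rfl

variable (L) (μ0 : Measure V) [SFinite μ0]

/-- iterates -/
def it : ℕ → Kernel ℝ V
  | 0 => 0
  | k + 1 => duh L μ0 (qk C (it k))

instance it_sfinite (k : ℕ) : IsSFiniteKernel (it L C μ0 k) := by
  induction k with
  | zero => unfold it; infer_instance
  | succ k ih => unfold it; infer_instance

lemma it_zero : it L C μ0 0 = 0 := rfl
lemma it_succ (k : ℕ) : it L C μ0 (k + 1) = duh L μ0 (qk C (it L C μ0 k)) := rfl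

variable {L}

lemma it_le_succ (hL : Measurable L) (k : ℕ) (t : ℝ) : it L C μ0 k t ≤ it L C μ0 (k + 1) t := by
  induction k generalizing t with
  | zero => rw [it_zero]; simp only [Kernel.zero_apply]; exact Measure.zero_le _
  | succ k ih =>
    rw [it_succ, it_succ]
    exact duh_mono μ0 hL fun s _ => qk_mono C (ih s)

lemma it_mono (hL : Measurable L) (t : ℝ) : Monotone fun k => it L C μ0 k t :=
  monotone_nat_of_le_succ fun k => it_le_succ C μ0 hL k t

/-- limit kernel -/
def lim (hL : Measurable L) : Kernel ℝ V where
  toFun t := Classical.choose (exists_lim _ (it_mono C μ0 hL (max t 0)))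
  measurable' := by
    refine Measure.measurable_of_measurable_coe _ fun s hs => ?_
    simp_rw [Classical.choose_spec (exists_lim _ (it_mono C μ0 hL (max _ 0))) s hs]
    refine Measurable.iSup fun k => ?_
    exact ((it L C μ0 k).measurable_coe hs).comp (measurable_id.max measurable_const)

lemma lim_apply (hL : Measurable L) {t : ℝ} (ht : 0 ≤ t) {s : Set V} (hs : MeasurableSet s) :
    lim C μ0 hL t s = ⨆ k, it L C μ0 k t s := by
  have h : lim C μ0 hL t s = ⨆ k, it L C μ0 k (max t 0) s :=
    Classical.choose_spec (exists_lim _ (it_mono C μ0 hL (max t 0))) s hs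
  rw [h, max_eq_left ht]

lemma lintegral_limk (hL : Measurable L) {t : ℝ} (ht : 0 ≤ t) {f : V → ℝ≥0∞} (hf : Measurable f) :
    ∫⁻ v, f v ∂(lim C μ0 hL t) = ⨆ k, ∫⁻ v, f v ∂(it L C μ0 k t) :=
  lintegral_lim (it_mono C μ0 hL t) (fun s hs => lim_apply C μ0 hL ht hs) hf

lemma lim_finite (hL : Measurable L) {M : ℝ≥0∞} (hM : M ≠ ∞)
    (h : ∀ k t, 0 ≤ t → it L C μ0 k t Set.univ ≤ M) : IsFiniteKernel (lim C μ0 hL) := by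
  refine ⟨⟨M, hM.lt_top, fun t => ?_⟩⟩
  have : lim C μ0 hL t = lim C μ0 hL (max t 0) := by simp [lim]
  rw [this, lim_apply C μ0 hL (le_max_right _ _) MeasurableSet.univ]
  exact iSup_le fun k => h k _ (le_max_right _ _)

lemma it_le_lim (hL : Measurable L) {t : ℝ} (ht : 0 ≤ t) (k : ℕ) :
    it L C μ0 k t ≤ lim C μ0 hL t := by
  refine Measure.le_iff.2 fun A hA => ?_
  rw [lim_apply C μ0 hL ht hA]
  exact le_iSup (fun k => it L C μ0 k t A) k

lemma lintegral_qk_lim (hL : Measurable L) [IsSFiniteKernel (lim C μ0 hL)] {s : ℝ} (hs : 0 ≤ s)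
    {f : V → ℝ≥0∞} (hf : Measurable f) :
    ∫⁻ v, f v ∂(qk C (lim C μ0 hL) s) = ⨆ k, ∫⁻ v, f v ∂(qk C (it L C μ0 k) s) := by
  rw [lintegral_qk C _ s hf]
  simp_rw [lintegral_qk C _ s hf]
  have hm : Measurable fun x : V × V => ∫⁻ y, f y ∂(C x) := hf.lintegral_kernel
  have h1 : ∀ v, ∫⁻ vs, ∫⁻ x, f x ∂(C (v, vs)) ∂(lim C μ0 hL s) =
      ⨆ k, ∫⁻ vs, ∫⁻ x, f x ∂(C (v, vs)) ∂(it L C μ0 k s) := fun v =>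
    lintegral_limk C μ0 hL hs (hm.comp (measurable_const.prodMk measurable_id))
  simp_rw [h1]
  have mj : ∀ j, Measurable fun v => ∫⁻ vs, ∫⁻ x, f x ∂(C (v, vs)) ∂(it L C μ0 j s) := fun j =>
    hm.lintegral_prod_right'
  rw [lintegral_limk C μ0 hL hs (Measurable.iSup mj)]
  have h2 : ∀ k, ∫⁻ v, ⨆ j, ∫⁻ vs, ∫⁻ x, f x ∂(C (v, vs)) ∂(it L C μ0 j s) ∂(it L C μ0 k s) =
      ⨆ j, ∫⁻ v, ∫⁻ vs, ∫⁻ x, f x ∂(C (v, vs)) ∂(it L C μ0 j s) ∂(it L C μ0 k s) := fun k =>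
    lintegral_iSup mj (fun i j hij v => lintegral_mono' (it_mono C μ0 hL s hij) le_rfl)
  simp_rw [h2]
  refine le_antisymm (iSup₂_le fun k j => ?_) (iSup_le fun k => le_iSup₂_of_le k k le_rfl)
  refine le_iSup_of_le (max k j) ?_
  exact lintegral_mono' (it_mono C μ0 hL s (le_max_left _ _)) fun v =>
    lintegral_mono' (it_mono C μ0 hL s (le_max_right _ _)) le_rfl

lemma lim_eq (hL : Measurable L) [IsSFiniteKernel (lim C μ0 hL)] {t : ℝ} (ht : 0 ≤ t) :
    lim C μ0 hL t = duh L μ0 (qk C (lim C μ0 hL)) t := by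
  refine Measure.ext_of_lintegral _ fun f hf => ?_
  rw [lintegral_limk C μ0 hL ht hf, lintegral_duh _ _ hL t hf]
  have e1 : ∫⁻ s in Set.Ioc 0 t, ∫⁻ v, ee L (t - s) v * f v ∂(qk C (lim C μ0 hL) s) =
      ⨆ k, ∫⁻ s in Set.Ioc 0 t, ∫⁻ v, ee L (t - s) v * f v ∂(qk C (it L C μ0 k) s) := by
    rw [setLIntegral_congr_fun measurableSet_Ioc (fun s hs => lintegral_qk_lim C μ0 hL hs.1.le
      (f := fun v => ee L (t - s) v * f v) ((measurable_ee_t hL _).mul hf))]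
    refine lintegral_iSup (fun k => measurable_duh_integrand _ hL hf t) ?_
    exact fun i j hij s => lintegral_mono' (qk_mono C (it_mono C μ0 hL s hij)) le_rfl
  rw [e1, ENNReal.add_iSup]
  simp_rw [← lintegral_duh μ0 _ hL t hf, ← it_succ]
  have hmono : Monotone fun k => ∫⁻ v, f v ∂(it L C μ0 k t) :=
    fun i j hij => lintegral_mono' (it_mono C μ0 hL t hij) le_rfl
  exact (hmono.iSup_nat_add 1).symm

/-- minimality -/
lemma it_le_of_mild (hL : Measurable L) (N : Kernel ℝ V) [IsSFiniteKernel N]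
    (hN : ∀ t, 0 ≤ t → N t = duh L μ0 (qk C N) t) (k : ℕ) {t : ℝ} (ht : 0 ≤ t) :
    it L C μ0 k t ≤ N t := by
  induction k generalizing t with
  | zero => rw [it_zero]; simp only [Kernel.zero_apply]; exact Measure.zero_le _
  | succ k ih =>
    rw [it_succ, hN t ht]
    exact duh_mono μ0 hL fun s hs => qk_mono C (ih hs.1.le)

lemma lim_le_of_mild (hL : Measurable L) (N : Kernel ℝ V) [IsSFiniteKernel N]
    (hN : ∀ t, 0 ≤ t → N t = duh L μ0 (qk C N) t) {t : ℝ} (ht : 0 ≤ t) :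
    lim C μ0 hL t ≤ N t := by
  refine Measure.le_iff.2 fun A hA => ?_
  rw [lim_apply C μ0 hL ht hA]
  exact iSup_le fun k => it_le_of_mild C μ0 hL N hN k ht A

/-- Conservation Gronwall. -/
lemma gronwall_zero {z g : ℝ → ℝ≥0∞} (hg : Measurable g) (hz : Measurable z) {T : ℝ}
    (hzt : ∀ t, z t ≠ ∞)
    (hgT : ∫⁻ s in Set.Ioc 0 T, g s ≠ ∞)
    (h : ∀ t ∈ Set.Icc 0 T, z t ≤ ∫⁻ s in Set.Ioc 0 t, g s * z s)
    (hmono : ∀ s t, 0 ≤ s → s ≤ t → t ≤ T → z s ≤ z t) :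
    ∀ t ∈ Set.Icc 0 T, z t = 0 := by
  by_contra hcon
  push Not at hcon
  obtain ⟨t1, ht1, hz1⟩ := hcon
  set S : Set ℝ := {t | t ∈ Set.Icc 0 T ∧ z t ≠ 0} with hS
  have hSne : S.Nonempty := ⟨t1, ht1, hz1⟩
  have hSb : BddBelow S := ⟨0, fun t ht => ht.1.1⟩
  set t0 := sInf S with ht0
  have h0 : 0 ≤ t0 := le_csInf hSne fun t ht => ht.1.1
  have hlt : ∀ s, 0 ≤ s → s ≤ T → s < t0 → z s = 0 := by
    intro s hs hsT hst
    by_contra hne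
    exact absurd (csInf_le hSb (show s ∈ S from ⟨⟨hs, hsT⟩, hne⟩)) (not_le.2 hst)
  have hgt : ∀ t, t0 < t → t ≤ T → z t ≠ 0 := by
    intro t htt htT
    obtain ⟨r, hr, hrt⟩ := exists_lt_of_csInf_lt hSne htt
    have := hmono r t hr.1.1 hrt.le htT
    exact fun h0 => hr.2 (le_antisymm (h0 ▸ this) (zero_le))
  have hbound : ∀ t ∈ S, z t ≤ (∫⁻ s in Set.Ioc t0 t, g s) * z t := by
    intro t ht
    have ht0t : t0 ≤ t := csInf_le hSb ht
    calc z t ≤ ∫⁻ s in Set.Ioc 0 t, g s * z s := h t ht.1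
      _ = ∫⁻ s in Set.Ioc 0 t0 ∪ Set.Ioc t0 t, g s * z s := by
          rw [Set.Ioc_union_Ioc_eq_Ioc h0 ht0t]
      _ ≤ (∫⁻ s in Set.Ioc 0 t0, g s * z s) + ∫⁻ s in Set.Ioc t0 t, g s * z s :=
          lintegral_union_le _ _ _
      _ = ∫⁻ s in Set.Ioc t0 t, g s * z s := by
          have : ∫⁻ s in Set.Ioc 0 t0, g s * z s = 0 := by
            rw [setLIntegral_congr Ioo_ae_eq_Ioc.symm,
              setLIntegral_congr_fun (g := fun _ => 0) measurableSet_Ioo, lintegral_zero]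
            intro s hs
            simp [hlt s hs.1.le (hs.2.le.trans (ht0t.trans ht.1.2)) hs.2]
          rw [this, zero_add]
      _ ≤ ∫⁻ s in Set.Ioc t0 t, g s * z t := by
          refine setLIntegral_mono' measurableSet_Ioc fun s hs => ?_
          gcongr
          exact hmono s t (h0.trans hs.1.le) hs.2 ht.1.2
      _ = _ := lintegral_mul_const _ hg
  have hone : ∀ t ∈ S, 1 ≤ ∫⁻ s in Set.Ioc t0 t, g s := by
    intro t ht
    by_contra hlt1
    push Not at hlt1
    have := hbound t ht
    have h2 : (∫⁻ s in Set.Ioc t0 t, g s) * z t < 1 * z t :=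
      ENNReal.mul_lt_mul_left ht.2 (hzt t) hlt1
    rw [one_mul] at h2
    exact absurd this (not_le.2 h2)
  have ht01 : t0 < t1 := by
    rcases lt_or_eq_of_le (csInf_le hSb (show t1 ∈ S from ⟨ht1, hz1⟩)) with h | h
    · exact h
    · have := hone t1 ⟨ht1, hz1⟩
      rw [← ht0] at h
      rw [h] at this
      simp at this
  -- continuity from above
  have hfin : ∫⁻ s in Set.Ioc t0 t1, g s ≠ ∞ :=
    ne_top_of_le_ne_top hgT (lintegral_mono_set (Set.Ioc_subset_Ioc h0 ht1.2))
  obtain ⟨δ, hδ, hδ'⟩ := exists_pos_setLIntegral_lt_of_measure_lt hfin (ε := 1) one_ne_zero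
  set η : ℝ := min (t1 - t0) (if δ = ∞ then 1 else δ.toReal / 2) with hη
  have hη0 : 0 < η := by
    refine lt_min (by linarith) ?_
    split_ifs with hd
    · norm_num
    · have := ENNReal.toReal_pos hδ.ne' hd; linarith
  have hηδ : ENNReal.ofReal η < δ := by
    by_cases hd : δ = ∞
    · rw [hd]; exact ENNReal.ofReal_lt_top
    · rw [ENNReal.ofReal_lt_iff_lt_toReal hη0.le hd]
      have := ENNReal.toReal_pos hδ.ne' hd
      calc η ≤ δ.toReal / 2 := (min_le_right _ _).trans (by simp [hd])
        _ < _ := by linarith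
  have hle : t0 + η ≤ t1 := by have := min_le_left (t1 - t0) (if δ = ∞ then 1 else δ.toReal / 2); linarith
  have hmem : t0 + η ∈ S := ⟨⟨by linarith, hle.trans ht1.2⟩, hgt _ (by linarith) (hle.trans ht1.2)⟩
  have hk := hδ' (Set.Ioc t0 (t0 + η)) (by
    refine lt_of_le_of_lt (Measure.restrict_apply_le _ _) ?_
    rw [Real.volume_Ioc]; simpa using hηδ)
  rw [Measure.restrict_restrict measurableSet_Ioc, Set.inter_eq_left.2 (Set.Ioc_subset_Ioc le_rfl hle)] at hk
  exact absurd (hone _ hmem) (not_le.2 hk)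

end Abstract3

section Concrete
variable {d : ℕ}

def ell (v : Vd d) : ℝ := 1 + ‖v‖
def ww (v : Vd d) : ℝ := 1 + ‖v‖ ^ 2
def LL (v : Vd d) : ℝ := 4 * (1 + ‖v‖)

lemma measurable_ell : Measurable (ell (d := d)) := by unfold ell; fun_prop
lemma measurable_ww : Measurable (ww (d := d)) := by unfold ww; fun_prop
lemma measurable_LL : Measurable (LL (d := d)) := by unfold LL; fun_prop
lemma LL_nonneg (v : Vd d) : 0 ≤ LL v := by unfold LL; positivity
lemma ell_pos (v : Vd d) : 0 < ell v := by unfold ell; positivity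
lemma ell_ge (v : Vd d) : 1 ≤ ell v := by unfold ell; linarith [norm_nonneg v]
lemma ww_pos (v : Vd d) : 0 < ww v := by unfold ww; positivity
lemma ww_ge (v : Vd d) : 1 ≤ ww v := by unfold ww; nlinarith [sq_nonneg ‖v‖]

lemma norm_sub_le_Lam (v vs : Vd d) : ‖v - vs‖ ≤ ell v * ww vs := by
  have := norm_sub_le v vs
  unfold ell ww
  nlinarith [norm_nonneg v, norm_nonneg vs, mul_nonneg (norm_nonneg v) (sq_nonneg ‖vs‖), sq_nonneg (‖vs‖ - 1)]

/-- normalised direction -/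
def nrm (e0 v : Vd d) : Vd d := if v = 0 then e0 else ‖v‖⁻¹ • v

lemma measurable_nrm (e0 : Vd d) : Measurable (nrm e0) := by
  unfold nrm
  refine Measurable.ite (measurableSet_singleton 0) measurable_const (by fun_prop)

lemma norm_nrm {e0 : Vd d} (he : ‖e0‖ = 1) (v : Vd d) : ‖nrm e0 v‖ = 1 := by
  unfold nrm
  split_ifs with h
  · exact he
  · rw [norm_smul, norm_inv, norm_norm, inv_mul_cancel₀ (norm_ne_zero_iff.2 h)]

variable {B : Vd d → Measure (Vd d)} (hB : IsCollisionKernel B) (e0 : Vd d)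

/-- normalised kernel -/
def Bh : Kernel (Vd d) (Vd d) where
  toFun v := B (nrm e0 v)
  measurable' := Measure.measurable_of_measurable_coe _ fun s hs =>
    (hB.measurable s hs).comp (measurable_nrm e0)

lemma Bh_apply (v : Vd d) : Bh hB e0 v = B (nrm e0 v) := rfl

variable {e0} in
instance Bh_markov [hF : Fact (‖e0‖ = 1)] : IsMarkovKernel (Bh hB e0) :=
  ⟨fun v => hB.prob _ (norm_nrm hF.out v)⟩

variable {e0} in
lemma Bh_norm [hF : Fact (‖e0‖ = 1)] (v : Vd d) : ∀ᵐ σ ∂(Bh hB e0 v), ‖σ‖ = 1 := by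
  have := hB.support _ (norm_nrm hF.out v)
  rw [ae_iff, Bh_apply]
  refine measure_mono_null ?_ this
  intro σ hσ
  simp only [Set.mem_compl_iff, Set.mem_diff, not_and, unitSphere, Set.mem_ofPred_eq] at hσ ⊢
  exact fun h => absurd h hσ

variable {e0} in
lemma B_eq [hF : Fact (‖e0‖ = 1)] (v : Vd d) : B v = ENNReal.ofReal ‖v‖ • Bh hB e0 v := by
  rw [Bh_apply, ← hB.scaling _ (norm_nonneg v) _ (norm_nrm hF.out v)]
  congr 1
  unfold nrm
  split_ifs with h
  · simp [h]
  · rw [smul_smul, mul_inv_cancel₀ (norm_ne_zero_iff.2 h), one_smul]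

variable {e0} in
lemma Bh_neg [hF : Fact (‖e0‖ = 1)] {u : Vd d} (hu : u ≠ 0) :
    Bh hB e0 (-u) = (Bh hB e0 u).map (fun x => -x) := by
  rw [Bh_apply, Bh_apply]
  have h := hB.symm (LinearIsometryEquiv.neg ℝ) _ (norm_nrm hF.out u)
  have e : nrm e0 (-u) = LinearIsometryEquiv.neg ℝ (nrm e0 u) := by
    simp [nrm, hu]
  rw [e, h]
  rfl

lemma measurable_postV : Measurable fun y : (Vd d × Vd d) × Vd d => postV y.1.1 y.1.2 y.2 := by
  unfold postV; fun_prop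

lemma measurable_postV' (v vs : Vd d) : Measurable (postV v vs) := by
  unfold postV; fun_prop
lemma measurable_postVs' (v vs : Vd d) : Measurable (postVs v vs) := by
  unfold postVs; fun_prop

variable [hF : Fact (‖e0‖ = 1)]

/-- Markov collision kernel -/
def Mk : Kernel (Vd d × Vd d) (Vd d) :=
  ((Kernel.id ×ₖ (Bh hB e0).comap (fun x : Vd d × Vd d => x.1 - x.2) (by fun_prop))).map
    (fun y : (Vd d × Vd d) × Vd d => postV y.1.1 y.1.2 y.2)

instance Mk_markov : IsMarkovKernel (Mk hB e0) := by
  unfold Mk; exact Kernel.IsMarkovKernel.map _ measurable_postV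

/-- identity part -/
def Dk (d : ℕ) : Kernel (Vd d × Vd d) (Vd d) :=
  Kernel.deterministic (fun x : Vd d × Vd d => x.1) measurable_fst

instance Dk_markov : IsMarkovKernel (Dk d) := by unfold Dk; infer_instance

lemma lintegral_Dk (v vs : Vd d) {f : Vd d → ℝ≥0∞} (hf : Measurable f) :
    ∫⁻ x, f x ∂(Dk d (v, vs)) = f v := by
  rw [Dk, Kernel.deterministic_apply, lintegral_dirac' _ hf]

/-- collision kernel -/
def CC : Kernel (Vd d × Vd d) (Vd d) :=
  (Mk hB e0).withDensity (fun x _ => ENNReal.ofReal (2 * ‖x.1 - x.2‖)) +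
  (Dk d).withDensity
    (fun x _ => ENNReal.ofReal (2 * (ell x.1 * ww x.2 - ‖x.1 - x.2‖)))

variable {e0}

instance CC_sfinite : IsSFiniteKernel (CC hB e0) := by
  unfold CC
  have h1 : IsSFiniteKernel ((Mk hB e0).withDensity (fun x _ => ENNReal.ofReal (2 * ‖x.1 - x.2‖))) :=
    Kernel.IsSFiniteKernel.withDensity _ (fun _ _ => ENNReal.ofReal_ne_top)
  have h2 : IsSFiniteKernel ((Dk d).withDensity
    (fun x _ => ENNReal.ofReal (2 * (ell x.1 * ww x.2 - ‖x.1 - x.2‖)))) :=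
    Kernel.IsSFiniteKernel.withDensity _ (fun _ _ => ENNReal.ofReal_ne_top)
  infer_instance

lemma lintegral_Mk (v vs : Vd d) {f : Vd d → ℝ≥0∞} (hf : Measurable f) :
    ∫⁻ x, f x ∂(Mk hB e0 (v, vs)) = ∫⁻ σ, f (postV v vs σ) ∂(Bh hB e0 (v - vs)) := by
  rw [Mk, Kernel.lintegral_map _ measurable_postV _ hf,
    Kernel.lintegral_prod _ _ _ (g := fun a : (Vd d × Vd d) × Vd d => f (postV a.1.1 a.1.2 a.2)) (hf.comp measurable_postV)]
  have m : Measurable fun b : Vd d × Vd d => ∫⁻ c, f (postV (b, c).1.1 (b, c).1.2 (b, c).2)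
      ∂((Bh hB e0).comap (fun x : Vd d × Vd d => x.1 - x.2) (by fun_prop)) (v, vs) :=
    (hf.comp measurable_postV).lintegral_prod_right'
  rw [Kernel.id_apply, lintegral_dirac' _ m, Kernel.comap_apply]

lemma lintegral_CC (v vs : Vd d) {f : Vd d → ℝ≥0∞} (hf : Measurable f) :
    ∫⁻ x, f x ∂(CC hB e0 (v, vs)) =
      ENNReal.ofReal (2 * ‖v - vs‖) * ∫⁻ σ, f (postV v vs σ) ∂(Bh hB e0 (v - vs)) +
      ENNReal.ofReal (2 * (ell v * ww vs - ‖v - vs‖)) * f v := by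
  have m1 := measurable_ell (d := d)
  have m2 := measurable_ww (d := d)
  rw [CC, add_apply, lintegral_add_measure,
    Kernel.lintegral_withDensity _ (by fun_prop) _ hf,
    Kernel.lintegral_withDensity _ (by fun_prop) _ hf,
    lintegral_const_mul _ hf, lintegral_const_mul _ hf, lintegral_Mk hB v vs hf,
    lintegral_Dk v vs hf]

lemma lintegral_swap (v vs : Vd d) {f : Vd d → ℝ≥0∞} (hf : Measurable f) :
    ∫⁻ σ, f (postV vs v σ) ∂(Bh hB e0 (vs - v)) = ∫⁻ σ, f (postVs v vs σ) ∂(Bh hB e0 (v - vs)) := by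
  by_cases h : v = vs
  · subst h; simp [postV, postVs]
  · rw [← neg_sub v vs, Bh_neg hB (sub_ne_zero.2 h),
      lintegral_map (f := fun σ => f (postV vs v σ)) (hf.comp (measurable_postV' _ _)) measurable_neg]
    congr 1 with σ
    congr 1
    simp only [postV, postVs, norm_sub_rev vs v, add_comm vs v, smul_neg]
    rw [← sub_eq_add_neg]

/-- average of `f' + f*'` -/
def PP (e0 : Vd d) (f : Vd d → ℝ≥0∞) (v vs : Vd d) : ℝ≥0∞ :=
  ∫⁻ σ, (f (postV v vs σ) + f (postVs v vs σ)) ∂(Bh hB e0 (v - vs))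

lemma CC_sym (v vs : Vd d) {f : Vd d → ℝ≥0∞} (hf : Measurable f) :
    ∫⁻ x, f x ∂(CC hB e0 (v, vs)) + ∫⁻ x, f x ∂(CC hB e0 (vs, v)) =
      ENNReal.ofReal (2 * ‖v - vs‖) * PP hB e0 f v vs +
      (ENNReal.ofReal (2 * (ell v * ww vs - ‖v - vs‖)) * f v +
      ENNReal.ofReal (2 * (ell vs * ww v - ‖v - vs‖)) * f vs) := by
  rw [lintegral_CC hB v vs hf, lintegral_CC hB vs v hf, lintegral_swap hB v vs hf, PP,
    lintegral_add_left (f := fun σ => f (postV v vs σ)) (hf.comp (measurable_postV' _ _)), norm_sub_rev vs v]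
  ring

lemma two_int (μ : Measure (Vd d)) [SFinite μ] {g : Vd d → Vd d → ℝ≥0∞}
    (hg : Measurable (Function.uncurry g)) :
    2 * ∫⁻ v, ∫⁻ vs, g v vs ∂μ ∂μ = ∫⁻ v, ∫⁻ vs, (g v vs + g vs v) ∂μ ∂μ := by
  have h1 : ∀ v, ∫⁻ vs, (g v vs + g vs v) ∂μ = ∫⁻ vs, g v vs ∂μ + ∫⁻ vs, g vs v ∂μ := fun v =>
    lintegral_add_left (hg.comp (measurable_const.prodMk measurable_id)) _
  simp_rw [h1]
  rw [lintegral_add_left (f := fun v => ∫⁻ vs, g v vs ∂μ) (hg.lintegral_prod_right'), two_mul]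
  congr 1
  exact lintegral_lintegral_swap hg.aemeasurable

lemma measurable_CCf {f : Vd d → ℝ≥0∞} (hf : Measurable f) :
    Measurable (Function.uncurry fun v vs => ∫⁻ x, f x ∂(CC hB e0 (v, vs))) :=
  hf.lintegral_kernel

/-- collision-invariant functions -/
def Inv (f : Vd d → ℝ≥0∞) : Prop :=
  ∀ v vs σ : Vd d, ‖σ‖ = 1 → f (postV v vs σ) + f (postVs v vs σ) = f v + f vs

lemma PP_inv {f : Vd d → ℝ≥0∞} (hf : Inv f) (v vs : Vd d) :
    PP hB e0 f v vs = f v + f vs := by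
  rw [PP, lintegral_congr_ae ((Bh_norm hB (v - vs)).mono fun σ hσ => hf v vs σ hσ)]
  simp

lemma ofReal_split (v vs : Vd d) : ENNReal.ofReal (2 * ‖v - vs‖) +
    ENNReal.ofReal (2 * (ell v * ww vs - ‖v - vs‖)) = 2 * (ENNReal.ofReal (ell v) * ENNReal.ofReal (ww vs)) := by
  have := norm_sub_le_Lam v vs
  rw [← ENNReal.ofReal_mul (ell_pos v).le, ← ENNReal.ofReal_add (by positivity) (by linarith),
    show 2 * ‖v - vs‖ + 2 * (ell v * ww vs - ‖v - vs‖) = 2 * (ell v * ww vs) by ring,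
    ENNReal.ofReal_mul (by norm_num), ENNReal.ofReal_ofNat]

lemma int_Lam (μ : Measure (Vd d)) [SFinite μ] {f : Vd d → ℝ≥0∞} (hf : Measurable f) :
    ∫⁻ v, ∫⁻ vs, ENNReal.ofReal (ell v) * f v * ENNReal.ofReal (ww vs) ∂μ ∂μ =
    (∫⁻ v, ENNReal.ofReal (ell v) * f v ∂μ) * ∫⁻ v, ENNReal.ofReal (ww v) ∂μ := by
  have m1 := measurable_ell (d := d)
  have m2 := measurable_ww (d := d)
  simp_rw [lintegral_const_mul _ m2.ennreal_ofReal]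
  rw [lintegral_mul_const (f := fun v => ENNReal.ofReal (ell v) * f v) _ (m1.ennreal_ofReal.mul hf)]

lemma two_cancel {a b : ℝ≥0∞} (h : 2 * a = 2 * b) : a = b :=
  (ENNReal.mul_right_inj (by norm_num) (by norm_num)).1 h

lemma two_cancel_le {a b : ℝ≥0∞} (h : 2 * a ≤ 2 * b) : a ≤ b :=
  (ENNReal.mul_le_mul_iff_right (by norm_num) (by norm_num)).1 h

lemma int_CC_inv (μ : Measure (Vd d)) [SFinite μ] {f : Vd d → ℝ≥0∞}
    (hf : Measurable f) (hi : Inv f) :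
    ∫⁻ v, ∫⁻ vs, ∫⁻ x, f x ∂(CC hB e0 (v, vs)) ∂μ ∂μ =
      2 * ((∫⁻ v, ENNReal.ofReal (ell v) * f v ∂μ) * ∫⁻ v, ENNReal.ofReal (ww v) ∂μ) := by
  have m1 := measurable_ell (d := d)
  have m2 := measurable_ww (d := d)
  apply two_cancel
  rw [two_int μ (measurable_CCf hB hf), ← int_Lam μ hf]
  have mm : Measurable (Function.uncurry fun v vs : Vd d => ENNReal.ofReal (ell v) * f v * ENNReal.ofReal (ww vs)) := by
    unfold Function.uncurry; fun_prop
  have mm2 : Measurable (Function.uncurry fun v vs : Vd d => 2 * (ENNReal.ofReal (ell v) * f v * ENNReal.ofReal (ww vs))) := by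
    unfold Function.uncurry; fun_prop
  have key : (2:ℝ≥0∞) * ∫⁻ v, ∫⁻ vs, ENNReal.ofReal (ell v) * f v * ENNReal.ofReal (ww vs) ∂μ ∂μ
     = ∫⁻ v, ∫⁻ vs, 2 * (ENNReal.ofReal (ell v) * f v * ENNReal.ofReal (ww vs)) ∂μ ∂μ := by
    rw [← lintegral_const_mul (f := fun v => ∫⁻ vs, ENNReal.ofReal (ell v) * f v * ENNReal.ofReal (ww vs) ∂μ) _ mm.lintegral_prod_right']
    refine lintegral_congr fun v => ?_
    rw [← lintegral_const_mul (f := fun vs => ENNReal.ofReal (ell v) * f v * ENNReal.ofReal (ww vs)) _ (by fun_prop)]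
  rw [key, two_int μ (g := fun v vs => 2 * (ENNReal.ofReal (ell v) * f v * ENNReal.ofReal (ww vs))) mm2]
  refine lintegral_congr fun v => lintegral_congr fun vs => ?_
  rw [CC_sym hB v vs hf, PP_inv hB hi]
  have h1 := ofReal_split v vs
  have h2 := ofReal_split vs v
  rw [norm_sub_rev vs v] at h2
  calc _ = (ENNReal.ofReal (2 * ‖v - vs‖) + ENNReal.ofReal (2 * (ell v * ww vs - ‖v - vs‖))) * f v +
      (ENNReal.ofReal (2 * ‖v - vs‖) + ENNReal.ofReal (2 * (ell vs * ww v - ‖v - vs‖))) * f vs := by ring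
    _ = _ := by rw [h1, h2]; ring

end Concrete

section Pov
variable {d : ℕ}

lemma rpow_split {q x : ℝ} (hq : 1 < q) (hx0 : 0 < x) (hx1 : x < 1) :
    x ^ q ≤ x - min (q - 1) 1 * (x * (1 - x)) := by
  set α := min (q - 1) 1
  have hα0 : 0 ≤ α := le_min (by linarith) (by norm_num)
  have h1 : x ^ q = x * x ^ (q - 1) := by
    rw [← Real.rpow_one_add' hx0.le (by linarith)]; congr 1; ring
  have h2 : x ^ (q - 1) ≤ x ^ α :=
    Real.rpow_le_rpow_of_exponent_ge hx0 hx1.le (min_le_left _ _)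
  have h3 := rpow_one_add_le_one_add_mul_self (s := x - 1) (p := α) (by linarith) hα0 (min_le_right _ _)
  rw [show 1 + (x - 1) = x by ring] at h3
  rw [h1]
  nlinarith [mul_le_mul_of_nonneg_left (h2.trans h3) hx0.le]

lemma two_rpow {q a b : ℝ} (hq : 1 < q) (ha : 0 < a) (hb : 0 < b) :
    a ^ q + b ^ q ≤ (a + b) ^ q * (1 - min (q - 1) 1 / 2 * (1 - |a - b| / (a + b))) := by
  set α := min (q - 1) 1
  have hα0 : 0 ≤ α := le_min (by linarith) (by norm_num)
  have hs : 0 < a + b := by linarith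
  set x := a / (a + b)
  have hx0 : 0 < x := by positivity
  have hx1 : x < 1 := by rw [div_lt_one hs]; linarith
  have e1 : b / (a + b) = 1 - x := by simp only [x]; field_simp; ring
  have ea : a ^ q = (a + b) ^ q * x ^ q := by
    rw [← Real.mul_rpow hs.le hx0.le]; congr 1; simp only [x]; field_simp
  have eb : b ^ q = (a + b) ^ q * (1 - x) ^ q := by
    rw [← Real.mul_rpow hs.le (by linarith), ← e1]; congr 1; field_simp
  have h1 := rpow_split hq hx0 hx1
  have h2 := rpow_split hq (x := 1 - x) (by linarith) (by linarith)
  have eh : |a - b| / (a + b) = |2 * x - 1| := by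
    have : 2 * x - 1 = (a - b) / (a + b) := by simp only [x]; field_simp; ring
    rw [this, abs_div, abs_of_pos hs]
  rw [ea, eb, eh, ← mul_add]
  gcongr
  have h3 : |2 * x - 1| ≤ 1 := abs_le.2 ⟨by linarith, by linarith⟩
  have h4 : |2 * x - 1| ^ 2 = (2 * x - 1) ^ 2 := sq_abs _
  have h5 : 1 - |2 * x - 1| ≤ 4 * (x * (1 - x)) := by
    nlinarith [abs_nonneg (2 * x - 1)]
  have h6 := mul_le_mul_of_nonneg_left h5 hα0
  linarith

lemma rpow_add_le {q a b : ℝ} (hq : 1 < q) (ha : 0 < a) (hb : 0 < b) (hab : b ≤ a) :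
    (a + b) ^ q ≤ a ^ q + 2 ^ q * (a ^ (q - 1) * b) := by
  have hc := @(convexOn_rpow hq.le).2 1 (show (1:ℝ) ∈ Set.Ici 0 by simp) 2 (show (2:ℝ) ∈ Set.Ici 0 by simp)
    (1 - b / a) (b / a) (by rw [sub_nonneg, div_le_one ha]; exact hab) (by positivity) (by ring)
  simp only [smul_eq_mul, Real.one_rpow, mul_one] at hc
  have e : (a + b) = a * (1 - b / a + b / a * 2) := by field_simp; ring
  have hp : 0 ≤ 1 - b / a + b / a * 2 := by
    have : 0 < b / a := by positivity
    linarith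
  rw [e, Real.mul_rpow ha.le hp]
  have e2 : a ^ q = a ^ (q - 1) * a := by rw [← Real.rpow_add_one ha.ne']; congr 1; ring
  have h1 := mul_le_mul_of_nonneg_left hc (Real.rpow_nonneg ha.le q)
  refine h1.trans ?_
  have h2 : a ^ q * (b / a) = a ^ (q - 1) * b := by rw [e2]; field_simp
  have h3 : 0 ≤ a ^ (q - 1) * b := by positivity
  rw [← h2] at h3 ⊢
  linarith

lemma norm_sub_le_ww {v vs : Vd d} (h : ‖vs‖ ≤ ‖v‖) : ‖v - vs‖ ≤ ww v := by
  have := norm_sub_le v vs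
  unfold ww
  nlinarith [sq_nonneg (‖v‖ - 1)]

lemma pov_aux {q : ℝ} (hq : 1 < q) {v vs : Vd d} (h : ‖vs‖ ≤ ‖v‖) :
    ‖v - vs‖ * (ww v + ww vs) ^ q ≤ ‖v - vs‖ * (ww v ^ q + ww vs ^ q) +
      2 ^ q * (ww v ^ q * ww vs) := by
  have hw := ww_pos v
  have hws := ww_pos vs
  have hle : ww vs ≤ ww v := by unfold ww; gcongr
  have h1 := rpow_add_le hq hw hws hle
  have h2 := norm_sub_le_ww h
  have e2 : ww v ^ q = ww v ^ (q - 1) * ww v := by rw [← Real.rpow_add_one hw.ne']; congr 1; ring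
  have h3 := mul_le_mul_of_nonneg_left h1 (norm_nonneg (v - vs))
  have h4 : ‖v - vs‖ * (2 ^ q * (ww v ^ (q - 1) * ww vs)) ≤ 2 ^ q * (ww v ^ q * ww vs) := by
    rw [e2]
    have : 0 ≤ 2 ^ q * (ww v ^ (q - 1) * ww vs) := by positivity
    have := mul_le_mul_of_nonneg_right h2 this
    calc _ ≤ _ := this
      _ = _ := by ring
  have h5 : 0 ≤ ‖v - vs‖ * ww vs ^ q := by positivity
  nlinarith

lemma pov_basic {q : ℝ} (hq : 1 < q) (v vs : Vd d) :
    ‖v - vs‖ * (ww v + ww vs) ^ q ≤ ‖v - vs‖ * (ww v ^ q + ww vs ^ q) +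
      2 ^ q * (ww v ^ q * ww vs + ww vs ^ q * ww v) := by
  have p1 : 0 ≤ 2 ^ q * (ww vs ^ q * ww v) := by have := ww_pos v; have := ww_pos vs; positivity
  have p2 : 0 ≤ 2 ^ q * (ww v ^ q * ww vs) := by have := ww_pos v; have := ww_pos vs; positivity
  rcases le_total ‖vs‖ ‖v‖ with h | h
  · have := pov_aux hq h; linarith
  · have := pov_aux hq h
    rw [norm_sub_rev, add_comm (ww vs), add_comm (ww vs ^ q)] at this
    linarith

lemma norm_postV_sq (v vs : Vd d) {σ : Vd d} (hσ : ‖σ‖ = 1) :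
    2 * ‖postV v vs σ‖ ^ 2 = ‖v‖ ^ 2 + ‖vs‖ ^ 2 + ‖v - vs‖ * inner ℝ (v + vs) (σ) := by
  rw [postV, norm_add_sq_real, norm_smul, norm_smul, real_inner_smul_left, real_inner_smul_right, hσ]
  have := parallelogram_law_with_norm ℝ v vs
  simp only [norm_mul, norm_norm, norm_inv, Real.norm_ofNat]
  nlinarith

lemma norm_postVs_sq (v vs : Vd d) {σ : Vd d} (hσ : ‖σ‖ = 1) :
    2 * ‖postVs v vs σ‖ ^ 2 = ‖v‖ ^ 2 + ‖vs‖ ^ 2 - ‖v - vs‖ * inner ℝ (v + vs) (σ) := by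
  rw [postVs, norm_sub_sq_real, norm_smul, norm_smul, real_inner_smul_left, real_inner_smul_right, hσ]
  have := parallelogram_law_with_norm ℝ v vs
  simp only [norm_mul, norm_norm, norm_inv, Real.norm_ofNat]
  nlinarith

lemma ww_sum (v vs : Vd d) {σ : Vd d} (hσ : ‖σ‖ = 1) :
    ww (postV v vs σ) + ww (postVs v vs σ) = ww v + ww vs := by
  have := norm_postV_sq v vs hσ
  have := norm_postVs_sq v vs hσ
  unfold ww; linarith

lemma pov_pt {q : ℝ} (hq : 1 < q) (v vs : Vd d) {σ : Vd d} (hσ : ‖σ‖ = 1) :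
    ww (postV v vs σ) ^ q + ww (postVs v vs σ) ^ q ≤
      (ww v + ww vs) ^ q * (1 - min (q - 1) 1 / 2 * (1 - ‖v - vs‖ * |inner ℝ (v + vs) (σ)| / (ww v + ww vs))) := by
  have h := two_rpow hq (ww_pos (postV v vs σ)) (ww_pos (postVs v vs σ))
  rw [ww_sum v vs hσ] at h
  have e : |ww (postV v vs σ) - ww (postVs v vs σ)| = ‖v - vs‖ * |inner ℝ (v + vs) (σ)| := by
    have h1 := norm_postV_sq v vs hσ
    have h2 := norm_postVs_sq v vs hσ
    have h3 : ww (postV v vs σ) - ww (postVs v vs σ) = ‖v - vs‖ * inner ℝ (v + vs) σ := by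
      unfold ww; linarith
    rw [h3, abs_mul, abs_norm]
  rwa [e] at h

variable {B : Vd d → Measure (Vd d)} (hB : IsCollisionKernel B)

lemma bet_const {B : Vd d → Measure (Vd d)} (hB : IsCollisionKernel B) {u u' : Vd d}
    (hu : ‖u‖ = 1) (hu' : ‖u'‖ = 1) :
    ∫ σ, |inner ℝ u' σ| ∂(B u') = ∫ σ, |inner ℝ u σ| ∂(B u) := by
  have hr : (ℝ ∙ (u - u'))ᗮ.reflection u = u' := Submodule.reflection_sub (hu.trans hu'.symm)
  set R := (ℝ ∙ (u - u'))ᗮ.reflection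
  have hs := hB.symm R u hu
  rw [← hr, hs, integral_map R.continuous.measurable.aemeasurable
    (by apply Measurable.aestronglyMeasurable; fun_prop)]
  simp only [LinearIsometryEquiv.inner_map_map]

lemma bet_lt {B : Vd d → Measure (Vd d)} (hB : IsCollisionKernel B) {u : Vd d} (hu : ‖u‖ = 1) :
    ∫ σ, |inner ℝ u σ| ∂(B u) < 1 := by
  have hp := hB.prob u hu
  have hsup := hB.support u hu
  have hae : ∀ᵐ σ ∂(B u), 0 < 1 - |inner ℝ u σ| := by
    rw [ae_iff]
    refine measure_mono_null ?_ hsup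
    intro σ hσ
    simp only [Set.mem_ofPred_eq, not_lt, sub_nonpos] at hσ
    intro hσ2
    obtain ⟨h1, h2⟩ := hσ2
    simp only [unitSphere, Set.mem_ofPred_eq] at h1
    simp only [Set.mem_insert_iff, Set.mem_singleton_iff, not_or] at h2
    have hle := abs_real_inner_le_norm u σ
    rw [hu, h1, one_mul] at hle
    have heq : |inner ℝ u σ| = 1 := le_antisymm hle hσ
    rcases (abs_eq (zero_le_one' ℝ)).1 heq with h | h
    · exact h2.1 ((inner_eq_one_iff_of_norm_eq_one hu h1).1 h).symm
    · have : inner ℝ (-u) σ = 1 := by rw [inner_neg_left, h, neg_neg]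
      exact h2.2 ((inner_eq_one_iff_of_norm_eq_one (by rwa [norm_neg]) h1).1 this).symm
  have hint : Integrable (fun σ => |inner ℝ u σ|) (B u) := by
    refine Integrable.of_bound (by apply Measurable.aestronglyMeasurable; fun_prop) 1 ?_
    filter_upwards [hae] with σ hσ
    rw [Real.norm_eq_abs, abs_abs]; linarith
  have hpos : 0 < ∫ σ, (1 - |inner ℝ u σ|) ∂(B u) := by
    rw [integral_pos_iff_support_of_nonneg_ae (hae.mono fun σ h => h.le) ((integrable_const 1).sub hint)]
    have : B u (Function.support fun σ => 1 - |inner ℝ u σ|) = 1 := by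
      rw [← prob_compl_eq_zero_iff₀]
      · refine measure_mono_null ?_ (ae_iff.1 hae)
        intro σ hσ
        simp only [Set.mem_compl_iff, Function.mem_support, not_not] at hσ
        simp only [Set.mem_ofPred_eq, not_lt]; exact hσ.le
      · exact (measurableSet_support (by fun_prop)).nullMeasurableSet
    rw [this]; norm_num
  rw [integral_sub (integrable_const 1) hint] at hpos
  simp at hpos
  exact hpos

variable {e0 : Vd d} [hF : Fact (‖e0‖ = 1)]

lemma exists_beta : ∃ β : ℝ, 0 ≤ β ∧ β < 1 ∧ ∀ w : Vd d,
    ∫ σ, |inner ℝ w σ| ∂(Bh hB e0 w) = ‖w‖ * β := by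
  refine ⟨∫ σ, |inner ℝ e0 σ| ∂(B e0), integral_nonneg fun _ => abs_nonneg _, bet_lt hB hF.out, fun w => ?_⟩
  rw [Bh_apply, ← bet_const hB hF.out (norm_nrm hF.out w), ← integral_const_mul]
  congr 1 with σ
  by_cases h : w = 0
  · simp [h]
  · rw [nrm, if_neg h, real_inner_smul_left, abs_mul, abs_inv, abs_norm, ← mul_assoc,
      mul_inv_cancel₀ (norm_ne_zero_iff.2 h), one_mul]

/-- polynomial weight -/
def phi (q : ℝ) (v : Vd d) : ℝ := ww v ^ q
lemma phi_pos (q : ℝ) (v : Vd d) : 0 < phi q v := Real.rpow_pos_of_pos (ww_pos v) q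
lemma measurable_phi (q : ℝ) : Measurable (phi (d := d) q) := by
  have := measurable_ww (d := d)
  unfold phi; fun_prop

lemma int_inner_bound (w v : Vd d) : Integrable (fun σ => |inner ℝ v σ|) (Bh hB e0 w) := by
  refine Integrable.of_bound (by apply Measurable.aestronglyMeasurable; fun_prop) ‖v‖ ?_
  filter_upwards [Bh_norm hB w] with σ hσ
  rw [Real.norm_eq_abs, abs_abs]
  simpa [hσ] using abs_real_inner_le_norm v σ

lemma PP_le {q : ℝ} (hq : 1 < q) (v vs : Vd d) :
    PP hB e0 (fun v => ENNReal.ofReal (phi q v)) v vs ≤ ENNReal.ofReal ((ww v + ww vs) ^ q *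
      (1 - min (q - 1) 1 / 2 * (1 - ‖v - vs‖ * (∫ σ, |inner ℝ (v + vs) σ| ∂(Bh hB e0 (v - vs))) / (ww v + ww vs)))) := by
  have hi := int_inner_bound hB (e0 := e0) (v - vs) (v + vs)
  have hi2 : Integrable (fun σ => (ww v + ww vs) ^ q * (1 - min (q - 1) 1 / 2 * (1 - ‖v - vs‖ * |inner ℝ (v + vs) σ| / (ww v + ww vs)))) (Bh hB e0 (v - vs)) := by
    refine Integrable.const_mul ?_ _
    refine (integrable_const _).sub (Integrable.const_mul ((integrable_const _).sub ?_) _)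
    exact (hi.const_mul _).div_const _
  have e : ∫ σ, (ww v + ww vs) ^ q * (1 - min (q - 1) 1 / 2 * (1 - ‖v - vs‖ * |inner ℝ (v + vs) σ| / (ww v + ww vs))) ∂(Bh hB e0 (v - vs))
     = (ww v + ww vs) ^ q *
      (1 - min (q - 1) 1 / 2 * (1 - ‖v - vs‖ * (∫ σ, |inner ℝ (v + vs) σ| ∂(Bh hB e0 (v - vs))) / (ww v + ww vs))) := by
    have hi3 : Integrable (fun σ => ‖v - vs‖ * |inner ℝ (v + vs) σ| / (ww v + ww vs)) (Bh hB e0 (v - vs)) :=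
      (hi.const_mul _).div_const _
    have hi4 : Integrable (fun σ => 1 - ‖v - vs‖ * |inner ℝ (v + vs) σ| / (ww v + ww vs)) (Bh hB e0 (v - vs)) :=
      (integrable_const _).sub hi3
    rw [integral_const_mul, integral_sub (integrable_const _) (hi4.const_mul _),
      integral_const_mul, integral_sub (integrable_const _) hi3, integral_div, integral_const_mul]
    simp
  have hpos : 0 ≤ᵐ[Bh hB e0 (v - vs)] fun σ => (ww v + ww vs) ^ q * (1 - min (q - 1) 1 / 2 * (1 - ‖v - vs‖ * |inner ℝ (v + vs) σ| / (ww v + ww vs))) := by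
    filter_upwards [Bh_norm hB (v - vs)] with σ hσ
    refine le_trans ?_ (pov_pt hq v vs hσ)
    exact (add_pos (phi_pos q _) (phi_pos q _)).le
  rw [← e, ofReal_integral_eq_lintegral_ofReal hi2 hpos, PP]
  refine lintegral_mono_ae ?_
  filter_upwards [Bh_norm hB (v - vs)] with σ hσ
  rw [← ENNReal.ofReal_add (phi_pos q _).le (phi_pos q _).le]
  exact ENNReal.ofReal_le_ofReal (pov_pt hq v vs hσ)

lemma inner_avg_le_one (v vs : Vd d) :
    ‖v - vs‖ * (∫ σ, |inner ℝ (v + vs) σ| ∂(Bh hB e0 (v - vs))) / (ww v + ww vs) ≤ 1 := by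
  have h1 : ∫ σ, |inner ℝ (v + vs) σ| ∂(Bh hB e0 (v - vs)) ≤ ∫ σ, ‖v + vs‖ ∂(Bh hB e0 (v - vs)) := by
    refine integral_mono_ae (int_inner_bound hB _ _) (integrable_const _) ?_
    filter_upwards [Bh_norm hB (v - vs)] with σ hσ
    simpa [hσ] using abs_real_inner_le_norm (v + vs) σ
  simp only [integral_const, probReal_univ, smul_eq_mul, one_mul] at h1
  have hw := ww_pos v; have hws := ww_pos vs
  rw [div_le_one (by positivity)]
  refine (mul_le_mul_of_nonneg_left h1 (norm_nonneg _)).trans ?_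
  have := parallelogram_law_with_norm ℝ v vs
  unfold ww
  nlinarith [sq_nonneg (‖v + vs‖ - ‖v - vs‖)]

lemma inner_avg_far {β : ℝ} (h0 : 0 ≤ β) (h1 : β < 1)
    (hβ : ∀ w : Vd d, ∫ σ, |inner ℝ w σ| ∂(Bh hB e0 w) = ‖w‖ * β)
    {v vs : Vd d} (hvs : ‖vs‖ ≤ 2) (hv : 40 / (1 - β) ≤ ‖v‖) :
    ‖v - vs‖ * (∫ σ, |inner ℝ (v + vs) σ| ∂(Bh hB e0 (v - vs))) / (ww v + ww vs) ≤ (1 + β) / 2 := by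
  have hle : ∫ σ, |inner ℝ (v + vs) σ| ∂(Bh hB e0 (v - vs)) ≤ ∫ σ, (|inner ℝ (v - vs) σ| + 4) ∂(Bh hB e0 (v - vs)) := by
    refine integral_mono_ae (int_inner_bound hB _ _) ((int_inner_bound hB _ _).add (integrable_const _)) ?_
    filter_upwards [Bh_norm hB (v - vs)] with σ hσ
    have e : inner ℝ (v + vs) σ = inner ℝ (v - vs) σ + 2 * inner ℝ vs σ := by
      rw [inner_add_left, inner_sub_left]; ring
    have h2 := abs_real_inner_le_norm vs σ
    rw [hσ, mul_one] at h2
    show |inner ℝ (v + vs) σ| ≤ |inner ℝ (v - vs) σ| + 4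
    rw [e]
    refine (abs_add_le _ _).trans ?_
    rw [abs_mul, abs_two]
    linarith
  rw [integral_add (int_inner_bound hB _ _) (integrable_const _), hβ] at hle
  simp only [integral_const, probReal_univ, smul_eq_mul, one_mul] at hle
  have hw := ww_pos v; have hws := ww_pos vs
  rw [div_le_iff₀ (by positivity)]
  refine (mul_le_mul_of_nonneg_left hle (norm_nonneg _)).trans ?_
  have hD := norm_sub_le v vs
  have hb : 0 < 1 - β := by linarith
  rw [div_le_iff₀ hb] at hv
  have ha : 40 ≤ ‖v‖ := by nlinarith [norm_nonneg v]
  set D := ‖v - vs‖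
  set a := ‖v‖
  have hD0 : 0 ≤ D := norm_nonneg _
  have hDa : D ≤ a + 2 := by linarith
  have h3 : D * (D * β + 4) ≤ (a + 2) * ((a + 2) * β + 4) := by
    have : D * β ≤ (a + 2) * β := mul_le_mul_of_nonneg_right hDa h0
    exact mul_le_mul hDa (by linarith) (by positivity) (by linarith)
  refine h3.trans ?_
  have hww : a ^ 2 ≤ ww v + ww vs := by unfold ww; nlinarith [sq_nonneg ‖vs‖]
  have h4 : (1 + β) / 2 * a ^ 2 ≤ (1 + β) / 2 * (ww v + ww vs) := by gcongr
  refine le_trans ?_ h4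
  nlinarith [mul_le_mul_of_nonneg_right hv (by linarith : 0 ≤ a)]

lemma pov_final {q : ℝ} (hq : 1 < q) : ∃ c K : ℝ, 0 < c ∧ 0 ≤ K ∧ ∀ v vs : Vd d,
    ENNReal.ofReal ‖v - vs‖ * PP hB e0 (fun v => ENNReal.ofReal (phi q v)) v vs +
      (if ‖vs‖ ≤ 2 then ENNReal.ofReal (c * (ell v * phi q v)) else 0) ≤
    ENNReal.ofReal (‖v - vs‖ * (phi q v + phi q vs) + K * (phi q v * ww vs + phi q vs * ww v)) := by
  obtain ⟨β, h0, h1, hβ⟩ := exists_beta hB (e0 := e0)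
  have hb : 0 < 1 - β := by linarith
  set α := min (q - 1) 1 with hα
  have hα0 : 0 < α := lt_min (by linarith) (by norm_num)
  set c := α * (1 - β) / 8 with hc
  have hc0 : 0 < c := by positivity
  refine ⟨c, 2 ^ q + c * (1 + 40 / (1 - β)), hc0, by positivity, fun v vs => ?_⟩
  have hw := ww_pos v
  have hws := ww_pos vs
  have hws1 := ww_ge vs
  have hphi := phi_pos q v
  have hphis := phi_pos q vs
  have hell := ell_pos v
  have hPP := PP_le hB (e0 := e0) hq v vs
  have hone := inner_avg_le_one hB (e0 := e0) v vs
  set h := ‖v - vs‖ * (∫ σ, |inner ℝ (v + vs) σ| ∂(Bh hB e0 (v - vs))) / (ww v + ww vs) with hh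
  have hbas := pov_basic hq v vs
  have hfac : (ww v + ww vs) ^ q * (1 - α / 2 * (1 - h)) ≤ (ww v + ww vs) ^ q := by
    have : 0 ≤ α / 2 * (1 - h) := mul_nonneg (by positivity) (by linarith)
    have h2 : 0 ≤ (ww v + ww vs) ^ q := by positivity
    nlinarith
  have hnn : 0 ≤ c * (1 + 40 / (1 - β)) * (phi q v * ww vs + phi q vs * ww v) := by positivity
  have hS : phi q v ≤ (ww v + ww vs) ^ q := by
    unfold phi; exact Real.rpow_le_rpow hw.le (by linarith) (by linarith)
  have hbas' : ‖v - vs‖ * (ww v + ww vs) ^ q ≤ ‖v - vs‖ * (phi q v + phi q vs) +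
      2 ^ q * (phi q v * ww vs + phi q vs * ww v) := hbas
  by_cases hvs : ‖vs‖ ≤ 2
  · rw [if_pos hvs]
    rcases le_or_gt (40 / (1 - β)) ‖v‖ with hv | hv
    · have hfar := inner_avg_far hB h0 h1 hβ hvs hv
      rw [← hh] at hfar
      have hD : ell v / 2 ≤ ‖v - vs‖ := by
        have h40 : 40 ≤ 40 / (1 - β) := by rw [le_div_iff₀ hb]; nlinarith
        have := norm_sub_norm_le v vs
        unfold ell; linarith
      have h3 : (ww v + ww vs) ^ q * (1 - α / 2 * (1 - h)) ≤ (ww v + ww vs) ^ q - 2 * c * (ww v + ww vs) ^ q := by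
        have : 2 * c ≤ α / 2 * (1 - h) := by
          rw [hc]
          have : (1 - β) / 2 ≤ 1 - h := by linarith
          nlinarith
        have h2 : 0 ≤ (ww v + ww vs) ^ q := by positivity
        nlinarith
      refine (add_le_add_left (mul_le_mul_right (hPP.trans (ENNReal.ofReal_le_ofReal h3)) _) _).trans ?_
      have hc1 : 2 * c ≤ 1 := by
        rw [hc]
        have : α ≤ 1 := min_le_right _ _
        nlinarith
      have h5 : 0 ≤ (ww v + ww vs) ^ q - 2 * c * (ww v + ww vs) ^ q := by
        have h2 : 0 ≤ (ww v + ww vs) ^ q := by positivity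
        nlinarith
      rw [← ENNReal.ofReal_mul (norm_nonneg _), ← ENNReal.ofReal_add (by positivity) (by positivity)]
      apply ENNReal.ofReal_le_ofReal
      have h6 : ell v / 2 * phi q v ≤ ‖v - vs‖ * (ww v + ww vs) ^ q :=
        mul_le_mul hD hS hphi.le (norm_nonneg _)
      have h7 : c * (ell v * phi q v) ≤ 2 * c * (‖v - vs‖ * (ww v + ww vs) ^ q) := by
        have := mul_le_mul_of_nonneg_left h6 (by positivity : 0 ≤ 2 * c)
        linarith
      linarith
    · refine (add_le_add_left (mul_le_mul_right (hPP.trans (ENNReal.ofReal_le_ofReal hfac)) _) _).trans ?_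
      rw [← ENNReal.ofReal_mul (norm_nonneg _), ← ENNReal.ofReal_add (by positivity) (by positivity)]
      apply ENNReal.ofReal_le_ofReal
      have h6 : ell v ≤ 1 + 40 / (1 - β) := by unfold ell; linarith
      have h7 : ell v * phi q v ≤ (1 + 40 / (1 - β)) * (phi q v * ww vs) := by
        refine mul_le_mul h6 ?_ hphi.le (by positivity)
        nlinarith
      have h8 := mul_le_mul_of_nonneg_left h7 hc0.le
      have h9 : 0 ≤ c * (1 + 40 / (1 - β)) * (phi q vs * ww v) := by positivity
      linarith
  · rw [if_neg hvs, add_zero]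
    refine (mul_le_mul_right (hPP.trans (ENNReal.ofReal_le_ofReal hfac)) _).trans ?_
    rw [← ENNReal.ofReal_mul (norm_nonneg _)]
    apply ENNReal.ofReal_le_ofReal
    linarith

end Pov

section It
variable {d : ℕ}

def lh (v : Vd d) : ℝ≥0∞ := ENNReal.ofReal (ell v)
def wh (v : Vd d) : ℝ≥0∞ := ENNReal.ofReal (ww v)
def ph (q : ℝ) (v : Vd d) : ℝ≥0∞ := ENNReal.ofReal (phi q v)

@[fun_prop] lemma measurable_lh : Measurable (lh (d := d)) := measurable_ell.ennreal_ofReal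
@[fun_prop] lemma measurable_wh : Measurable (wh (d := d)) := measurable_ww.ennreal_ofReal
@[fun_prop] lemma measurable_ph (q : ℝ) : Measurable (ph (d := d) q) := (measurable_phi q).ennreal_ofReal

lemma LL_eq (v : Vd d) : ENNReal.ofReal (LL v) = 4 * lh v := by
  rw [LL, lh, ENNReal.ofReal_mul (by norm_num), ENNReal.ofReal_ofNat]; rfl

def bal (v : Vd d) : ℝ≥0∞ := if ‖v‖ ≤ 2 then 1 else 0

@[fun_prop] lemma measurable_bal : Measurable (bal (d := d)) := by
  unfold bal
  have : MeasurableSet {v : Vd d | ‖v‖ ≤ 2} := measurableSet_le measurable_norm measurable_const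
  exact Measurable.ite this measurable_const measurable_const

lemma ofReal_two_mul (x : ℝ) : ENNReal.ofReal (2 * x) = 2 * ENNReal.ofReal x := by
  rw [ENNReal.ofReal_mul (by norm_num), ENNReal.ofReal_ofNat]

lemma dbl_int {μ : Measure (Vd d)} [SFinite μ] {f g : Vd d → ℝ≥0∞} (hf : Measurable f) (hg : Measurable g) :
    ∫⁻ v, ∫⁻ vs, f v * g vs ∂μ ∂μ = (∫⁻ v, f v ∂μ) * ∫⁻ v, g v ∂μ := by
  simp_rw [lintegral_const_mul _ hg]
  rw [lintegral_mul_const _ hf]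

variable {B : Vd d → Measure (Vd d)} (hB : IsCollisionKernel B) {e0 : Vd d} [hF : Fact (‖e0‖ = 1)]

lemma pov_sym {q : ℝ} {c K : ℝ} (hc : 0 < c) (hK : 0 ≤ K) (h : ∀ v vs : Vd d,
    ENNReal.ofReal ‖v - vs‖ * PP hB e0 (fun v => ENNReal.ofReal (phi q v)) v vs +
      (if ‖vs‖ ≤ 2 then ENNReal.ofReal (c * (ell v * phi q v)) else 0) ≤
    ENNReal.ofReal (‖v - vs‖ * (phi q v + phi q vs) + K * (phi q v * ww vs + phi q vs * ww v))) (v vs : Vd d) :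
    (∫⁻ x, ph q x ∂(CC hB e0 (v, vs)) + ∫⁻ x, ph q x ∂(CC hB e0 (vs, v))) +
      2 * ENNReal.ofReal c * (lh v * ph q v * bal vs) ≤
    (2 * (lh v * ph q v * wh vs) + 2 * ENNReal.ofReal K * (ph q v * wh vs)) +
    (2 * (lh vs * ph q vs * wh v) + 2 * ENNReal.ofReal K * (ph q vs * wh v)) := by
  have hh := h v vs
  rw [CC_sym hB v vs (measurable_ph q), ofReal_two_mul]
  have e1 : (if ‖vs‖ ≤ 2 then ENNReal.ofReal (c * (ell v * phi q v)) else 0) =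
      ENNReal.ofReal c * (lh v * ph q v * bal vs) := by
    unfold bal
    split_ifs
    · rw [mul_one, ENNReal.ofReal_mul hc.le, ENNReal.ofReal_mul (ell_pos v).le]; rfl
    · simp
  rw [e1] at hh
  have p1 := ell_pos v
  have p2 := ww_pos v
  have p3 := phi_pos q v
  have p4 := ell_pos vs
  have p5 := ww_pos vs
  have p6 := phi_pos q vs
  have e2 : ENNReal.ofReal (‖v - vs‖ * (phi q v + phi q vs) + K * (phi q v * ww vs + phi q vs * ww v)) =
      ENNReal.ofReal ‖v - vs‖ * (ph q v + ph q vs) + ENNReal.ofReal K * (ph q v * wh vs + ph q vs * wh v) := by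
    unfold ph wh
    rw [ENNReal.ofReal_add (by positivity) (by positivity), ENNReal.ofReal_mul (by positivity),
      ENNReal.ofReal_mul (by positivity), ENNReal.ofReal_add (by positivity) (by positivity),
      ENNReal.ofReal_add (by positivity) (by positivity), ENNReal.ofReal_mul (by positivity),
      ENNReal.ofReal_mul (by positivity)]
  rw [e2] at hh
  have s1 := ofReal_split v vs
  have s2 := ofReal_split vs v
  rw [norm_sub_rev vs v] at s2
  rw [ofReal_two_mul] at s1 s2
  calc _ = 2 * (ENNReal.ofReal ‖v - vs‖ * PP hB e0 (fun v => ENNReal.ofReal (phi q v)) v vs + ENNReal.ofReal c * (lh v * ph q v * bal vs)) +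
      (ENNReal.ofReal (2 * (ell v * ww vs - ‖v - vs‖)) * ph q v +
      ENNReal.ofReal (2 * (ell vs * ww v - ‖v - vs‖)) * ph q vs) := by
        have : PP hB e0 (ph q) v vs = PP hB e0 (fun v => ENNReal.ofReal (phi q v)) v vs := rfl
        rw [this]; ring
    _ ≤ 2 * (ENNReal.ofReal ‖v - vs‖ * (ph q v + ph q vs) + ENNReal.ofReal K * (ph q v * wh vs + ph q vs * wh v)) +
      (ENNReal.ofReal (2 * (ell v * ww vs - ‖v - vs‖)) * ph q v +
      ENNReal.ofReal (2 * (ell vs * ww v - ‖v - vs‖)) * ph q vs) := by gcongr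
    _ = (2 * ENNReal.ofReal ‖v - vs‖ + ENNReal.ofReal (2 * (ell v * ww vs - ‖v - vs‖))) * ph q v +
        (2 * ENNReal.ofReal ‖v - vs‖ + ENNReal.ofReal (2 * (ell vs * ww v - ‖v - vs‖))) * ph q vs +
        2 * ENNReal.ofReal K * (ph q v * wh vs + ph q vs * wh v) := by ring
    _ = _ := by rw [s1, s2]; unfold lh wh; ring

lemma pov_int {q : ℝ} (hq : 1 < q) : ∃ c K : ℝ, 0 < c ∧ 0 ≤ K ∧ ∀ μ : Measure (Vd d), SFinite μ →
    ∫⁻ v, ∫⁻ vs, ∫⁻ x, ph q x ∂(CC hB e0 (v, vs)) ∂μ ∂μ +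
      ENNReal.ofReal c * ((∫⁻ v, lh v * ph q v ∂μ) * ∫⁻ v, bal v ∂μ) ≤
    2 * ((∫⁻ v, lh v * ph q v ∂μ) * ∫⁻ v, wh v ∂μ) +
      2 * ENNReal.ofReal K * ((∫⁻ v, ph q v ∂μ) * ∫⁻ v, wh v ∂μ) := by
  obtain ⟨c, K, hc, hK, h⟩ := pov_final hB (e0 := e0) hq
  refine ⟨c, K, hc, hK, fun μ hμ => ?_⟩
  have hs := pov_sym hB hc hK h
  apply two_cancel_le
  have mC := measurable_CCf hB (e0 := e0) (measurable_ph (d := d) q)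
  have mG : Measurable (Function.uncurry fun v vs : Vd d => 2 * (lh v * ph q v * wh vs) + 2 * ENNReal.ofReal K * (ph q v * wh vs)) := by
    unfold Function.uncurry; fun_prop
  have hint := lintegral_mono (μ := μ) fun v => lintegral_mono (μ := μ) fun vs => hs v vs
  rw [← two_int μ mG] at hint
  have e1 : ∀ v, ∫⁻ vs, ((∫⁻ x, ph q x ∂(CC hB e0 (v, vs)) + ∫⁻ x, ph q x ∂(CC hB e0 (vs, v))) +
      2 * ENNReal.ofReal c * (lh v * ph q v * bal vs)) ∂μ =
      ∫⁻ vs, (∫⁻ x, ph q x ∂(CC hB e0 (v, vs)) + ∫⁻ x, ph q x ∂(CC hB e0 (vs, v))) ∂μ +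
      2 * ENNReal.ofReal c * (lh v * ph q v * ∫⁻ vs, bal vs ∂μ) := by
    intro v
    rw [lintegral_add_right (g := fun vs => 2 * ENNReal.ofReal c * (lh v * ph q v * bal vs)) _ (by fun_prop),
      lintegral_const_mul (f := fun vs => (lh v * ph q v * bal vs)) _ (by fun_prop),
      lintegral_const_mul (f := fun vs => bal vs) _ (by fun_prop)]
  have e2 : ∀ v : Vd d, ∫⁻ vs, (2 * (lh v * ph q v * wh vs) + 2 * ENNReal.ofReal K * (ph q v * wh vs)) ∂μ =
      2 * (lh v * ph q v * ∫⁻ vs, wh vs ∂μ) + 2 * ENNReal.ofReal K * (ph q v * ∫⁻ vs, wh vs ∂μ) := by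
    intro v
    rw [lintegral_add_right (g := fun vs => 2 * ENNReal.ofReal K * (ph q v * wh vs)) _ (by fun_prop),
      lintegral_const_mul (f := fun vs => (lh v * ph q v * wh vs)) _ (by fun_prop),
      lintegral_const_mul (f := fun vs => wh vs) _ (by fun_prop),
      lintegral_const_mul (f := fun vs => (ph q v * wh vs)) _ (by fun_prop),
      lintegral_const_mul (f := fun vs => wh vs) _ (by fun_prop)]
  simp_rw [e1, e2] at hint
  rw [lintegral_add_right (g := fun v => 2 * ENNReal.ofReal c * (lh v * ph q v * ∫⁻ vs, bal vs ∂μ)) _ (by fun_prop),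
    lintegral_const_mul (f := fun v => (lh v * ph q v * ∫⁻ vs, bal vs ∂μ)) _ (by fun_prop),
    lintegral_mul_const (f := fun v => lh v * ph q v) _ (by fun_prop), ← two_int μ mC,
    lintegral_add_right (g := fun v => 2 * ENNReal.ofReal K * (ph q v * ∫⁻ vs, wh vs ∂μ)) _ (by fun_prop),
    lintegral_const_mul (f := fun v => (lh v * ph q v * ∫⁻ vs, wh vs ∂μ)) _ (by fun_prop),
    lintegral_mul_const (f := fun v => lh v * ph q v) _ (by fun_prop),
    lintegral_const_mul (f := fun v => (ph q v * ∫⁻ vs, wh vs ∂μ)) _ (by fun_prop),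
    lintegral_mul_const (f := fun v => ph q v) _ (by fun_prop)] at hint
  calc _ = _ := by ring
    _ ≤ _ := hint

lemma Inv_one : Inv (fun _ : Vd d => (1 : ℝ≥0∞)) := fun _ _ _ _ => rfl

lemma Inv_wh : Inv (wh (d := d)) := by
  intro v vs σ hσ
  unfold wh
  rw [← ENNReal.ofReal_add (ww_pos _).le (ww_pos _).le, ← ENNReal.ofReal_add (ww_pos _).le (ww_pos _).le, ww_sum v vs hσ]

def mh (e v : Vd d) : ℝ≥0∞ := ENNReal.ofReal (ww v + inner ℝ e v)

@[fun_prop] lemma measurable_mh (e : Vd d) : Measurable (mh e) := by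
  have := measurable_ww (d := d)
  unfold mh; fun_prop

lemma mm_bound {e : Vd d} (he : ‖e‖ ≤ 1) (v : Vd d) : |inner ℝ e v| ≤ ww v := by
  have h := abs_real_inner_le_norm e v
  have : ‖e‖ * ‖v‖ ≤ ‖v‖ := by nlinarith [norm_nonneg v]
  unfold ww; nlinarith [sq_nonneg (‖v‖ - 1)]

lemma mm_nonneg {e : Vd d} (he : ‖e‖ ≤ 1) (v : Vd d) : 0 ≤ ww v + inner ℝ e v := by
  have := (abs_le.1 (mm_bound he v)).1; linarith

lemma Inv_mh {e : Vd d} (he : ‖e‖ ≤ 1) : Inv (mh e) := by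
  intro v vs σ hσ
  unfold mh
  rw [← ENNReal.ofReal_add (mm_nonneg he _) (mm_nonneg he _), ← ENNReal.ofReal_add (mm_nonneg he _) (mm_nonneg he _)]
  congr 1
  have h1 := ww_sum v vs hσ
  have h2 : postV v vs σ + postVs v vs σ = v + vs := by
    unfold postV postVs
    rw [add_add_sub_cancel, ← add_smul]; norm_num
  have h3 : inner ℝ e (postV v vs σ) + inner ℝ e (postVs v vs σ) = inner ℝ e v + inner ℝ e vs := by
    rw [← inner_add_right, h2, inner_add_right]
  linarith

end It

section Est
variable {d : ℕ}
variable {B : Vd d → Measure (Vd d)} (hB : IsCollisionKernel B) {e0 : Vd d} [hF : Fact (‖e0‖ = 1)]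
variable (μ0 : Measure (Vd d)) [SFinite μ0]

lemma duh_weak (N : Kernel ℝ (Vd d)) [IsSFiniteKernel N] {t : ℝ} (ht : 0 ≤ t) {f : Vd d → ℝ≥0∞} (hf : Measurable f) :
    ∫⁻ v, f v ∂(duh LL μ0 (qk (CC hB e0) N) t) +
      ∫⁻ s in Set.Ioc 0 t, 4 * ∫⁻ v, lh v * f v ∂(duh LL μ0 (qk (CC hB e0) N) s) =
    ∫⁻ v, f v ∂μ0 + ∫⁻ s in Set.Ioc 0 t, ∫⁻ v, ∫⁻ vs, ∫⁻ x, f x ∂(CC hB e0 (v, vs)) ∂(N s) ∂(N s) := by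
  have h := mild_to_weak μ0 (qk (CC hB e0) N) measurable_LL LL_nonneg ht hf
  have e1 : ∀ s, ∫⁻ v, ENNReal.ofReal (LL v) * f v ∂(duh LL μ0 (qk (CC hB e0) N) s) =
      4 * ∫⁻ v, lh v * f v ∂(duh LL μ0 (qk (CC hB e0) N) s) := by
    intro s
    rw [← lintegral_const_mul (f := fun v => lh v * f v) _ (by fun_prop)]
    refine lintegral_congr fun v => ?_
    rw [LL_eq, mul_assoc]
  simp_rw [e1, lintegral_qk (CC hB e0) N _ hf] at h
  exact h

lemma duh_weak_inv (N : Kernel ℝ (Vd d)) [IsSFiniteKernel N] {t : ℝ} (ht : 0 ≤ t) {f : Vd d → ℝ≥0∞} (hf : Measurable f)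
    (hi : Inv f) :
    ∫⁻ v, f v ∂(duh LL μ0 (qk (CC hB e0) N) t) +
      ∫⁻ s in Set.Ioc 0 t, 4 * ∫⁻ v, lh v * f v ∂(duh LL μ0 (qk (CC hB e0) N) s) =
    ∫⁻ v, f v ∂μ0 + ∫⁻ s in Set.Ioc 0 t, 2 * ((∫⁻ v, lh v * f v ∂(N s)) * ∫⁻ v, wh v ∂(N s)) := by
  rw [duh_weak hB μ0 N ht hf]
  congr 1
  refine lintegral_congr fun s => ?_
  exact int_CC_inv hB (N s) hf hi

lemma it_w (hw : ∫⁻ v, wh v ∂μ0 = 2) (k : ℕ) :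
    (∀ t, 0 ≤ t → ∫⁻ v, wh v ∂(it LL (CC hB e0) μ0 k t) ≤ 2) ∧
    ∀ t, 0 ≤ t → ∫⁻ s in Set.Ioc 0 t, 4 * ∫⁻ v, lh v * wh v ∂(it LL (CC hB e0) μ0 k s) ≠ ∞ := by
  induction k with
  | zero => simp [it_zero]
  | succ k ih =>
    have key : ∀ t, 0 ≤ t → ∫⁻ v, wh v ∂(it LL (CC hB e0) μ0 (k+1) t) +
      ∫⁻ s in Set.Ioc 0 t, 4 * ∫⁻ v, lh v * wh v ∂(it LL (CC hB e0) μ0 (k+1) s) ≤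
      2 + ∫⁻ s in Set.Ioc 0 t, 4 * ∫⁻ v, lh v * wh v ∂(it LL (CC hB e0) μ0 k s) := by
      intro t ht
      rw [it_succ, duh_weak_inv hB μ0 _ ht measurable_wh Inv_wh, hw]
      gcongr 2 + ?_
      refine setLIntegral_mono' measurableSet_Ioc fun s hs => ?_
      calc _ ≤ 2 * ((∫⁻ v, lh v * wh v ∂(it LL (CC hB e0) μ0 k s)) * 2) := by
            gcongr; exact ih.1 s hs.1.le
        _ = _ := by ring
    have fin : ∀ t, 0 ≤ t → ∫⁻ s in Set.Ioc 0 t, 4 * ∫⁻ v, lh v * wh v ∂(it LL (CC hB e0) μ0 (k+1) s) ≠ ∞ := by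
      intro t ht
      refine ne_top_of_le_ne_top ?_ (le_add_self.trans (key t ht))
      exact ENNReal.add_ne_top.2 ⟨by simp, ih.2 t ht⟩
    refine ⟨fun t ht => ?_, fin⟩
    have h1 := key t ht
    have h2 : ∫⁻ s in Set.Ioc 0 t, 4 * ∫⁻ v, lh v * wh v ∂(it LL (CC hB e0) μ0 k s) ≤
        ∫⁻ s in Set.Ioc 0 t, 4 * ∫⁻ v, lh v * wh v ∂(it LL (CC hB e0) μ0 (k+1) s) := by
      refine lintegral_mono fun s => ?_
      gcongr
      exact it_mono (CC hB e0) μ0 measurable_LL s (Nat.le_succ k)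
    have h3 := h1.trans (add_le_add le_rfl h2)
    exact (ENNReal.add_le_add_iff_right (fin t ht)).1 h3

lemma it_bal {T : ℝ} (k : ℕ) {t : ℝ} (ht : t ∈ Set.Icc 0 T) :
    ENNReal.ofReal (Real.exp (-(12 * T))) * ∫⁻ v, bal v ∂μ0 ≤ ∫⁻ v, bal v ∂(it LL (CC hB e0) μ0 (k+1) t) := by
  rw [it_succ, lintegral_duh μ0 _ measurable_LL t measurable_bal, ← lintegral_const_mul _ measurable_bal]
  refine le_trans (lintegral_mono fun v => ?_) le_self_add
  unfold bal
  split_ifs with hv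
  · gcongr
    unfold ee
    apply ENNReal.ofReal_le_ofReal
    apply Real.exp_le_exp.2
    have : LL v ≤ 12 := by unfold LL; linarith
    have := mul_le_mul this ht.2 ht.1 (by norm_num : (0:ℝ) ≤ 12)
    linarith
  · simp

lemma lint_exp {K t : ℝ} (hK : 0 ≤ K) (ht : 0 ≤ t) (a : ℝ≥0∞) :
    a + ENNReal.ofReal K * ∫⁻ s in Set.Ioc 0 t, a * ENNReal.ofReal (Real.exp (K * s)) = a * ENNReal.ofReal (Real.exp (K * t)) := by
  have hm : Measurable fun s : ℝ => ENNReal.ofReal (Real.exp (K * s)) := by fun_prop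
  rw [lintegral_const_mul _ hm]
  have : ENNReal.ofReal K * ∫⁻ s in Set.Ioc 0 t, ENNReal.ofReal (Real.exp (K * s)) = ENNReal.ofReal (Real.exp (K * t) - 1) := by
    rw [← lintegral_const_mul _ hm]
    simp_rw [← ENNReal.ofReal_mul hK]
    have hc : Continuous fun s : ℝ => K * Real.exp (K * s) := by fun_prop
    rw [← ofReal_integral_eq_lintegral_ofReal]
    · congr 1
      rw [← intervalIntegral.integral_of_le ht]
      have hd : ∀ x ∈ Set.uIcc 0 t, HasDerivAt (fun s : ℝ => Real.exp (K * s)) (K * Real.exp (K * x)) x := by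
        intro x _
        have := ((hasDerivAt_id x).const_mul K).exp
        simpa [mul_comm] using this
      rw [intervalIntegral.integral_eq_sub_of_hasDerivAt hd (hc.intervalIntegrable _ _)]
      simp
    · exact (hc.integrableOn_Icc).mono_set Set.Ioc_subset_Icc_self
    · exact ae_of_all _ fun s => by positivity
  calc _ = a * (1 + ENNReal.ofReal K * ∫⁻ s in Set.Ioc 0 t, ENNReal.ofReal (Real.exp (K * s))) := by ring
    _ = _ := by
      rw [this, ← ENNReal.ofReal_one, ← ENNReal.ofReal_add (by norm_num)]
      · congr 2; ring
      · have : 1 ≤ Real.exp (K * t) := Real.one_le_exp (by positivity)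
        linarith

lemma it_phi {q : ℝ} (hq : 1 < q) (hw : ∫⁻ v, wh v ∂μ0 = 2) (hfin : ∫⁻ v, ph q v ∂μ0 ≠ ∞) :
    ∃ c K : ℝ, 0 < c ∧ 0 ≤ K ∧ ∀ T, 0 ≤ T → ∀ k : ℕ,
      (∀ t ∈ Set.Icc 0 T, ∫⁻ v, ph q v ∂(it LL (CC hB e0) μ0 k t) ≤
          (∫⁻ v, ph q v ∂μ0) * ENNReal.ofReal (Real.exp (K * t))) ∧
      (ENNReal.ofReal c * (ENNReal.ofReal (Real.exp (-(12 * T))) * ∫⁻ v, bal v ∂μ0)) *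
        ∫⁻ s in Set.Ioc 0 T, ∫⁻ v, lh v * ph q v ∂(it LL (CC hB e0) μ0 k s) ≤
          (∫⁻ v, ph q v ∂μ0) * ENNReal.ofReal (Real.exp (K * T)) ∧
      ∫⁻ s in Set.Ioc 0 T, ∫⁻ v, lh v * ph q v ∂(it LL (CC hB e0) μ0 k s) ≠ ∞ := by
  obtain ⟨c, K, hc, hK, hp⟩ := pov_int hB (e0 := e0) hq
  refine ⟨c, 4 * K, hc, by positivity, fun T hT => ?_⟩
  set m := ENNReal.ofReal (Real.exp (-(12 * T))) * ∫⁻ v, bal v ∂μ0 with hm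
  set a := ∫⁻ v, ph q v ∂μ0 with ha
  have mlp : ∀ k, Measurable fun s => ∫⁻ v, lh v * ph q v ∂(it LL (CC hB e0) μ0 k s) := fun k =>
    measurable_lint _ (by fun_prop)
  have mp : ∀ k, Measurable fun s => ∫⁻ v, ph q v ∂(it LL (CC hB e0) μ0 k s) := fun k =>
    measurable_lint _ (by fun_prop)
  -- pointwise
  have pt : ∀ k, ∀ s ∈ Set.Icc 0 T,
      ∫⁻ v, ∫⁻ vs, ∫⁻ x, ph q x ∂(CC hB e0 (v, vs)) ∂(it LL (CC hB e0) μ0 k s) ∂(it LL (CC hB e0) μ0 k s) +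
      ENNReal.ofReal c * m * ∫⁻ v, lh v * ph q v ∂(it LL (CC hB e0) μ0 k s) ≤
      4 * (∫⁻ v, lh v * ph q v ∂(it LL (CC hB e0) μ0 k s)) +
        ENNReal.ofReal (4 * K) * ∫⁻ v, ph q v ∂(it LL (CC hB e0) μ0 k s) := by
    intro k s hs
    cases k with
    | zero => simp [it_zero]
    | succ k =>
      have h := hp (it LL (CC hB e0) μ0 (k+1) s) inferInstance
      have hb := it_bal hB μ0 (e0 := e0) k hs
      have hww := (it_w hB μ0 (e0 := e0) hw (k+1)).1 s hs.1
      calc _ ≤ _ := by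
            refine le_trans ?_ h
            refine add_le_add le_rfl ?_
            rw [mul_assoc, mul_comm m]
            gcongr
        _ ≤ 2 * ((∫⁻ v, lh v * ph q v ∂(it LL (CC hB e0) μ0 (k+1) s)) * 2) +
          2 * ENNReal.ofReal K * ((∫⁻ v, ph q v ∂(it LL (CC hB e0) μ0 (k+1) s)) * 2) := by gcongr
        _ = _ := by
          rw [ENNReal.ofReal_mul (by norm_num), ENNReal.ofReal_ofNat]; ring
  have step : ∀ k, ∀ t ∈ Set.Icc 0 T,
      ∫⁻ v, ph q v ∂(it LL (CC hB e0) μ0 (k+1) t) +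
      (∫⁻ s in Set.Ioc 0 t, 4 * ∫⁻ v, lh v * ph q v ∂(it LL (CC hB e0) μ0 (k+1) s)) +
      ENNReal.ofReal c * m * ∫⁻ s in Set.Ioc 0 t, ∫⁻ v, lh v * ph q v ∂(it LL (CC hB e0) μ0 k s) ≤
      a + ((∫⁻ s in Set.Ioc 0 t, 4 * ∫⁻ v, lh v * ph q v ∂(it LL (CC hB e0) μ0 k s)) +
        ENNReal.ofReal (4 * K) * ∫⁻ s in Set.Ioc 0 t, ∫⁻ v, ph q v ∂(it LL (CC hB e0) μ0 k s)) := by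
    intro k t ht
    rw [it_succ, duh_weak hB μ0 _ ht.1 (measurable_ph q), add_assoc]
    gcongr a + ?_
    rw [← lintegral_const_mul _ (mlp k), ← lintegral_const_mul _ (mp k), ← lintegral_add_right _ ((mlp k).const_mul _),
      ← lintegral_add_right _ ((mp k).const_mul _)]
    exact setLIntegral_mono' measurableSet_Ioc fun s hs => pt k s ⟨hs.1.le, hs.2.trans ht.2⟩
  have mono : ∀ k (t : ℝ), ∫⁻ s in Set.Ioc 0 t, 4 * ∫⁻ v, lh v * ph q v ∂(it LL (CC hB e0) μ0 k s) ≤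
        ∫⁻ s in Set.Ioc 0 t, 4 * ∫⁻ v, lh v * ph q v ∂(it LL (CC hB e0) μ0 (k+1) s) := by
    intro k t
    refine lintegral_mono fun s => ?_
    gcongr
    exact it_mono (CC hB e0) μ0 measurable_LL s (Nat.le_succ k)
  have P : ∀ k, (∀ t ∈ Set.Icc 0 T, ∫⁻ v, ph q v ∂(it LL (CC hB e0) μ0 k t) ≤ a * ENNReal.ofReal (Real.exp (4 * K * t))) ∧
      ∫⁻ s in Set.Ioc 0 T, 4 * ∫⁻ v, lh v * ph q v ∂(it LL (CC hB e0) μ0 k s) ≠ ∞ ∧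
      (∫⁻ s in Set.Ioc 0 T, 4 * ∫⁻ v, lh v * ph q v ∂(it LL (CC hB e0) μ0 (k+1) s) ≠ ∞) ∧
      ∀ t ∈ Set.Icc 0 T, ∫⁻ v, ph q v ∂(it LL (CC hB e0) μ0 (k+1) t) +
        ENNReal.ofReal c * m * ∫⁻ s in Set.Ioc 0 t, ∫⁻ v, lh v * ph q v ∂(it LL (CC hB e0) μ0 k s) ≤
        a * ENNReal.ofReal (Real.exp (4 * K * t)) := by
    have stepP : ∀ k, (∀ t ∈ Set.Icc 0 T, ∫⁻ v, ph q v ∂(it LL (CC hB e0) μ0 k t) ≤ a * ENNReal.ofReal (Real.exp (4 * K * t))) →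
      ∫⁻ s in Set.Ioc 0 T, 4 * ∫⁻ v, lh v * ph q v ∂(it LL (CC hB e0) μ0 k s) ≠ ∞ →
      (∫⁻ s in Set.Ioc 0 T, 4 * ∫⁻ v, lh v * ph q v ∂(it LL (CC hB e0) μ0 (k+1) s) ≠ ∞) ∧
      ∀ t ∈ Set.Icc 0 T, ∫⁻ v, ph q v ∂(it LL (CC hB e0) μ0 (k+1) t) +
        ENNReal.ofReal c * m * ∫⁻ s in Set.Ioc 0 t, ∫⁻ v, lh v * ph q v ∂(it LL (CC hB e0) μ0 k s) ≤
        a * ENNReal.ofReal (Real.exp (4 * K * t)) := by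
      intro k h1 h2
      have e1 : ∀ t ∈ Set.Icc 0 T, a + ENNReal.ofReal (4 * K) * ∫⁻ s in Set.Ioc 0 t, ∫⁻ v, ph q v ∂(it LL (CC hB e0) μ0 k s) ≤
          a * ENNReal.ofReal (Real.exp (4 * K * t)) := by
        intro t ht
        rw [← lint_exp (by positivity) ht.1]
        gcongr a + _ * ?_
        exact setLIntegral_mono' measurableSet_Ioc fun s hs => h1 s ⟨hs.1.le, hs.2.trans ht.2⟩
      have e2 : ∀ t ∈ Set.Icc 0 T, (∫⁻ v, ph q v ∂(it LL (CC hB e0) μ0 (k+1) t) +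
        ENNReal.ofReal c * m * ∫⁻ s in Set.Ioc 0 t, ∫⁻ v, lh v * ph q v ∂(it LL (CC hB e0) μ0 k s)) +
        (∫⁻ s in Set.Ioc 0 t, 4 * ∫⁻ v, lh v * ph q v ∂(it LL (CC hB e0) μ0 (k+1) s)) ≤
          a * ENNReal.ofReal (Real.exp (4 * K * t)) + ∫⁻ s in Set.Ioc 0 t, 4 * ∫⁻ v, lh v * ph q v ∂(it LL (CC hB e0) μ0 k s) := by
        intro t ht
        have := step k t ht
        calc _ = _ := by ring
          _ ≤ _ := this
          _ = _ := by ring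
          _ ≤ _ := add_le_add (e1 t ht) le_rfl
      have fin : ∫⁻ s in Set.Ioc 0 T, 4 * ∫⁻ v, lh v * ph q v ∂(it LL (CC hB e0) μ0 (k+1) s) ≠ ∞ := by
        refine ne_top_of_le_ne_top ?_ (le_add_self.trans (e2 T ⟨hT, le_rfl⟩))
        exact ENNReal.add_ne_top.2 ⟨ENNReal.mul_ne_top hfin (by simp), h2⟩
      refine ⟨fin, fun t ht => ?_⟩
      have fint : ∫⁻ s in Set.Ioc 0 t, 4 * ∫⁻ v, lh v * ph q v ∂(it LL (CC hB e0) μ0 (k+1) s) ≠ ∞ :=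
        ne_top_of_le_ne_top fin (lintegral_mono_set (Set.Ioc_subset_Ioc le_rfl ht.2))
      exact (ENNReal.add_le_add_iff_right fint).1 ((e2 t ht).trans (add_le_add le_rfl (mono k t)))
    intro k
    induction k with
    | zero =>
      have h1 : (∀ t ∈ Set.Icc 0 T, ∫⁻ v, ph q v ∂(it LL (CC hB e0) μ0 0 t) ≤ a * ENNReal.ofReal (Real.exp (4 * K * t))) := by
        simp [it_zero]
      have h2 : ∫⁻ s in Set.Ioc 0 T, 4 * ∫⁻ v, lh v * ph q v ∂(it LL (CC hB e0) μ0 0 s) ≠ ∞ := by simp [it_zero]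
      exact ⟨h1, h2, stepP 0 h1 h2⟩
    | succ k ih =>
      have h1 : (∀ t ∈ Set.Icc 0 T, ∫⁻ v, ph q v ∂(it LL (CC hB e0) μ0 (k+1) t) ≤ a * ENNReal.ofReal (Real.exp (4 * K * t))) :=
        fun t ht => le_self_add.trans (ih.2.2.2 t ht)
      exact ⟨h1, ih.2.2.1, stepP (k+1) h1 ih.2.2.1⟩
  intro k
  refine ⟨(P k).1, le_add_self.trans ((P k).2.2.2 T ⟨hT, le_rfl⟩), ?_⟩
  have := (P k).2.1
  rw [lintegral_const_mul _ (mlp k)] at this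
  intro h
  rw [h] at this
  simp at this

end Est

section Lim
variable {d : ℕ}

lemma one_le_wh (v : Vd d) : 1 ≤ wh v := by
  unfold wh; rw [← ENNReal.ofReal_one]; exact ENNReal.ofReal_le_ofReal (ww_ge v)

lemma wh_le_ph {q : ℝ} (hq : 1 < q) (v : Vd d) : wh v ≤ ph q v := by
  unfold wh ph phi
  apply ENNReal.ofReal_le_ofReal
  exact Real.self_le_rpow_of_one_le (ww_ge v) hq.le

lemma ww_int {μ : Measure (Vd d)} [IsProbabilityMeasure μ] (h : ∫ v, ‖v‖ ^ 2 ∂μ = 1) :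
    Integrable (fun v : Vd d => ww v) μ ∧ ∫ v, ww v ∂μ = 2 := by
  have hi : Integrable (fun v : Vd d => ‖v‖ ^ 2) μ := by
    by_contra hn
    rw [integral_undef hn] at h; norm_num at h
  refine ⟨(integrable_const 1).add hi, ?_⟩
  unfold ww
  rw [integral_add (integrable_const 1) hi, h]; norm_num

lemma v_int {μ : Measure (Vd d)} (h : Integrable (fun v : Vd d => ww v) μ) : Integrable (fun v : Vd d => v) μ := by
  refine h.mono' (by fun_prop) (ae_of_all _ fun v => ?_)
  unfold ww; nlinarith [sq_nonneg (‖v‖ - 1)]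

lemma sphere_iff {μ : Measure (Vd d)} [IsProbabilityMeasure μ] :
    μ ∈ boltzmannSphere d ↔ ∫⁻ v, wh v ∂μ = 2 ∧ ∀ e : Vd d, ‖e‖ ≤ 1 → ∫⁻ v, mh e v ∂μ = 2 := by
  constructor
  · rintro ⟨-, h1, h2⟩
    obtain ⟨hi, hw⟩ := ww_int h2
    have hv := v_int hi
    constructor
    · unfold wh
      rw [← ofReal_integral_eq_lintegral_ofReal hi (ae_of_all _ fun v => (ww_pos v).le), hw]; norm_num
    · intro e he
      unfold mh
      have hin : Integrable (fun v : Vd d => (inner ℝ e v : ℝ)) μ := hv.const_inner e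
      rw [← ofReal_integral_eq_lintegral_ofReal (f := fun v : Vd d => ww v + inner ℝ e v) (hi.add hin) (ae_of_all _ fun v => mm_nonneg he v)]
      rw [integral_add hi hin, hw, integral_inner hv e, h1]; simp
  · rintro ⟨h1, h2⟩
    have hi : Integrable (fun v : Vd d => ww v) μ := by
      refine ⟨measurable_ww.aestronglyMeasurable, ?_⟩
      rw [hasFiniteIntegral_iff_ofReal (ae_of_all _ fun v => (ww_pos v).le)]
      change ∫⁻ v, wh v ∂μ < ∞
      rw [h1]; simp
    have hw : ∫ v, ww v ∂μ = 2 := by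
      rw [integral_eq_lintegral_of_nonneg_ae (ae_of_all _ fun v => (ww_pos v).le) measurable_ww.aestronglyMeasurable]
      change (∫⁻ v, wh v ∂μ).toReal = 2
      rw [h1]; simp
    have hv := v_int hi
    have key : ∀ e : Vd d, ‖e‖ ≤ 1 → inner ℝ e (∫ v, v ∂μ) = 0 := by
      intro e he
      have hin : Integrable (fun v : Vd d => (inner ℝ e v : ℝ)) μ := hv.const_inner e
      have h3 := h2 e he
      unfold mh at h3
      rw [← ofReal_integral_eq_lintegral_ofReal (f := fun v : Vd d => ww v + inner ℝ e v) (hi.add hin) (ae_of_all _ fun v => mm_nonneg he v)] at h3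
      rw [integral_add hi hin, hw, integral_inner hv e] at h3
      have h4 : (2:ℝ) + inner ℝ e (∫ v, v ∂μ) = 2 := by
        have := congrArg ENNReal.toReal h3
        rw [ENNReal.toReal_ofReal] at this
        · simpa using this
        · by_contra hn
          rw [ENNReal.ofReal_of_nonpos (not_le.1 hn).le] at h3
          simp at h3
      linarith
    refine ⟨inferInstance, ?_, ?_⟩
    · by_contra hne
      have h5 := key (‖∫ v, v ∂μ‖⁻¹ • ∫ v, v ∂μ) (by rw [norm_smul, norm_inv, norm_norm, inv_mul_cancel₀ (norm_ne_zero_iff.2 hne)])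
      rw [inner_smul_left, real_inner_self_eq_norm_sq] at h5
      have h6 : ‖∫ v, v ∂μ‖ ≠ 0 := norm_ne_zero_iff.2 hne
      simp [h6] at h5
    · have h7 : ∫ v, (ww v - 1) ∂μ = 1 := by
        rw [integral_sub hi (integrable_const 1), hw]; norm_num
      rw [← h7]; congr 1; ext v; unfold ww; ring

lemma bal_ne {μ0 : Measure (Vd d)} [IsProbabilityMeasure μ0] (hw : ∫⁻ v, wh v ∂μ0 = 2) : ∫⁻ v, bal v ∂μ0 ≠ 0 := by
  intro h
  have h1 : ∀ v : Vd d, 5 ≤ wh v + 5 * bal v := by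
    intro v
    unfold bal
    split_ifs with hv
    · simp
    · push Not at hv
      rw [mul_zero, add_zero]
      unfold wh ww
      rw [← ENNReal.ofReal_ofNat]
      apply ENNReal.ofReal_le_ofReal
      nlinarith
  have h2 : ∫⁻ v : Vd d, 5 ∂μ0 ≤ _ := lintegral_mono h1
  rw [lintegral_add_left measurable_wh, lintegral_const_mul _ measurable_bal, h, hw] at h2
  simp at h2
  norm_num at h2

variable {B : Vd d → Measure (Vd d)} (hB : IsCollisionKernel B) {e0 : Vd d} [hF : Fact (‖e0‖ = 1)]
variable (μ0 : Measure (Vd d)) [IsProbabilityMeasure μ0]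

abbrev MM (e0 : Vd d) [Fact (‖e0‖ = 1)] : Kernel ℝ (Vd d) := BE.lim (CC hB e0) μ0 measurable_LL

lemma MM_fin (hw : ∫⁻ v, wh v ∂μ0 = 2) : IsFiniteKernel (MM hB μ0 e0) := by
  refine lim_finite (CC hB e0) μ0 measurable_LL (M := 2) (by simp) fun k t ht => ?_
  refine le_trans ?_ ((it_w hB μ0 (e0 := e0) hw k).1 t ht)
  rw [← lintegral_one]
  exact lintegral_mono one_le_wh

lemma MM_w (hw : ∫⁻ v, wh v ∂μ0 = 2) {t : ℝ} (ht : 0 ≤ t) : ∫⁻ v, wh v ∂(MM hB μ0 e0 t) ≤ 2 := by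
  rw [lintegral_limk _ _ _ ht measurable_wh]
  exact iSup_le fun k => (it_w hB μ0 (e0 := e0) hw k).1 t ht

lemma MM_phi {q : ℝ} (hq : 1 < q) (hw : ∫⁻ v, wh v ∂μ0 = 2) (hfin : ∫⁻ v, ph q v ∂μ0 ≠ ∞) {T : ℝ} (hT : 0 ≤ T) :
    (∃ M : ℝ≥0∞, M ≠ ∞ ∧ ∀ t ∈ Set.Icc 0 T, ∫⁻ v, ph q v ∂(MM hB μ0 e0 t) ≤ M) ∧
    ∫⁻ s in Set.Ioc 0 T, ∫⁻ v, lh v * ph q v ∂(MM hB μ0 e0 s) ≠ ∞ := by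
  obtain ⟨c, K, hc, hK, h⟩ := it_phi hB μ0 (e0 := e0) hq hw hfin
  have hfin2 : (∫⁻ v, ph q v ∂μ0) * ENNReal.ofReal (Real.exp (K * T)) ≠ ∞ := ENNReal.mul_ne_top hfin (by simp)
  constructor
  · refine ⟨_, hfin2, fun t ht => ?_⟩
    rw [lintegral_limk _ _ _ ht.1 (measurable_ph q)]
    refine iSup_le fun k => ((h T hT k).1 t ht).trans ?_
    gcongr
    exact ht.2
  · have e : ∫⁻ s in Set.Ioc 0 T, ∫⁻ v, lh v * ph q v ∂(MM hB μ0 e0 s) =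
        ⨆ k, ∫⁻ s in Set.Ioc 0 T, ∫⁻ v, lh v * ph q v ∂(it LL (CC hB e0) μ0 k s) := by
      rw [setLIntegral_congr_fun measurableSet_Ioc (fun s hs => lintegral_limk _ _ _ hs.1.le
        (f := fun v => lh v * ph q v) (by fun_prop))]
      refine lintegral_iSup (fun k => measurable_lint _ (by fun_prop)) ?_
      exact fun i j hij s => lintegral_mono' (it_mono _ μ0 measurable_LL s hij) le_rfl
    rw [e]
    set m := ENNReal.ofReal c * (ENNReal.ofReal (Real.exp (-(12 * T))) * ∫⁻ v, bal v ∂μ0) with hm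
    have m0 : m ≠ 0 := by
      refine mul_ne_zero ?_ (mul_ne_zero ?_ (bal_ne hw))
      · simpa using hc
      · simpa using Real.exp_pos _
    have h3 : m * ⨆ k, ∫⁻ s in Set.Ioc 0 T, ∫⁻ v, lh v * ph q v ∂(it LL (CC hB e0) μ0 k s) ≤ 
        (∫⁻ v, ph q v ∂μ0) * ENNReal.ofReal (Real.exp (K * T)) := by
      rw [ENNReal.mul_iSup]
      exact iSup_le fun k => (h T hT k).2.1
    intro htop
    rw [htop, ENNReal.mul_top m0] at h3
    exact hfin2 (top_le_iff.1 h3)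

lemma MM_lw {q : ℝ} (hq : 1 < q) (hw : ∫⁻ v, wh v ∂μ0 = 2) (hfin : ∫⁻ v, ph q v ∂μ0 ≠ ∞) {T : ℝ} (hT : 0 ≤ T) :
    ∫⁻ s in Set.Ioc 0 T, ∫⁻ v, lh v * wh v ∂(MM hB μ0 e0 s) ≠ ∞ := by
  refine ne_top_of_le_ne_top (MM_phi hB μ0 (e0 := e0) hq hw hfin hT).2 ?_
  refine lintegral_mono fun s => lintegral_mono fun v => ?_
  have := wh_le_ph hq v
  dsimp only
  gcongr

lemma MM_weak (hw : ∫⁻ v, wh v ∂μ0 = 2) {t : ℝ} (ht : 0 ≤ t) {f : Vd d → ℝ≥0∞} (hf : Measurable f) :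
    ∫⁻ v, f v ∂(MM hB μ0 e0 t) + ∫⁻ s in Set.Ioc 0 t, 4 * ∫⁻ v, lh v * f v ∂(MM hB μ0 e0 s) =
    ∫⁻ v, f v ∂μ0 + ∫⁻ s in Set.Ioc 0 t, ∫⁻ v, ∫⁻ vs, ∫⁻ x, f x ∂(CC hB e0 (v, vs)) ∂(MM hB μ0 e0 s) ∂(MM hB μ0 e0 s) := by
  have := MM_fin hB μ0 (e0 := e0) hw
  rw [← duh_weak hB μ0 (MM hB μ0 e0) ht hf, ← BE.lim_eq (CC hB e0) μ0 measurable_LL ht]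
  congr 1
  refine setLIntegral_congr_fun measurableSet_Ioc fun s hs => ?_
  rw [← BE.lim_eq (CC hB e0) μ0 measurable_LL hs.1.le]

lemma MM_weak_inv (hw : ∫⁻ v, wh v ∂μ0 = 2) {t : ℝ} (ht : 0 ≤ t) {f : Vd d → ℝ≥0∞} (hf : Measurable f) (hi : Inv f) :
    ∫⁻ v, f v ∂(MM hB μ0 e0 t) + ∫⁻ s in Set.Ioc 0 t, 4 * ∫⁻ v, lh v * f v ∂(MM hB μ0 e0 s) =
    ∫⁻ v, f v ∂μ0 + ∫⁻ s in Set.Ioc 0 t, 2 * ((∫⁻ v, lh v * f v ∂(MM hB μ0 e0 s)) * ∫⁻ v, wh v ∂(MM hB μ0 e0 s)) := by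
  have := MM_fin hB μ0 (e0 := e0) hw
  rw [MM_weak hB μ0 hw ht hf]
  congr 1
  refine lintegral_congr fun s => ?_
  exact int_CC_inv hB _ hf hi

lemma MM_w_eq {q : ℝ} (hq : 1 < q) (hw : ∫⁻ v, wh v ∂μ0 = 2) (hfin : ∫⁻ v, ph q v ∂μ0 ≠ ∞) {T : ℝ} (hT : 0 ≤ T) :
    ∫⁻ v, wh v ∂(MM hB μ0 e0 T) = 2 := by
  set y : ℝ → ℝ≥0∞ := fun t => ∫⁻ v, wh v ∂(MM hB μ0 e0 t) with hy
  set g : ℝ → ℝ≥0∞ := fun t => ∫⁻ v, lh v * wh v ∂(MM hB μ0 e0 t) with hg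
  have my : Measurable y := measurable_lint _ measurable_wh
  have mg : Measurable g := measurable_lint _ (by fun_prop)
  have y2 : ∀ t, 0 ≤ t → y t ≤ 2 := fun t ht => MM_w hB μ0 hw ht
  have yz : ∀ t, 0 ≤ t → y t + (2 - y t) = 2 := fun t ht => add_tsub_cancel_of_le (y2 t ht)
  have gT : ∀ t, 0 ≤ t → ∫⁻ s in Set.Ioc 0 t, g s ≠ ∞ := fun t ht => MM_lw hB μ0 hq hw hfin ht
  have mz : Measurable fun t => 2 - y t := my.const_sub 2
  have key : ∀ t, 0 ≤ t → 2 - y t = ∫⁻ s in Set.Ioc 0 t, (2 * g s) * (2 - y s) := by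
    intro t ht
    have h1 : y t + ∫⁻ s in Set.Ioc 0 t, 4 * g s = 2 + ∫⁻ s in Set.Ioc 0 t, 2 * (g s * y s) := by
      have := MM_weak_inv hB μ0 (e0 := e0) hw ht measurable_wh Inv_wh
      rw [hw] at this; exact this
    have h2 : ∫⁻ s in Set.Ioc 0 t, 4 * g s = (∫⁻ s in Set.Ioc 0 t, 2 * (g s * y s)) + ∫⁻ s in Set.Ioc 0 t, (2 * g s) * (2 - y s) := by
      rw [← lintegral_add_left (by fun_prop)]
      refine setLIntegral_congr_fun measurableSet_Ioc fun s hs => ?_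
      have := yz s hs.1.le
      calc 4 * g s = 2 * g s * (y s + (2 - y s)) := by rw [this]; ring
        _ = _ := by ring
    have f1 : ∫⁻ s in Set.Ioc 0 t, 2 * (g s * y s) ≠ ∞ := by
      have : ∫⁻ s in Set.Ioc 0 t, 4 * g s ≠ ∞ := by
        rw [lintegral_const_mul _ mg]; exact ENNReal.mul_ne_top (by simp) (gT t ht)
      exact ne_top_of_le_ne_top this (h2 ▸ le_self_add)
    rw [h2] at h1
    have h1' : y t + ((∫⁻ s in Set.Ioc 0 t, 2 * (g s * y s)) + ∫⁻ s in Set.Ioc 0 t, (2 * g s) * (2 - y s)) =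
      (y t + (2 - y t)) + ∫⁻ s in Set.Ioc 0 t, 2 * (g s * y s) := by rw [yz t ht]; exact h1
    have h3 : (∫⁻ s in Set.Ioc 0 t, (2 * g s) * (2 - y s)) + (y t + ∫⁻ s in Set.Ioc 0 t, 2 * (g s * y s)) =
      (2 - y t) + (y t + ∫⁻ s in Set.Ioc 0 t, 2 * (g s * y s)) := by
      calc _ = _ := by ring
        _ = _ := h1'
        _ = _ := by ring
    have f2 : y t + ∫⁻ s in Set.Ioc 0 t, 2 * (g s * y s) ≠ ∞ :=
      ENNReal.add_ne_top.2 ⟨ne_top_of_le_ne_top (by simp) (y2 t ht), f1⟩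
    exact ((ENNReal.add_left_inj f2).1 h3).symm
  have hz := gronwall_zero (z := fun t => 2 - y t) (g := fun t => 2 * g t) (mg.const_mul 2) mz (T := T)
    (fun t => ne_top_of_le_ne_top (by simp) tsub_le_self)
    (by rw [lintegral_const_mul _ mg]; exact ENNReal.mul_ne_top (by simp) (gT T hT))
    (fun t ht => (key t ht.1).le)
    (fun s t hs hst _ => by
      rw [key s hs, key t (hs.trans hst)]
      exact lintegral_mono_set (Set.Ioc_subset_Ioc le_rfl hst)) T ⟨hT, le_rfl⟩
  have := yz T hT
  rw [hz, add_zero] at this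
  exact this

lemma MM_inv {q : ℝ} (hq : 1 < q) (hw : ∫⁻ v, wh v ∂μ0 = 2) (hfin : ∫⁻ v, ph q v ∂μ0 ≠ ∞) {t : ℝ} (ht : 0 ≤ t)
    {f : Vd d → ℝ≥0∞} (hf : Measurable f) (hi : Inv f) (hfw : ∀ v, f v ≤ 2 * wh v) :
    ∫⁻ v, f v ∂(MM hB μ0 e0 t) = ∫⁻ v, f v ∂μ0 := by
  have h := MM_weak_inv hB μ0 (e0 := e0) hw ht hf hi
  have e : ∫⁻ s in Set.Ioc 0 t, 2 * ((∫⁻ v, lh v * f v ∂(MM hB μ0 e0 s)) * ∫⁻ v, wh v ∂(MM hB μ0 e0 s)) =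
      ∫⁻ s in Set.Ioc 0 t, 4 * ∫⁻ v, lh v * f v ∂(MM hB μ0 e0 s) := by
    refine setLIntegral_congr_fun measurableSet_Ioc fun s hs => ?_
    rw [MM_w_eq hB μ0 hq hw hfin hs.1.le]; ring
  rw [e] at h
  refine (ENNReal.add_left_inj ?_).1 h
  rw [lintegral_const_mul _ (measurable_lint _ (by fun_prop))]
  refine ENNReal.mul_ne_top (by simp) ?_
  have h2 : ∫⁻ s in Set.Ioc 0 t, 2 * ∫⁻ v, lh v * wh v ∂(MM hB μ0 e0 s) ≠ ∞ := by
    rw [lintegral_const_mul _ (measurable_lint _ (by fun_prop))]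
    exact ENNReal.mul_ne_top (by simp) (MM_lw hB μ0 (e0 := e0) hq hw hfin ht)
  refine ne_top_of_le_ne_top h2 (lintegral_mono fun s => ?_)
  rw [← lintegral_const_mul (f := fun v => lh v * wh v) _ (by fun_prop)]
  refine lintegral_mono fun v => ?_
  calc lh v * f v ≤ lh v * (2 * wh v) := by gcongr; exact hfw v
    _ = _ := by ring

lemma MM_prob {q : ℝ} (hq : 1 < q) (hw : ∫⁻ v, wh v ∂μ0 = 2) (hfin : ∫⁻ v, ph q v ∂μ0 ≠ ∞) {t : ℝ} (ht : 0 ≤ t) :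
    IsProbabilityMeasure (MM hB μ0 e0 t) := by
  have h := MM_inv hB μ0 (e0 := e0) hq hw hfin ht measurable_const Inv_one (fun v => (one_le_wh v).trans (le_mul_of_one_le_left (zero_le) (by norm_num)))
  constructor
  simpa using h

lemma MM_sphere {q : ℝ} (hq : 1 < q) (h0 : μ0 ∈ boltzmannSphere d) (hfin : ∫⁻ v, ph q v ∂μ0 ≠ ∞) {t : ℝ} (ht : 0 ≤ t) :
    MM hB μ0 e0 t ∈ boltzmannSphere d := by
  obtain ⟨hw, hm⟩ := sphere_iff.1 h0
  have := MM_prob hB μ0 (e0 := e0) hq hw hfin ht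
  refine sphere_iff.2 ⟨MM_w_eq hB μ0 hq hw hfin ht, fun e he => ?_⟩
  rw [MM_inv hB μ0 hq hw hfin ht (measurable_mh e) (Inv_mh he), hm e he]
  intro v
  unfold mh wh
  rw [← ofReal_two_mul]
  apply ENNReal.ofReal_le_ofReal
  have := (abs_le.1 (mm_bound he v)).2
  linarith

lemma MM_zero (hw : ∫⁻ v, wh v ∂μ0 = 2) : MM hB μ0 e0 0 = μ0 := by
  refine Measure.ext_of_lintegral _ fun f hf => ?_
  have := MM_weak hB μ0 (e0 := e0) hw le_rfl hf
  simpa using this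

end Lim

section QQ
variable {d : ℕ}
variable {B : Vd d → Measure (Vd d)} (hB : IsCollisionKernel B) {e0 : Vd d} [hF : Fact (‖e0‖ = 1)]

abbrev gh (g : Vd d → ℝ) (v : Vd d) : ℝ≥0∞ := ENNReal.ofReal (g v)

lemma measurable_gh {g : Vd d → ℝ} (hg : Measurable g) : Measurable (gh g) := hg.ennreal_ofReal

lemma PP_real {g : Vd d → ℝ} (hg : Measurable g) (h0 : ∀ v, 0 ≤ g v) {M : ℝ} (hM : ∀ v, g v ≤ M) (v vs : Vd d) :
    ∫ σ, (g (postV v vs σ) + g (postVs v vs σ) - g v - g vs) ∂(B (v - vs)) =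
      ‖v - vs‖ * ((PP hB e0 (gh g) v vs).toReal - g v - g vs) := by
  rw [B_eq hB (e0 := e0), integral_smul_measure, ENNReal.toReal_ofReal (norm_nonneg _), smul_eq_mul]
  congr 1
  have m1 : Measurable fun σ => g (postV v vs σ) := hg.comp (measurable_postV' _ _)
  have m2 : Measurable fun σ => g (postVs v vs σ) := hg.comp (measurable_postVs' _ _)
  have hb : ∀ x, ‖g x‖ ≤ M := fun x => by rw [Real.norm_eq_abs, abs_of_nonneg (h0 x)]; exact hM x
  have i1 : Integrable (fun σ => g (postV v vs σ)) (Bh hB e0 (v - vs)) :=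
    Integrable.of_bound m1.aestronglyMeasurable M (ae_of_all _ fun σ => hb _)
  have i2 : Integrable (fun σ => g (postVs v vs σ)) (Bh hB e0 (v - vs)) :=
    Integrable.of_bound m2.aestronglyMeasurable M (ae_of_all _ fun σ => hb _)
  have i12 : Integrable (fun σ => g (postV v vs σ) + g (postVs v vs σ)) (Bh hB e0 (v - vs)) := i1.add i2
  have i3 : Integrable (fun σ => g (postV v vs σ) + g (postVs v vs σ) - g v) (Bh hB e0 (v - vs)) :=
    i12.sub (integrable_const _)
  rw [integral_sub i3 (integrable_const _), integral_sub i12 (integrable_const _)]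
  simp only [integral_const, probReal_univ, one_smul]
  congr 2
  rw [integral_eq_lintegral_of_nonneg_ae (ae_of_all _ fun σ => add_nonneg (h0 _) (h0 _)) (m1.add m2).aestronglyMeasurable]
  unfold PP gh
  congr 1
  refine lintegral_congr fun σ => ?_
  exact ENNReal.ofReal_add (h0 _) (h0 _)

lemma PP_le_bd {g : Vd d → ℝ} {M : ℝ} (hM : ∀ v, g v ≤ M) (v vs : Vd d) :
    PP hB e0 (gh g) v vs ≤ ENNReal.ofReal M + ENNReal.ofReal M := by
  unfold PP
  calc _ ≤ ∫⁻ σ, (ENNReal.ofReal M + ENNReal.ofReal M) ∂(Bh hB e0 (v - vs)) :=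
        lintegral_mono fun σ => add_le_add (ENNReal.ofReal_le_ofReal (hM _)) (ENNReal.ofReal_le_ofReal (hM _))
    _ = _ := by simp

lemma PP_pt {g : Vd d → ℝ} (hg : Measurable g) (h0 : ∀ v, 0 ≤ g v) {M : ℝ} (hM : ∀ v, g v ≤ M) (v vs : Vd d) :
    2 * ∫ σ, (g (postV v vs σ) + g (postVs v vs σ) - g v - g vs) ∂(B (v - vs)) =
      (∫⁻ x, gh g x ∂(CC hB e0 (v, vs)) + ∫⁻ x, gh g x ∂(CC hB e0 (vs, v))).toReal -
      (2 * (lh v * gh g v * wh vs + lh vs * gh g vs * wh v)).toReal := by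
  rw [PP_real hB (e0 := e0) hg h0 hM, CC_sym hB v vs (measurable_gh hg)]
  have hP : PP hB e0 (gh g) v vs ≠ ∞ := ne_top_of_le_ne_top (by simp) (PP_le_bd hB hM v vs)
  have l1 := norm_sub_le_Lam v vs
  have l2 := norm_sub_le_Lam vs v
  rw [norm_sub_rev] at l2
  have p1 := ell_pos v
  have p2 := ww_pos v
  have p4 := ell_pos vs
  have p5 := ww_pos vs
  rw [ENNReal.toReal_add (ENNReal.mul_ne_top ENNReal.ofReal_ne_top hP)
    (ENNReal.add_ne_top.2 ⟨ENNReal.mul_ne_top ENNReal.ofReal_ne_top ENNReal.ofReal_ne_top, ENNReal.mul_ne_top ENNReal.ofReal_ne_top ENNReal.ofReal_ne_top⟩),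
    ENNReal.toReal_add (ENNReal.mul_ne_top ENNReal.ofReal_ne_top ENNReal.ofReal_ne_top) (ENNReal.mul_ne_top ENNReal.ofReal_ne_top ENNReal.ofReal_ne_top)]
  unfold lh wh
  rw [ENNReal.toReal_mul (a := 2), ENNReal.toReal_add (by finiteness) (by finiteness)]
  simp only [ENNReal.toReal_mul]
  rw [ENNReal.toReal_ofReal (by positivity), ENNReal.toReal_ofReal (by linarith), ENNReal.toReal_ofReal (h0 v),
    ENNReal.toReal_ofReal (by linarith), ENNReal.toReal_ofReal (h0 vs), ENNReal.toReal_ofReal p1.le,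
    ENNReal.toReal_ofReal p2.le, ENNReal.toReal_ofReal p4.le, ENNReal.toReal_ofReal p5.le]
  simp only [ENNReal.toReal_ofNat]
  ring

lemma lh_le (v : Vd d) : lh v ≤ 2 * wh v := by
  unfold lh wh
  rw [← ofReal_two_mul]
  apply ENNReal.ofReal_le_ofReal
  unfold ell ww; nlinarith [sq_nonneg (‖v‖ - 1)]

lemma lhg_le {g : Vd d → ℝ} {M : ℝ} (hM : ∀ v, g v ≤ M) {μ : Measure (Vd d)} (hw : ∫⁻ v, wh v ∂μ = 2) :
    ∫⁻ v, lh v * gh g v ∂μ ≤ 4 * ENNReal.ofReal M := by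
  calc _ ≤ ∫⁻ v, (2 * ENNReal.ofReal M) * wh v ∂μ := by
        refine lintegral_mono fun v => ?_
        calc _ ≤ (2 * wh v) * ENNReal.ofReal M := mul_le_mul' (lh_le v) (ENNReal.ofReal_le_ofReal (hM v))
          _ = _ := by ring
    _ = _ := by rw [lintegral_const_mul _ measurable_wh, hw]; ring

lemma Inv_const (a : ℝ≥0∞) : Inv (fun _ : Vd d => a) := fun _ _ _ _ => rfl

lemma CCg_le {g : Vd d → ℝ} {M : ℝ} (hM : ∀ v, g v ≤ M) {μ : Measure (Vd d)} [SFinite μ] (hw : ∫⁻ v, wh v ∂μ = 2) :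
    ∫⁻ v, ∫⁻ vs, ∫⁻ x, gh g x ∂(CC hB e0 (v, vs)) ∂μ ∂μ ≤ 16 * ENNReal.ofReal M := by
  have h := int_CC_inv hB (e0 := e0) μ (f := fun _ => ENNReal.ofReal M) measurable_const (Inv_const _)
  calc _ ≤ ∫⁻ v, ∫⁻ vs, ∫⁻ x, ENNReal.ofReal M ∂(CC hB e0 (v, vs)) ∂μ ∂μ :=
        lintegral_mono fun v => lintegral_mono fun vs => lintegral_mono fun x => ENNReal.ofReal_le_ofReal (hM x)
    _ = _ := h
    _ ≤ 2 * ((4 * ENNReal.ofReal M) * 2) := by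
        have h1 := lhg_le (g := fun _ : Vd d => M) (M := M) (fun _ => le_rfl) hw
        have h2 : ∫⁻ v : Vd d, ENNReal.ofReal (ww v) ∂μ = 2 := hw
        rw [h2]
        gcongr
        exact h1
    _ = _ := by ring

lemma QInt_eq {g : Vd d → ℝ} (hg : Measurable g) (h0 : ∀ v, 0 ≤ g v) {M : ℝ} (hM : ∀ v, g v ≤ M)
    {μ : Measure (Vd d)} [SFinite μ] (hw : ∫⁻ v, wh v ∂μ = 2) :
    QInt B g μ μ = (∫⁻ v, ∫⁻ vs, ∫⁻ x, gh g x ∂(CC hB e0 (v, vs)) ∂μ ∂μ).toReal -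
      (4 * ∫⁻ v, lh v * gh g v ∂μ).toReal := by
  have mC := measurable_CCf hB (e0 := e0) (measurable_gh hg)
  have mgh := measurable_gh hg
  set a : Vd d × Vd d → ℝ≥0∞ := fun z => ∫⁻ x, gh g x ∂(CC hB e0 (z.1, z.2)) + ∫⁻ x, gh g x ∂(CC hB e0 (z.2, z.1)) with ha
  set b : Vd d × Vd d → ℝ≥0∞ := fun z => 2 * (lh z.1 * gh g z.1 * wh z.2 + lh z.2 * gh g z.2 * wh z.1) with hb
  have ma : Measurable a := mC.add (mC.comp measurable_swap)
  have mb0 : Measurable (Function.uncurry fun v vs : Vd d => lh v * gh g v * wh vs) := by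
    unfold Function.uncurry; fun_prop
  have mb1 : Measurable fun z : Vd d × Vd d => (lh z.1 * gh g z.1 * wh z.2 + lh z.2 * gh g z.2 * wh z.1) := by
    fun_prop
  have mb : Measurable b := mb1.const_mul 2
  have Ia : ∫⁻ z, a z ∂(μ.prod μ) = 2 * ∫⁻ v, ∫⁻ vs, ∫⁻ x, gh g x ∂(CC hB e0 (v, vs)) ∂μ ∂μ := by
    rw [lintegral_prod _ ma.aemeasurable, two_int μ mC]
  have Ib : ∫⁻ z, b z ∂(μ.prod μ) = 2 * (4 * ∫⁻ v, lh v * gh g v ∂μ) := by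
    rw [hb, lintegral_const_mul (f := fun z : Vd d × Vd d => (lh z.1 * gh g z.1 * wh z.2 + lh z.2 * gh g z.2 * wh z.1)) _
      mb1,
      lintegral_prod _ mb1.aemeasurable]
    have := two_int μ mb0
    dsimp only
    rw [← this, dbl_int (by fun_prop) measurable_wh, hw]; ring
  have fa : ∫⁻ z, a z ∂(μ.prod μ) ≠ ∞ := by
    rw [Ia]; exact ENNReal.mul_ne_top (by simp) (ne_top_of_le_ne_top (by finiteness) (CCg_le hB hM hw))
  have fb : ∫⁻ z, b z ∂(μ.prod μ) ≠ ∞ := by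
    rw [Ib]; exact ENNReal.mul_ne_top (by simp) (ENNReal.mul_ne_top (by simp) (ne_top_of_le_ne_top (by finiteness) (lhg_le hM hw)))
  have ia := integrable_toReal_of_lintegral_ne_top ma.aemeasurable fa
  have ib := integrable_toReal_of_lintegral_ne_top mb.aemeasurable fb
  have e1 : QInt B g μ μ = ∫ v, ∫ vs, (fun z : Vd d × Vd d => (1/2 : ℝ) * ((a z).toReal - (b z).toReal)) (v, vs) ∂μ ∂μ := by
    unfold QInt
    congr 1; ext v; congr 1; ext vs
    have := PP_pt hB (e0 := e0) hg h0 hM v vs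
    simp only [ha, hb]
    rw [← this]; ring
  rw [e1, ← integral_prod (fun z : Vd d × Vd d => (1/2 : ℝ) * ((a z).toReal - (b z).toReal)) ((ia.sub ib).const_mul _), integral_const_mul, integral_sub ia ib,
    integral_toReal ma.aemeasurable (ae_lt_top ma fa), integral_toReal mb.aemeasurable (ae_lt_top mb fb), Ia, Ib,
    ENNReal.toReal_mul (a := 2), ENNReal.toReal_mul (a := 2) (b := 4 * _)]
  simp only [ENNReal.toReal_ofNat]
  ring

lemma measurable_CCt (N : Kernel ℝ (Vd d)) [IsSFiniteKernel N] {f : Vd d → ℝ≥0∞} (hf : Measurable f) :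
    Measurable fun s => ∫⁻ v, ∫⁻ vs, ∫⁻ x, f x ∂(CC hB e0 (v, vs)) ∂(N s) ∂(N s) := by
  simp_rw [← lintegral_qk (CC hB e0) N _ hf]
  exact measurable_lint _ hf

lemma weak_iff (N : Kernel ℝ (Vd d)) [IsSFiniteKernel N] (hN : ∀ t, 0 ≤ t → IsProbabilityMeasure (N t))
    (hw : ∀ t, 0 ≤ t → ∫⁻ v, wh v ∂(N t) = 2) {g : Vd d → ℝ} (hg : Measurable g)
    (h0 : ∀ v, 0 ≤ g v) {M : ℝ} (hM : ∀ v, g v ≤ M) {t : ℝ} (ht : 0 ≤ t) :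
    (∫ v, g v ∂(N t) = ∫ v, g v ∂(N 0) + ∫ s in Set.Ioc 0 t, QInt B g (N s) (N s)) ↔
    (∫⁻ v, gh g v ∂(N t) + ∫⁻ s in Set.Ioc 0 t, 4 * ∫⁻ v, lh v * gh g v ∂(N s) =
    ∫⁻ v, gh g v ∂(N 0) + ∫⁻ s in Set.Ioc 0 t, ∫⁻ v, ∫⁻ vs, ∫⁻ x, gh g x ∂(CC hB e0 (v, vs)) ∂(N s) ∂(N s)) := by
  have mgh := measurable_gh hg
  have mX := measurable_CCt hB (e0 := e0) N mgh
  have mY : Measurable fun s => 4 * ∫⁻ v, lh v * gh g v ∂(N s) := (measurable_lint N (by fun_prop)).const_mul 4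
  have fX : ∫⁻ s in Set.Ioc 0 t, ∫⁻ v, ∫⁻ vs, ∫⁻ x, gh g x ∂(CC hB e0 (v, vs)) ∂(N s) ∂(N s) ≠ ∞ := by
    refine ne_top_of_le_ne_top (b := ∫⁻ s in Set.Ioc 0 t, 16 * ENNReal.ofReal M) ?_
      (setLIntegral_mono' measurableSet_Ioc fun s hs => CCg_le hB hM (hw s hs.1.le))
    rw [setLIntegral_const, Real.volume_Ioc]; finiteness
  have fY : ∫⁻ s in Set.Ioc 0 t, 4 * ∫⁻ v, lh v * gh g v ∂(N s) ≠ ∞ := by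
    refine ne_top_of_le_ne_top (b := ∫⁻ s in Set.Ioc 0 t, 4 * (4 * ENNReal.ofReal M)) ?_
      (setLIntegral_mono' measurableSet_Ioc fun s hs => ?_)
    · rw [setLIntegral_const, Real.volume_Ioc]; finiteness
    · have := lhg_le hM (hw s hs.1.le)
      gcongr
  have iX := integrable_toReal_of_lintegral_ne_top mX.aemeasurable fX
  have iY := integrable_toReal_of_lintegral_ne_top mY.aemeasurable fY
  have eQ : ∫ s in Set.Ioc 0 t, QInt B g (N s) (N s) =
      (∫⁻ s in Set.Ioc 0 t, ∫⁻ v, ∫⁻ vs, ∫⁻ x, gh g x ∂(CC hB e0 (v, vs)) ∂(N s) ∂(N s)).toReal -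
      (∫⁻ s in Set.Ioc 0 t, 4 * ∫⁻ v, lh v * gh g v ∂(N s)).toReal := by
    rw [← integral_toReal mX.aemeasurable (ae_lt_top mX fX), ← integral_toReal mY.aemeasurable (ae_lt_top mY fY),
      ← integral_sub iX iY]
    refine setIntegral_congr_fun measurableSet_Ioc fun s hs => ?_
    exact QInt_eq hB hg h0 hM (hw s hs.1.le)
  have fg : ∀ t, 0 ≤ t → ∫⁻ v, gh g v ∂(N t) ≠ ∞ := by
    intro t ht
    have := hN t ht
    refine ne_top_of_le_ne_top (b := ∫⁻ v, ENNReal.ofReal M ∂(N t)) (by simp) (lintegral_mono fun v => ENNReal.ofReal_le_ofReal (hM v))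
  have eg : ∀ t, ∫ v, g v ∂(N t) = (∫⁻ v, gh g v ∂(N t)).toReal := fun t =>
    integral_eq_lintegral_of_nonneg_ae (ae_of_all _ h0) hg.aestronglyMeasurable
  rw [eQ, eg t, eg 0, ← ENNReal.toReal_eq_toReal_iff' (ENNReal.add_ne_top.2 ⟨fg t ht, fY⟩) (ENNReal.add_ne_top.2 ⟨fg 0 le_rfl, fX⟩),
    ENNReal.toReal_add (fg t ht) fY, ENNReal.toReal_add (fg 0 le_rfl) fX]
  constructor <;> intro h <;> linarith

end QQ

section Fin
variable {d : ℕ}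
variable {B : Vd d → Measure (Vd d)} (hB : IsCollisionKernel B) {e0 : Vd d} [hF : Fact (‖e0‖ = 1)]

lemma QInt_shift (f : Vd d → ℝ) (M : ℝ) (μ ν : Measure (Vd d)) : QInt B (fun v => f v + M) μ ν = QInt B f μ ν := by
  unfold QInt
  congr 1; ext v; congr 1; ext vs; congr 1; ext σ; ring

lemma MM_sol (μ0 : Measure (Vd d)) [IsProbabilityMeasure μ0] {q : ℝ} (hq : 1 < q) (h0 : μ0 ∈ boltzmannSphere d)
    (hfin : ∫⁻ v, ph q v ∂μ0 ≠ ∞) : IsBoltzmannSolution B (fun t => MM hB μ0 e0 t) := by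
  have hw := (sphere_iff.1 h0).1
  have := MM_fin hB μ0 (e0 := e0) hw
  refine ⟨fun t ht => MM_sphere hB μ0 hq h0 hfin ht, fun f hf hb _ t ht => ?_⟩
  obtain ⟨M, hM⟩ := hb
  have key := (weak_iff hB (e0 := e0) (MM hB μ0 e0) (fun t ht => MM_prob hB μ0 hq hw hfin ht)
    (fun t ht => MM_w_eq hB μ0 hq hw hfin ht) (g := fun v => f v + M) (by fun_prop)
    (fun v => by have := (abs_le.1 (hM v)).1; linarith) (M := 2 * M)
    (fun v => by have := (abs_le.1 (hM v)).2; linarith) ht).2 (by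
      have := MM_weak hB μ0 (e0 := e0) hw ht (f := gh (fun v => f v + M)) (measurable_gh (by fun_prop))
      rw [this, MM_zero hB μ0 hw])
  simp_rw [QInt_shift] at key
  have p1 := MM_prob hB μ0 (e0 := e0) hq hw hfin ht
  have p0 := MM_prob hB μ0 (e0 := e0) hq hw hfin le_rfl
  have i : ∀ ν : Measure (Vd d), IsProbabilityMeasure ν → ∫ v, (f v + M) ∂ν = ∫ v, f v ∂ν + M := by
    intro ν hν
    rw [integral_add (Integrable.of_bound hf.aestronglyMeasurable M (ae_of_all _ hM)) (integrable_const _)]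
    simp
  rw [i _ p1, i _ p0] at key
  linarith

lemma prim_meas (Q : ℝ → ℝ) : Measurable fun t : ℝ => ∫ s in Set.Ioc 0 t, Q s := by
  classical
  set A : Set ℝ := {t | IntegrableOn Q (Set.Ioc 0 t)} with hA
  have hlow : ∀ {s t : ℝ}, s ≤ t → t ∈ A → s ∈ A := fun hst ht =>
    IntegrableOn.mono_set (show IntegrableOn Q (Set.Ioc 0 _) volume from ht) (Set.Ioc_subset_Ioc le_rfl hst)
  have mA : MeasurableSet A := by
    have : A.OrdConnected := ⟨fun x hx y hy z hz => hlow hz.2 hy⟩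
    exact this.measurableSet
  have e : (fun t : ℝ => ∫ s in Set.Ioc 0 t, Q s) = A.piecewise (fun t : ℝ => ∫ s in Set.Ioc 0 t, Q s) (fun _ => 0) := by
    ext t
    by_cases ht : t ∈ A
    · simp [ht]
    · rw [Set.piecewise_eq_of_notMem _ _ _ ht]
      exact integral_undef ht
  rw [e]
  refine ContinuousOn.measurable_piecewise ?_ continuousOn_const mA
  have hcont : ∀ T ∈ A, ContinuousOn (fun t : ℝ => ∫ s in Set.Ioc 0 t, Q s) (Set.Iic T) := by
    intro T hT
    have hi : Integrable ((Set.Ioc 0 T).indicator Q) := (integrable_indicator_iff measurableSet_Ioc).2 hT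
    have hc : Continuous fun t : ℝ => ∫ s in (0:ℝ)..(max t 0), (Set.Ioc 0 T).indicator Q s :=
      (intervalIntegral.continuous_primitive (fun a b => hi.intervalIntegrable) 0).comp (continuous_id.max continuous_const)
    refine hc.continuousOn.congr fun t ht => ?_
    dsimp only
    rcases le_total t 0 with h | h
    · rw [max_eq_right h]; simp [h]
    · rw [max_eq_left h, intervalIntegral.integral_of_le h]
      refine setIntegral_congr_fun measurableSet_Ioc fun s hs => ?_
      rw [Set.indicator_of_mem]
      exact ⟨hs.1, hs.2.trans ht⟩
  intro t ht
  by_cases hm : ∃ T ∈ A, t < T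
  · obtain ⟨T, hT, htT⟩ := hm
    exact ((hcont T hT).continuousAt (Iic_mem_nhds htT)).continuousWithinAt
  · push Not at hm
    exact (hcont t ht t Set.self_mem_Iic).mono hm

lemma meas_eq_iSup (μ : Measure (Vd d)) (s : Set (Vd d)) (hs : MeasurableSet s) :
    μ s = ⨆ n : ℕ, μ (s ∩ Metric.closedBall 0 n) := by
  have hmono : Monotone fun n : ℕ => s ∩ Metric.closedBall (0 : Vd d) n := fun i j hij =>
    Set.inter_subset_inter_right _ (Metric.closedBall_subset_closedBall (by exact_mod_cast hij))
  rw [← hmono.measure_iUnion, ← Set.inter_iUnion, Metric.iUnion_closedBall_nat, Set.inter_univ]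

lemma hcs_ind {f : Vd d → ℝ} {R : ℝ} (h : ∀ v, v ∉ Metric.closedBall (0 : Vd d) R → f v = 0) : HasCompactSupport f :=
  HasCompactSupport.intro (isCompact_closedBall 0 R) h

lemma sol_meas {νt : ℝ → Measure (Vd d)} (hν : IsBoltzmannSolution B νt) :
    Measurable fun t : ℝ => νt (max t 0) := by
  refine Measure.measurable_of_measurable_coe _ fun s hs => ?_
  simp_rw [meas_eq_iSup _ s hs]
  refine Measurable.iSup fun n => ?_
  have ms : MeasurableSet (s ∩ Metric.closedBall (0 : Vd d) n) := hs.inter Metric.isClosed_closedBall.measurableSet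
  have h := hν.2 ((s ∩ Metric.closedBall (0 : Vd d) n).indicator fun _ => (1:ℝ)) (measurable_const.indicator ms)
    ⟨1, fun v => by by_cases hv : v ∈ s ∩ Metric.closedBall (0 : Vd d) n <;> simp [Set.indicator, hv]⟩
    (hcs_ind (R := n) fun v hv => Set.indicator_of_notMem (fun hv' => hv hv'.2) _)
  have e : (fun t : ℝ => νt (max t 0) (s ∩ Metric.closedBall 0 n)) = fun t : ℝ => ENNReal.ofReal
      (∫ v, (s ∩ Metric.closedBall (0 : Vd d) n).indicator (fun _ => (1:ℝ)) v ∂(νt 0) +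
        ∫ r in Set.Ioc 0 (max t 0), QInt B ((s ∩ Metric.closedBall (0 : Vd d) n).indicator fun _ => (1:ℝ)) (νt r) (νt r)) := by
    ext t
    rw [← h (max t 0) (le_max_right _ _)]
    have := (hν.1 (max t 0) (le_max_right _ _)).1
    rw [integral_indicator ms, setIntegral_const, smul_eq_mul, mul_one, measureReal_def, ENNReal.ofReal_toReal (measure_ne_top _ _)]
  rw [e]
  refine Measurable.ennreal_ofReal (Measurable.const_add ?_ _)
  exact (prim_meas _).comp (measurable_id.max measurable_const)

lemma sol_mild {νt : ℝ → Measure (Vd d)} (hν : IsBoltzmannSolution B νt) {t : ℝ} (ht : 0 ≤ t)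
    (N : Kernel ℝ (Vd d)) (hN : ∀ t, 0 ≤ t → N t = νt t) [IsSFiniteKernel N] [SFinite (νt 0)] :
    N t = duh LL (νt 0) (qk (CC hB e0) N) t := by
  have hp : ∀ t, 0 ≤ t → IsProbabilityMeasure (N t) := fun t ht => by rw [hN t ht]; exact (hν.1 t ht).1
  have hw : ∀ t, 0 ≤ t → ∫⁻ v, wh v ∂(N t) = 2 := fun t ht => by
    have := hp t ht
    exact (sphere_iff.1 (by rw [hN t ht]; exact hν.1 t ht)).1
  have weak : ∀ g : Vd d → ℝ, Measurable g → (∀ v, 0 ≤ g v) → ∀ M : ℝ, (∀ v, g v ≤ M) → ∀ R : ℝ,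
      (∀ v, v ∉ Metric.closedBall (0 : Vd d) R → g v = 0) → ∀ r, 0 ≤ r →
      Weak LL (νt 0) (qk (CC hB e0) N) N r (gh g) := by
    intro g hg h0 M hM R hR r hr
    have h := hν.2 g hg ⟨M, fun v => by rw [abs_of_nonneg (h0 v)]; exact hM v⟩ (hcs_ind hR) r hr
    have e : ∫ s in Set.Ioc 0 r, QInt B g (νt s) (νt s) = ∫ s in Set.Ioc 0 r, QInt B g (N s) (N s) :=
      setIntegral_congr_fun measurableSet_Ioc fun s hs => by rw [hN s hs.1.le]
    rw [e, ← hN r hr, ← hN 0 le_rfl] at h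
    have h2 := (weak_iff hB (e0 := e0) N hp hw hg h0 hM hr).1 h
    unfold Weak
    simp_rw [lintegral_qk (CC hB e0) N _ (measurable_gh hg)]
    rw [← hN 0 le_rfl, ← h2]
    congr 1
    refine lintegral_congr fun s => ?_
    have mg := measurable_gh hg
    rw [← lintegral_const_mul (f := fun v => lh v * gh g v) _ (by fun_prop)]
    refine lintegral_congr fun v => ?_
    rw [LL_eq, mul_assoc]
  refine Measure.ext fun s hs => ?_
  rw [meas_eq_iSup _ s hs, meas_eq_iSup (duh _ _ _ _) s hs]
  congr 1; ext n
  have ms : MeasurableSet (s ∩ Metric.closedBall (0 : Vd d) n) := hs.inter Metric.isClosed_closedBall.measurableSet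
  set S := s ∩ Metric.closedBall (0 : Vd d) n with hS
  set g : Vd d → ℝ := S.indicator fun _ => 1 with hg
  have mg : Measurable g := measurable_const.indicator ms
  have g0 : ∀ v, 0 ≤ g v := fun v => Set.indicator_nonneg (fun _ _ => zero_le_one) v
  have g1 : ∀ v, g v ≤ 1 := fun v => Set.indicator_le_self' (fun _ _ => zero_le_one) v
  have gR : ∀ v, v ∉ Metric.closedBall (0 : Vd d) n → g v = 0 := fun v hv => Set.indicator_of_notMem (fun hv' => hv hv'.2) _
  have eg : ∀ μ : Measure (Vd d), ∫⁻ v, gh g v ∂μ = μ S := by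
    intro μ
    rw [← lintegral_indicator_one ms]
    refine lintegral_congr fun v => ?_
    by_cases hv : v ∈ S <;> simp [gh, g, hv]
  rw [← eg, ← eg]
  refine weak_to_mild (νt 0) _ measurable_LL LL_nonneg ht N (measurable_gh mg) ?_ (weak g mg g0 1 g1 n gR t ht) ?_
  · intro r hr
    have mL := measurable_LL (d := d)
    have := weak (fun v => LL v * Real.exp (-(LL v * (t - r))) * g v) (by fun_prop)
      (fun v => mul_nonneg (mul_nonneg (LL_nonneg v) (Real.exp_pos _).le) (g0 v)) (4 * (1 + n)) (fun v => by
        by_cases hv : v ∈ Metric.closedBall (0 : Vd d) n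
        · rw [mem_closedBall_zero_iff] at hv
          have h1 : LL v ≤ 4 * (1 + n) := by unfold LL; linarith
          have h2 : Real.exp (-(LL v * (t - r))) ≤ 1 := by
            rw [Real.exp_le_one_iff]
            have := mul_nonneg (LL_nonneg v) (sub_nonneg.2 hr.2); linarith
          have h3 : LL v * Real.exp (-(LL v * (t - r))) ≤ LL v := mul_le_of_le_one_right (LL_nonneg v) h2
          have h4 : LL v * Real.exp (-(LL v * (t - r))) * g v ≤ LL v * Real.exp (-(LL v * (t - r))) :=
            mul_le_of_le_one_right (mul_nonneg (LL_nonneg v) (Real.exp_pos _).le) (g1 v)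
          linarith
        · rw [gR v hv, mul_zero]; positivity) n (fun v hv => by rw [gR v hv, mul_zero]) r hr.1.le
    have e2 : gh (fun v => LL v * Real.exp (-(LL v * (t - r))) * g v) =
        fun v => ENNReal.ofReal (LL v) * ee LL (t - r) v * gh g v := by
      ext v
      unfold gh ee
      rw [ENNReal.ofReal_mul (mul_nonneg (LL_nonneg v) (Real.exp_pos _).le), ENNReal.ofReal_mul (LL_nonneg v)]
    rw [e2] at this
    exact this
  · refine ne_top_of_le_ne_top (b := ∫⁻ s in Set.Ioc 0 t, 4 * (4 * ENNReal.ofReal 1)) ?_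
      (setLIntegral_mono' measurableSet_Ioc fun s hs => ?_)
    · rw [setLIntegral_const, Real.volume_Ioc]; finiteness
    · calc _ = 4 * ∫⁻ v, lh v * gh g v ∂(N s) := by
            have mg' := measurable_gh mg
            rw [← lintegral_const_mul (f := fun v => lh v * gh g v) _ (by fun_prop)]
            refine lintegral_congr fun v => ?_
            rw [LL_eq, mul_assoc]
        _ ≤ _ := by gcongr; exact lhg_le g1 (hw s hs.1.le)

lemma sol_unique (μ0 : Measure (Vd d)) [IsProbabilityMeasure μ0] {q : ℝ} (hq : 1 < q) (h0 : μ0 ∈ boltzmannSphere d)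
    (hfin : ∫⁻ v, ph q v ∂μ0 ≠ ∞) {νt : ℝ → Measure (Vd d)} (hν0 : νt 0 = μ0) (hν : IsBoltzmannSolution B νt)
    {t : ℝ} (ht : 0 ≤ t) : νt t = MM hB μ0 e0 t := by
  let N : Kernel ℝ (Vd d) := ⟨fun t => νt (max t 0), sol_meas hν⟩
  have hN : ∀ t, 0 ≤ t → N t = νt t := fun t ht => by
    change νt (max t 0) = νt t
    rw [max_eq_left ht]
  have : IsMarkovKernel N := ⟨fun t => (hν.1 (max t 0) (le_max_right _ _)).1⟩
  have p1 : IsProbabilityMeasure (νt t) := (hν.1 t ht).1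
  have p2 := MM_prob hB μ0 (e0 := e0) hq (sphere_iff.1 h0).1 hfin ht
  subst hν0
  have hle : MM hB (νt 0) e0 t ≤ N t := lim_le_of_mild (CC hB e0) (νt 0) measurable_LL N
    (fun t ht => sol_mild hB hν ht N hN) ht
  rw [hN t ht] at hle
  exact (Measure.eq_of_le_of_measure_univ_eq hle (by simp)).symm

lemma mom_le_ph {p : ℝ} (hp : 2 < p) (v : Vd d) : (‖v‖₊ : ℝ≥0∞) ^ p ≤ ph (p / 2) v := by
  have e : (‖v‖₊ : ℝ≥0∞) = ENNReal.ofReal ‖v‖ := by rw [ofReal_norm_eq_enorm]; rfl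
  rw [e, ENNReal.ofReal_rpow_of_nonneg (norm_nonneg _) (by linarith)]
  unfold ph phi
  apply ENNReal.ofReal_le_ofReal
  calc ‖v‖ ^ p = (‖v‖ ^ 2) ^ (p / 2) := by
        rw [← Real.rpow_natCast, ← Real.rpow_mul (norm_nonneg _)]; congr 1; push_cast; ring
    _ ≤ _ := by
        apply Real.rpow_le_rpow (by positivity) _ (by linarith)
        unfold ww; linarith

lemma ph_le_mom {p : ℝ} (hp : 2 < p) (v : Vd d) :
    ph (p / 2) v ≤ ENNReal.ofReal (2 ^ (p / 2)) * (1 + (‖v‖₊ : ℝ≥0∞) ^ p) := by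
  have e : (‖v‖₊ : ℝ≥0∞) = ENNReal.ofReal ‖v‖ := by rw [ofReal_norm_eq_enorm]; rfl
  have q0 : 0 ≤ p / 2 := by linarith
  rw [e, ENNReal.ofReal_rpow_of_nonneg (norm_nonneg _) (by linarith), ← ENNReal.ofReal_one, ← ENNReal.ofReal_add (by norm_num) (by positivity),
    ← ENNReal.ofReal_mul (by positivity)]
  unfold ph phi
  apply ENNReal.ofReal_le_ofReal
  have hpp : ‖v‖ ^ p = (‖v‖ ^ 2) ^ (p / 2) := by
    rw [← Real.rpow_natCast, ← Real.rpow_mul (norm_nonneg _)]; congr 1; push_cast; ring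
  rcases le_total ‖v‖ 1 with h | h
  · calc ww v ^ (p / 2) ≤ 2 ^ (p / 2) := by
          apply Real.rpow_le_rpow (ww_pos v).le _ q0
          unfold ww; nlinarith [norm_nonneg v]
      _ ≤ _ := by
          have : 0 ≤ ‖v‖ ^ p := by positivity
          have h2 : (0:ℝ) ≤ 2 ^ (p / 2) := by positivity
          nlinarith
  · calc ww v ^ (p / 2) ≤ (2 * ‖v‖ ^ 2) ^ (p / 2) := by
          apply Real.rpow_le_rpow (ww_pos v).le _ q0
          unfold ww; nlinarith [norm_nonneg v]
      _ = 2 ^ (p / 2) * ‖v‖ ^ p := by rw [Real.mul_rpow (by norm_num) (by positivity), hpp]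
      _ ≤ _ := by
          have h2 : (0:ℝ) ≤ 2 ^ (p / 2) := by positivity
          nlinarith

lemma ph_fin {p : ℝ} (hp : 2 < p) {μ0 : Measure (Vd d)} [IsProbabilityMeasure μ0] (h : momentL p μ0 ≠ ∞) :
    ∫⁻ v, ph (p / 2) v ∂μ0 ≠ ∞ := by
  refine ne_top_of_le_ne_top ?_ (lintegral_mono (ph_le_mom hp))
  have m : Measurable fun v : Vd d => (‖v‖₊ : ℝ≥0∞) ^ p := by fun_prop
  rw [lintegral_const_mul _ (by fun_prop), lintegral_add_left measurable_const]
  refine ENNReal.mul_ne_top ENNReal.ofReal_ne_top (ENNReal.add_ne_top.2 ⟨by simp, h⟩)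

end Fin

end BE

/-- Well-posedness of the spatially homogeneous Boltzmann equation in 𝒮(p)
(part of Theorem 10.1). -/
theorem boltzmann_existence_uniqueness
    (d : ℕ) (hd : 2 ≤ d) (B : Vd d → Measure (Vd d)) (κ : ℝ)
    (hB : IsCollisionKernel B) (hBL : IsLipschitzKernel B κ)
    (p : ℝ) (hp : 2 < p)
    (μ0 : Measure (Vd d)) (hμ0 : μ0 ∈ boltzmannSphere d)
    (hμ0p : momentL p μ0 ≠ ⊤) :
    ∃ μt : ℝ → Measure (Vd d),
      μt 0 = μ0 ∧ IsBoltzmannSolution B μt ∧ LocBddMomentFrom p 0 μt ∧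
      ∀ νt : ℝ → Measure (Vd d),
        νt 0 = μ0 → IsBoltzmannSolution B νt → LocBddMomentFrom p 0 νt →
        ∀ t : ℝ, 0 ≤ t → νt t = μt t := by
  have hpr : IsProbabilityMeasure μ0 := hμ0.1
  have hd0 : 0 < d := by omega
  have hF : Fact (‖(EuclideanSpace.single (⟨0, hd0⟩ : Fin d) (1:ℝ) : Vd d)‖ = 1) := ⟨by simp⟩
  have hq : 1 < p / 2 := by linarith
  have hfin := BE.ph_fin hp hμ0p
  have hw := (BE.sphere_iff.1 hμ0).1
  refine ⟨fun t => BE.MM hB μ0 (EuclideanSpace.single (⟨0, hd0⟩ : Fin d) (1:ℝ)) t, BE.MM_zero hB μ0 hw,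
    BE.MM_sol hB μ0 hq hμ0 hfin, ?_, fun νt h0 h _ t ht => BE.sol_unique hB μ0 hq hμ0 hfin h0 h ht⟩
  intro T hT
  obtain ⟨M, hM, h⟩ := (BE.MM_phi hB μ0 (e0 := EuclideanSpace.single (⟨0, hd0⟩ : Fin d) (1:ℝ)) hq hw hfin hT).1
  exact ⟨M, hM, fun t ht => (lintegral_mono (BE.mom_le_ph hp)).trans (h t ht)⟩
end
end

section
/- Let d ≥ 2. The function W(μ,ν) = sup_{f ∈ ℱ} ∫ f d(μ − ν) defines a metric on the Boltzmann sphere 𝒮, and the metric space (𝒮, W) is complete and separable. -/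
open MeasureTheory ProbabilityTheory Filter
open scoped ENNReal NNReal RealInnerProductSpace

noncomputable section

open KacModel

namespace KacAux

def wn {d : ℕ} (v : Vd d) : ℝ≥0 := (1 + ‖v‖₊ ^ 2) / 2

lemma wn_coe {d : ℕ} (v : Vd d) : ((wn v : ℝ≥0) : ℝ) = (1 + ‖v‖ ^ 2) / 2 := by
  simp [wn]

lemma wn_pos {d : ℕ} (v : Vd d) : 0 < wn v := by
  unfold wn; positivity

lemma wn_cont {d : ℕ} : Continuous (wn : Vd d → ℝ≥0) := by
  unfold wn; fun_prop

def pm {d : ℕ} (μ : Measure (Vd d)) : Measure (Vd d) :=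
  μ.withDensity (fun v => (wn v : ℝ≥0∞))

def qm {d : ℕ} (μ : Measure (Vd d)) : Measure (Vd d) :=
  μ.withDensity (fun v => ((wn v)⁻¹ : ℝ≥0))

def BL (d : ℕ) : Set (Vd d → ℝ) :=
  {g | (∀ v, |g v| ≤ 1) ∧ ∀ v v', |g v - g v'| ≤ ‖v - v'‖}

variable {d : ℕ}

lemma qm_pm (μ : Measure (Vd d)) : qm (pm μ) = μ := by
  have := withDensity_inv_same (μ := μ) (f := fun v => (wn v : ℝ≥0∞))
    (by have := wn_cont (d := d); fun_prop)
    (by simp [(wn_pos _).ne']) (by simp)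
  unfold qm pm
  convert! this using 3 with v
  rw [ENNReal.coe_inv (wn_pos v).ne']

lemma pm_qm (μ : Measure (Vd d)) : pm (qm μ) = μ := by
  have := withDensity_inv_same (μ := μ) (f := fun v => (((wn v)⁻¹ : ℝ≥0) : ℝ≥0∞))
    (by have := (wn_cont (d := d)).measurable; fun_prop)
    (by simp [(wn_pos _).ne']) (by simp)
  unfold qm pm
  convert! this using 3 with v
  rw [← ENNReal.coe_inv (inv_pos.2 (wn_pos v)).ne', inv_inv]

lemma integral_pm {E : Type*} [NormedAddCommGroup E] [NormedSpace ℝ E]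
    (μ : Measure (Vd d)) (g : Vd d → E) :
    ∫ v, g v ∂(pm μ) = ∫ v, ((1 + ‖v‖ ^ 2) / 2 : ℝ) • g v ∂μ := by
  unfold pm
  rw [integral_withDensity_eq_integral_smul wn_cont.measurable]
  simp only [NNReal.smul_def, wn_coe]

lemma integral_qm {E : Type*} [NormedAddCommGroup E] [NormedSpace ℝ E]
    (μ : Measure (Vd d)) (g : Vd d → E) :
    ∫ v, g v ∂(qm μ) = ∫ v, (2 / (1 + ‖v‖ ^ 2) : ℝ) • g v ∂μ := by
  unfold qm
  rw [integral_withDensity_eq_integral_smul (f := fun v : Vd d => (wn v)⁻¹) wn_cont.measurable.inv]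
  simp only [NNReal.smul_def, NNReal.coe_inv, wn_coe, inv_div]

lemma integrable_sq {μ : Measure (Vd d)} (h : μ ∈ boltzmannSphere d) :
    Integrable (fun v => ‖v‖ ^ 2) μ := by
  by_contra hc
  have := h.2.2
  rw [integral_undef hc] at this
  norm_num at this

lemma pm_prob {μ : Measure (Vd d)} (h : μ ∈ boltzmannSphere d) :
    IsProbabilityMeasure (pm μ) := by
  have := h.1
  have hi := integrable_sq h
  constructor
  unfold pm
  rw [withDensity_apply _ MeasurableSet.univ, Measure.restrict_univ]
  have h2 : ∀ v : Vd d, (wn v : ℝ≥0∞) = ENNReal.ofReal ((1 + ‖v‖ ^ 2) / 2) := by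
    intro v
    rw [← wn_coe, ENNReal.ofReal_coe_nnreal]
  simp_rw [h2]
  rw [← ofReal_integral_eq_lintegral_ofReal]
  · rw [integral_div, integral_add (integrable_const _) hi, h.2.2]
    norm_num
  · exact ((integrable_const _).add hi).div_const _
  · exact Eventually.of_forall fun v => by positivity

lemma BL_cont {g : Vd d → ℝ} (hg : g ∈ BL d) : Continuous g := by
  have : LipschitzWith 1 g := LipschitzWith.of_dist_le_mul fun x y => by
    simpa [dist_eq_norm] using hg.2 x y
  exact this.continuous

lemma BL_int {g : Vd d → ℝ} (hg : g ∈ BL d) (p : Measure (Vd d)) [IsFiniteMeasure p] :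
    Integrable g p :=
  Integrable.of_bound (BL_cont hg).aestronglyMeasurable 1
    (Eventually.of_forall fun v => by simpa using hg.1 v)

lemma BL_bound {g : Vd d → ℝ} (hg : g ∈ BL d) (p : Measure (Vd d)) [IsProbabilityMeasure p] :
    |∫ v, g v ∂p| ≤ 1 := by
  have := norm_integral_le_of_norm_le_const (μ := p) (f := g) (C := 1)
    (Eventually.of_forall fun v => by simpa using hg.1 v)
  simpa using this

lemma int_test (μ : Measure (Vd d)) (f : Vd d → ℝ) :
    ∫ v, f v ∂μ = 2 * ∫ v, f v / (1 + ‖v‖ ^ 2) ∂(pm μ) := by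
  rw [integral_pm, ← integral_const_mul]
  congr 1; ext v
  have : (1 + ‖v‖ ^ 2) ≠ 0 := by positivity
  simp; field_simp

lemma test_of_BL {g : Vd d → ℝ} (hg : g ∈ BL d) :
    (fun v => g v * (1 + ‖v‖ ^ 2)) ∈ testF d := by
  have h : ∀ v : Vd d, g v * (1 + ‖v‖ ^ 2) / (1 + ‖v‖ ^ 2) = g v := fun v => by
    have : (1 + ‖v‖ ^ 2) ≠ 0 := by positivity
    field_simp
  simp only [testF, Set.mem_ofPred_eq, h]
  exact hg

lemma W_ge {μ ν : Measure (Vd d)} (hμ : μ ∈ boltzmannSphere d) (hν : ν ∈ boltzmannSphere d)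
    {g : Vd d → ℝ} (hg : g ∈ BL d) :
    2 * (∫ v, g v ∂(pm μ) - ∫ v, g v ∂(pm ν)) ≤ Wdist μ ν := by
  have := pm_prob hμ
  have := pm_prob hν
  have hb : BddAbove (Set.range fun f : testF d =>
      ((∫ v, (f : Vd d → ℝ) v ∂μ) - ∫ v, (f : Vd d → ℝ) v ∂ν)) := by
    refine ⟨4, ?_⟩
    rintro _ ⟨⟨f, hf⟩, rfl⟩
    simp only
    rw [int_test μ, int_test ν]
    have h1 := abs_le.1 (BL_bound (g := fun v => f v / (1 + ‖v‖ ^ 2)) hf (pm μ))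
    have h2 := abs_le.1 (BL_bound (g := fun v => f v / (1 + ‖v‖ ^ 2)) hf (pm ν))
    linarith [h1.1, h1.2, h2.1, h2.2]
  have := le_ciSup hb ⟨_, test_of_BL hg⟩
  refine le_trans (le_of_eq ?_) this
  simp only
  rw [int_test μ, int_test ν]
  have h : ∀ v : Vd d, g v * (1 + ‖v‖ ^ 2) / (1 + ‖v‖ ^ 2) = g v := fun v => by
    have : (1 + ‖v‖ ^ 2) ≠ 0 := by positivity
    field_simp
  simp only [h]; ring

lemma BL_zero : (fun _ => 0 : Vd d → ℝ) ∈ BL d := by simp [BL]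

lemma BL_neg {g : Vd d → ℝ} (hg : g ∈ BL d) : (fun v => - g v) ∈ BL d := by
  refine ⟨fun v => by simpa using hg.1 v, fun v v' => ?_⟩
  have := hg.2 v' v
  rw [norm_sub_rev] at this
  convert this using 2; ring

lemma W_le {μ ν : Measure (Vd d)} {c : ℝ}
    (h : ∀ g ∈ BL d, 2 * (∫ v, g v ∂(pm μ) - ∫ v, g v ∂(pm ν)) ≤ c) : Wdist μ ν ≤ c := by
  have : Nonempty (testF d) := ⟨⟨_, test_of_BL BL_zero⟩⟩
  refine ciSup_le fun f => ?_
  rw [int_test μ, int_test ν]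
  have := h (fun v => (f : Vd d → ℝ) v / (1 + ‖v‖ ^ 2)) f.2
  linarith

lemma W_nonneg {μ ν : Measure (Vd d)} (hμ : μ ∈ boltzmannSphere d)
    (hν : ν ∈ boltzmannSphere d) : 0 ≤ Wdist μ ν := by
  simpa using W_ge hμ hν BL_zero

lemma W_symm_le {μ ν : Measure (Vd d)} (hμ : μ ∈ boltzmannSphere d)
    (hν : ν ∈ boltzmannSphere d) : Wdist μ ν ≤ Wdist ν μ := by
  refine W_le fun g hg => ?_
  have := W_ge hν hμ (BL_neg hg)
  simp only [integral_neg] at this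
  linarith

lemma W_tri {μ ν ρ : Measure (Vd d)} (hμ : μ ∈ boltzmannSphere d)
    (hν : ν ∈ boltzmannSphere d) (hρ : ρ ∈ boltzmannSphere d) :
    Wdist μ ρ ≤ Wdist μ ν + Wdist ν ρ := by
  refine W_le fun g hg => ?_
  have := W_ge hμ hν hg
  have := W_ge hν hρ hg
  linarith

lemma W_self (μ : Measure (Vd d)) (hμ : μ ∈ boltzmannSphere d) : Wdist μ μ = 0 :=
  le_antisymm (W_le fun g hg => by simp) (W_nonneg hμ hμ)

lemma eq_of_BL (p q : ProbabilityMeasure (Vd d))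
    (h : ∀ g ∈ BL d, ∫ v, g v ∂(p : Measure (Vd d)) = ∫ v, g v ∂(q : Measure (Vd d))) : p = q := by
  have ht : Tendsto (fun _ : ℕ => p) atTop (nhds q) := by
    rw [tendsto_iff_forall_lipschitz_integral_tendsto]
    rintro f ⟨C, hC⟩ ⟨L, hL⟩
    have hC0 : 0 ≤ C := dist_nonneg.trans (hC 0 0)
    set M : ℝ := |f 0| + C + L + 1 with hM
    have hMp : 0 < M := by positivity
    have hg : (fun v => M⁻¹ * f v) ∈ BL d := by
      refine ⟨fun v => ?_, fun v v' => ?_⟩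
      · rw [abs_mul, abs_of_pos (inv_pos.2 hMp), inv_mul_le_iff₀ hMp]
        have h1 := hC v 0
        rw [Real.dist_eq] at h1
        have h2 : |f v| ≤ |f v - f 0| + |f 0| := by
          simpa using abs_add_le (f v - f 0) (f 0)
        have : (0:ℝ) ≤ L := L.2
        linarith
      · rw [← mul_sub, abs_mul, abs_of_pos (inv_pos.2 hMp), inv_mul_le_iff₀ hMp]
        have h1 := hL.dist_le_mul v v'
        rw [Real.dist_eq, dist_eq_norm] at h1
        have : (L : ℝ) ≤ M := by linarith [abs_nonneg (f 0)]
        exact h1.trans (by gcongr)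
    have h3 := h _ hg
    rw [integral_const_mul, integral_const_mul] at h3
    rw [mul_left_cancel₀ (inv_pos.2 hMp).ne' h3]
    exact tendsto_const_nhds
  exact tendsto_nhds_unique tendsto_const_nhds ht

lemma eq_of_W {μ ν : Measure (Vd d)} (hμ : μ ∈ boltzmannSphere d)
    (hν : ν ∈ boltzmannSphere d) (h : Wdist μ ν = 0) : μ = ν := by
  have := pm_prob hμ
  have := pm_prob hν
  have h' : Wdist ν μ ≤ 0 := (W_symm_le hν hμ).trans h.le
  have := eq_of_BL ⟨pm μ, inferInstance⟩ ⟨pm ν, inferInstance⟩ (fun g hg => by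
    have h1 := W_ge hμ hν hg
    have h2 := W_ge hν hμ hg
    simp only [ProbabilityMeasure.coe_mk]
    linarith)
  have h3 : pm μ = pm ν := congrArg (fun p : ProbabilityMeasure (Vd d) => (p : Measure (Vd d))) this
  rw [← qm_pm μ, h3, qm_pm]

lemma one_div_pm {μ : Measure (Vd d)} (h : μ ∈ boltzmannSphere d) :
    ∫ v, 1 / (1 + ‖v‖ ^ 2) ∂(pm μ) = 1 / 2 := by
  have := h.1
  rw [integral_pm]
  have : ∀ v : Vd d, ((1 + ‖v‖ ^ 2) / 2 : ℝ) • (1 / (1 + ‖v‖ ^ 2)) = 1 / 2 := fun v => by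
    have : (1 + ‖v‖ ^ 2) ≠ 0 := by positivity
    simp; field_simp
  simp only [this]; simp

lemma inner_pm {μ : Measure (Vd d)} (h : μ ∈ boltzmannSphere d) (e : Vd d) :
    ∫ v, inner ℝ e v / (1 + ‖v‖ ^ 2) ∂(pm μ) = 0 := by
  have := h.1
  rw [integral_pm]
  have h1 : ∀ v : Vd d, ((1 + ‖v‖ ^ 2) / 2 : ℝ) • (inner ℝ e v / (1 + ‖v‖ ^ 2))
      = inner ℝ e v / 2 := fun v => by
    have : (1 + ‖v‖ ^ 2) ≠ 0 := by positivity
    simp; field_simp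
  have hi : Integrable (fun v : Vd d => v) μ := by
    refine Integrable.mono' ((integrable_const (1:ℝ)).add (integrable_sq h))
      continuous_id.aestronglyMeasurable (Eventually.of_forall fun v => ?_)
    simp only [Pi.add_apply]
    nlinarith [sq_nonneg (‖v‖ - 1), norm_nonneg v]
  simp only [h1]
  rw [integral_div, integral_inner hi, h.2.1]; simp

lemma bound_aux (v : Vd d) : ‖v‖ / (1 + ‖v‖ ^ 2) ≤ 1 := by
  rw [div_le_one (by positivity)]
  nlinarith [sq_nonneg (‖v‖ - 1), norm_nonneg v]

def bcfOne (d : ℕ) : BoundedContinuousFunction (Vd d) ℝ :=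
  BoundedContinuousFunction.ofNormedAddCommGroup (fun v => 1 / (1 + ‖v‖ ^ 2))
    (by
      refine Continuous.div (by fun_prop) (by fun_prop) fun v => ?_
      positivity) 1 (fun v => by
      rw [Real.norm_eq_abs, abs_of_pos (by positivity), div_le_one (by positivity)]
      nlinarith [sq_nonneg ‖v‖])

def bcfInner (e : Vd d) : BoundedContinuousFunction (Vd d) ℝ :=
  BoundedContinuousFunction.ofNormedAddCommGroup (fun v => inner ℝ e v / (1 + ‖v‖ ^ 2))
    (by
      refine Continuous.div (by fun_prop) (by fun_prop) fun v => ?_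
      positivity) ‖e‖ (fun v => by
      rw [norm_div, Real.norm_of_nonneg (show 0 ≤ 1 + ‖v‖ ^ 2 by positivity)]
      calc _ ≤ (‖e‖ * ‖v‖) / (1 + ‖v‖ ^ 2) := by gcongr; exact norm_inner_le_norm e v
        _ = ‖e‖ * (‖v‖ / (1 + ‖v‖ ^ 2)) := by ring
        _ ≤ ‖e‖ * 1 := by gcongr; exact bound_aux v
        _ = ‖e‖ := mul_one _)

lemma qm_mem {p : Measure (Vd d)} [IsProbabilityMeasure p]
    (h1 : ∫ v, 1 / (1 + ‖v‖ ^ 2) ∂p = 1 / 2)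
    (h2 : ∀ e : Vd d, ∫ v, inner ℝ e v / (1 + ‖v‖ ^ 2) ∂p = 0) : qm p ∈ boltzmannSphere d := by
  have hi : Integrable (fun v : Vd d => 1 / (1 + ‖v‖ ^ 2)) p := (bcfOne d).integrable p
  refine ⟨⟨?_⟩, ?_, ?_⟩
  · unfold qm
    rw [withDensity_apply _ MeasurableSet.univ, Measure.restrict_univ]
    have h3 : ∀ v : Vd d, (((wn v)⁻¹ : ℝ≥0) : ℝ≥0∞) =
        ENNReal.ofReal (2 * (1 / (1 + ‖v‖ ^ 2))) := by
      intro v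
      rw [← ENNReal.ofReal_coe_nnreal, NNReal.coe_inv, wn_coe, inv_div]
      congr 1; ring
    simp_rw [h3]
    rw [← ofReal_integral_eq_lintegral_ofReal]
    · rw [integral_const_mul, h1]; norm_num
    · exact hi.const_mul _
    · exact Eventually.of_forall fun v => by positivity
  · rw [integral_qm]
    have hv : Integrable (fun v : Vd d => (2 / (1 + ‖v‖ ^ 2) : ℝ) • v) p := by
      refine Integrable.of_bound (Continuous.aestronglyMeasurable ?_) 2
        (Eventually.of_forall fun v => ?_)
      · have hcont : Continuous (fun v : Vd d => (2 / (1 + ‖v‖ ^ 2) : ℝ)) := by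
          refine Continuous.div (by fun_prop) (by fun_prop) fun v => ?_
          positivity
        exact hcont.smul continuous_id
      · rw [norm_smul, Real.norm_of_nonneg (by positivity)]
        have := bound_aux v
        calc _ = 2 * (‖v‖ / (1 + ‖v‖ ^ 2)) := by ring
          _ ≤ 2 := by linarith
    refine ext_inner_left ℝ fun e => ?_
    rw [← integral_inner hv, inner_zero_right]
    have : ∀ v : Vd d, inner ℝ e ((2 / (1 + ‖v‖ ^ 2) : ℝ) • v)
        = 2 * (inner ℝ e v / (1 + ‖v‖ ^ 2)) := fun v => by
      rw [inner_smul_right]; ring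
    simp only [this]
    rw [integral_const_mul, h2, mul_zero]
  · rw [integral_qm]
    have : ∀ v : Vd d, (2 / (1 + ‖v‖ ^ 2) : ℝ) • ‖v‖ ^ 2 = 2 - 2 * (1 / (1 + ‖v‖ ^ 2)) :=
      fun v => by
        have : (1 + ‖v‖ ^ 2) ≠ 0 := by positivity
        simp; field_simp; ring
    simp only [this]
    rw [integral_sub (integrable_const _) (hi.const_mul _), integral_const_mul, h1]
    simp; norm_num

def phi (R : ℝ) (v : Vd d) : ℝ := min 1 (max 0 (‖v‖ - R))

lemma phi_BL (R : ℝ) : (phi R : Vd d → ℝ) ∈ BL d := by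
  refine ⟨fun v => ?_, fun v v' => ?_⟩
  · unfold phi
    rw [abs_of_nonneg (by positivity)]
    exact min_le_left _ _
  · unfold phi
    calc _ ≤ |max 0 (‖v‖ - R) - max 0 (‖v'‖ - R)| := by
          have := abs_min_sub_min_le_max 1 (max 0 (‖v‖ - R)) 1 (max 0 (‖v'‖ - R))
          simpa using this
      _ ≤ |(‖v‖ - R) - (‖v'‖ - R)| := by
          have := abs_max_sub_max_le_max 0 (‖v‖ - R) 0 (‖v'‖ - R)
          simpa using this
      _ = |‖v‖ - ‖v'‖| := by congr 1; ring
      _ ≤ ‖v - v'‖ := abs_norm_sub_norm_le v v'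

lemma phi_lower (p : Measure (Vd d)) [IsProbabilityMeasure p] (R : ℝ) :
    p.real (Metric.closedBall 0 (R + 1))ᶜ ≤ ∫ v, phi R v ∂p := by
  have hm : MeasurableSet (Metric.closedBall (0 : Vd d) (R + 1))ᶜ :=
    measurableSet_closedBall.compl
  rw [← integral_indicator_one hm]
  refine integral_mono ((integrable_const _).indicator hm) (BL_int (phi_BL R) p) fun v => ?_
  by_cases hv : v ∈ (Metric.closedBall (0 : Vd d) (R + 1))ᶜ
  · rw [Set.indicator_of_mem hv]
    have : R + 1 < ‖v‖ := by simpa using hv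
    simp only [phi, Pi.one_apply]
    refine le_min le_rfl (le_max_of_le_right (by linarith))
  · rw [Set.indicator_of_notMem hv]
    unfold phi; positivity

lemma phi_upper (p : Measure (Vd d)) [IsProbabilityMeasure p] (R : ℝ) :
    ∫ v, phi R v ∂p ≤ p.real (Metric.closedBall 0 R)ᶜ := by
  have hm : MeasurableSet (Metric.closedBall (0 : Vd d) R)ᶜ :=
    measurableSet_closedBall.compl
  rw [← integral_indicator_one hm]
  refine integral_mono (BL_int (phi_BL R) p) ((integrable_const _).indicator hm) fun v => ?_
  by_cases hv : v ∈ (Metric.closedBall (0 : Vd d) R)ᶜ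
  · rw [Set.indicator_of_mem hv]
    exact min_le_left _ _
  · rw [Set.indicator_of_notMem hv]
    have : ‖v‖ ≤ R := by simpa using hv
    unfold phi
    rw [max_eq_left (by linarith)]
    exact min_le_right _ _

lemma tail_small (p : Measure (Vd d)) [IsProbabilityMeasure p] {ε : ℝ} (hε : 0 < ε) :
    ∃ R : ℝ, ∀ r, R ≤ r → p.real (Metric.closedBall 0 r)ᶜ ≤ ε := by
  have := isTightMeasureSet_iff_exists_isCompact_measure_compl_le.1
    (isTightMeasureSet_singleton (μ := p)) (ENNReal.ofReal ε) (by simpa using hε)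
  obtain ⟨K, hK, h⟩ := this
  obtain ⟨R, hR⟩ := hK.isBounded.subset_closedBall 0
  refine ⟨R, fun r hr => ?_⟩
  refine ENNReal.toReal_le_of_le_ofReal hε.le (le_trans (measure_mono ?_) (h p rfl))
  exact Set.compl_subset_compl.2 (hR.trans (Metric.closedBall_subset_closedBall hr))

lemma complete (u : ℕ → Measure (Vd d)) (hu : ∀ n, u n ∈ boltzmannSphere d)
    (hc : ∀ ε : ℝ, 0 < ε → ∃ K : ℕ, ∀ m n : ℕ, K ≤ m → K ≤ n → Wdist (u m) (u n) < ε) :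
    ∃ μ ∈ boltzmannSphere d, Tendsto (fun n => Wdist (u n) μ) atTop (nhds 0) := by
  have hpr := fun n => pm_prob (hu n)
  let P : ℕ → ProbabilityMeasure (Vd d) := fun n => ⟨pm (u n), hpr n⟩
  have htight : IsTightMeasureSet
      {((μ : ProbabilityMeasure (Vd d)) : Measure (Vd d)) | μ ∈ Set.range P} := by
    rw [isTightMeasureSet_iff_exists_isCompact_measure_compl_le]
    intro ε' hε'
    obtain ⟨ε, hε, hεε⟩ : ∃ ε : ℝ, 0 < ε ∧ ENNReal.ofReal ε ≤ ε' := by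
      obtain ⟨r, hr, hr'⟩ := ENNReal.lt_iff_exists_nnreal_btwn.1 hε'
      exact ⟨r, by exact_mod_cast hr, by simpa using hr'.le⟩
    obtain ⟨K, hK⟩ := hc ε hε
    choose R hR using fun n => tail_small (pm (u n)) (half_pos hε)
    obtain ⟨M, hM⟩ := ((Finset.range (K + 1)).image R).bddAbove
    refine ⟨Metric.closedBall 0 (M + 1), isCompact_closedBall _ _, ?_⟩
    rintro _ ⟨_, ⟨n, rfl⟩, rfl⟩
    refine le_trans ?_ hεε
    change pm (u n) _ ≤ _
    rw [← ENNReal.ofReal_toReal (measure_ne_top (pm (u n)) _)]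
    refine ENNReal.ofReal_le_ofReal ?_
    change (pm (u n)).real _ ≤ _
    have hRM : ∀ j ≤ K, R j ≤ M := fun j hj =>
      hM (Finset.mem_coe.2 (Finset.mem_image_of_mem _ (Finset.mem_range.2 (by omega))))
    by_cases hn : n ≤ K
    · have := hR n (M + 1) (by linarith [hRM n hn])
      linarith
    · have h1 := phi_lower (pm (u n)) M
      have h2 := phi_upper (pm (u K)) M
      have h3 := hR K M (hRM K le_rfl)
      have h4 := W_ge (hu n) (hu K) (phi_BL M)
      have h5 := hK n K (by omega) le_rfl
      linarith
  have hcomp := isCompact_closure_of_isTightMeasureSet htight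
  obtain ⟨p, -, hp⟩ := hcomp.ultrafilter_le_nhds ((hyperfilter ℕ).map P) (by
    rw [le_principal_iff]
    exact mem_of_superset (Filter.mem_map.2 (univ_mem' fun n => Set.mem_range_self n))
      subset_closure)
  have hlim : Tendsto P (hyperfilter ℕ : Filter ℕ) (nhds p) := hp
  have hle : (hyperfilter ℕ : Filter ℕ) ≤ atTop := Nat.hyperfilter_le_atTop
  rw [ProbabilityMeasure.tendsto_iff_forall_integral_tendsto] at hlim
  have hmem : qm (p : Measure (Vd d)) ∈ boltzmannSphere d := by
    refine qm_mem ?_ fun e => ?_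
    · refine tendsto_nhds_unique (hlim (bcfOne d)) ?_
      refine tendsto_const_nhds.congr fun n => ?_
      exact (one_div_pm (hu n)).symm
    · refine tendsto_nhds_unique (hlim (bcfInner e)) ?_
      refine tendsto_const_nhds.congr fun n => ?_
      exact (inner_pm (hu n) e).symm
  refine ⟨_, hmem, ?_⟩
  rw [Metric.tendsto_atTop]
  intro ε hε
  obtain ⟨K, hK⟩ := hc (ε / 2) (half_pos hε)
  refine ⟨K, fun n hn => ?_⟩
  rw [Real.dist_eq, sub_zero, abs_of_nonneg (W_nonneg (hu n) hmem)]
  refine lt_of_le_of_lt (W_le (c := ε / 2) fun g hg => ?_) (half_lt_self hε)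
  rw [pm_qm]
  let G : BoundedContinuousFunction (Vd d) ℝ :=
    BoundedContinuousFunction.ofNormedAddCommGroup g (BL_cont hg) 1
      (fun v => by simpa using hg.1 v)
  have h1 : Tendsto (fun m => 2 * (∫ v, g v ∂(pm (u n)) - ∫ v, g v ∂(pm (u m))))
      (hyperfilter ℕ : Filter ℕ)
      (nhds (2 * (∫ v, g v ∂(pm (u n)) - ∫ v, g v ∂(p : Measure (Vd d))))) :=
    (tendsto_const_nhds.sub (hlim G)).const_mul 2
  refine le_of_tendsto h1 (Filter.Eventually.filter_mono hle ?_)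
  filter_upwards [eventually_ge_atTop K] with m hm
  exact (W_ge (hu n) (hu m) hg).trans (hK n m hn hm).le

lemma piece_est {g : Vd d → ℝ} (hg : g ∈ BL d) (p q : Measure (Vd d)) [IsProbabilityMeasure p]
    [IsProbabilityMeasure q] {A : Set (Vd d)} (hA : MeasurableSet A) {ε : ℝ}
    (hd : ∀ x ∈ A, ∀ y ∈ A, dist x y ≤ ε) :
    ∫ v in A, g v ∂p - ∫ v in A, g v ∂q
      ≤ |p.real A - q.real A| + ε * (p.real A + q.real A) := by
  rcases A.eq_empty_or_nonempty with rfl | ⟨x, hx⟩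
  · simp
  have key : ∀ (m : Measure (Vd d)) [IsProbabilityMeasure m],
      |∫ v in A, g v ∂m - g x * m.real A| ≤ ε * m.real A := by
    intro m _
    have h1 : ∫ v in A, g v ∂m - g x * m.real A = ∫ v in A, (g v - g x) ∂m := by
      rw [integral_sub (BL_int hg m).integrableOn (integrable_const _)]
      simp [mul_comm]
    rw [h1, ← Real.norm_eq_abs]
    refine norm_setIntegral_le_of_norm_le_const (measure_lt_top m A) fun v hv => ?_
    rw [Real.norm_eq_abs]
    exact (hg.2 v x).trans (by rw [← dist_eq_norm]; exact hd v hv x hx)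
  have h1 := (abs_le.1 (key p)).2
  have h2 := (abs_le.1 (key q)).1
  have h3 : g x * (p.real A - q.real A) ≤ |p.real A - q.real A| := by
    calc _ ≤ |g x * (p.real A - q.real A)| := le_abs_self _
      _ = |g x| * |p.real A - q.real A| := abs_mul _ _
      _ ≤ 1 * |p.real A - q.real A| := by gcongr; exact hg.1 x
      _ = _ := one_mul _
  linarith

lemma sep_est {g : Vd d → ℝ} (hg : g ∈ BL d) (p q : Measure (Vd d)) [IsProbabilityMeasure p]
    [IsProbabilityMeasure q] {A : ℕ → Set (Vd d)} (hA : ∀ n, MeasurableSet (A n))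
    (hdis : Pairwise (fun n m => Disjoint (A n) (A m))) {ε : ℝ} (hε : 0 ≤ ε)
    (hd : ∀ n, ∀ x ∈ A n, ∀ y ∈ A n, dist x y ≤ ε) (N : ℕ)
    (hN : 1 - ε ≤ ∑ n ∈ Finset.range N, p.real (A n))
    (hpq : ∑ n ∈ Finset.range N, |p.real (A n) - q.real (A n)| ≤ ε) :
    ∫ v, g v ∂p - ∫ v, g v ∂q ≤ 6 * ε := by
  set B := ⋃ n ∈ Finset.range N, A n with hB
  have hBm : MeasurableSet B := Finset.measurableSet_biUnion _ fun n _ => hA n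
  have hpd : Set.PairwiseDisjoint (↑(Finset.range N)) A := fun i _ j _ hij => hdis hij
  have split : ∀ (m : Measure (Vd d)) [IsProbabilityMeasure m],
      ∫ v, g v ∂m = ∑ n ∈ Finset.range N, ∫ v in A n, g v ∂m + ∫ v in Bᶜ, g v ∂m := by
    intro m _
    rw [← integral_add_compl hBm (BL_int hg m), hB,
      integral_biUnion_finset _ (fun n _ => hA n) hpd fun n _ => (BL_int hg m).integrableOn]
  have hsum : ∀ (m : Measure (Vd d)) [IsProbabilityMeasure m],
      m.real B = ∑ n ∈ Finset.range N, m.real (A n) := by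
    intro m _
    rw [hB, measureReal_biUnion_finset hpd fun n _ => hA n]
  have hcomp : ∀ (m : Measure (Vd d)) [IsProbabilityMeasure m],
      |∫ v in Bᶜ, g v ∂m| ≤ 1 - m.real B := by
    intro m _
    rw [← probReal_compl_eq_one_sub hBm]
    have := norm_setIntegral_le_of_norm_le_const (μ := m) (f := g) (C := 1) (s := Bᶜ)
      (measure_lt_top m _) fun v _ => by simpa using hg.1 v
    simpa using this
  have hpB := hcomp p
  have hqB := hcomp q
  have hp1 : p.real B ≤ 1 := measureReal_le_one
  have hq1 : q.real B ≤ 1 := measureReal_le_one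
  have hdiff : p.real B - q.real B ≤ ε := by
    rw [hsum p, hsum q, ← Finset.sum_sub_distrib]
    exact (Finset.sum_le_sum fun n _ => le_abs_self _).trans hpq
  have hmain : ∑ n ∈ Finset.range N, ∫ v in A n, g v ∂p
      - ∑ n ∈ Finset.range N, ∫ v in A n, g v ∂q ≤ ε + ε * (p.real B + q.real B) := by
    rw [← Finset.sum_sub_distrib, hsum p, hsum q, ← Finset.sum_add_distrib, Finset.mul_sum]
    refine le_trans (Finset.sum_le_sum fun n _ => piece_est hg p q (hA n) (hd n)) ?_
    rw [Finset.sum_add_distrib]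
    linarith
  rw [← hsum p] at hN
  have h3 : ε * (p.real B + q.real B) ≤ ε * 2 := by gcongr; linarith
  rw [split p, split q]
  have := (abs_le.1 hpB).2
  have := (abs_le.1 hqB).1
  linarith

lemma sphere_nonempty (hd : 2 ≤ d) : ∃ μ, μ ∈ boltzmannSphere d := by
  let e : Vd d := EuclideanSpace.single ⟨0, by omega⟩ (1:ℝ)
  have he : ‖e‖ = 1 := by simp [e]
  refine ⟨(2⁻¹ : ℝ≥0∞) • (Measure.dirac e + Measure.dirac (-e)), ⟨?_⟩, ?_, ?_⟩
  · simp only [Measure.smul_apply, Measure.add_apply, measure_univ, smul_eq_mul]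
    rw [one_add_one_eq_two]
    exact ENNReal.inv_mul_cancel (by simp) (by simp)
  · rw [integral_smul_measure, integral_add_measure]
    · simp
    · exact integrable_dirac (by simp)
    · exact integrable_dirac (by simp)
  · rw [integral_smul_measure, integral_add_measure]
    · simp [he]; norm_num
    · exact integrable_dirac (by simp)
    · exact integrable_dirac (by simp)

lemma step (ε : ℝ) (hε : 0 < ε) : ∃ C : Set (Measure (Vd d)), C.Countable ∧
    C ⊆ boltzmannSphere d ∧ ∀ μ ∈ boltzmannSphere d, ∃ ν ∈ C, Wdist μ ν ≤ 12 * ε := by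
  obtain ⟨A, hAm, hAb, hAd, hAu, hAdis⟩ :=
    SeparableSpace.exists_measurable_partition_diam_le (Vd d) hε
  let F : Measure (Vd d) → ℕ → ℝ := fun μ n => (pm μ).real (A n)
  obtain ⟨t, hts, htc, htd⟩ := (TopologicalSpace.IsSeparable.of_separableSpace
    (F '' boltzmannSphere d)).exists_countable_dense_subset
  obtain ⟨C, hCs, hCc⟩ : ∃ C : Set (Measure (Vd d)), C ⊆ boltzmannSphere d ∧ 
      (C.Countable ∧ F '' C = t) := by
    choose! G hG1 hG2 using hts
    refine ⟨G '' t, ?_, htc.image _, ?_⟩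
    · rintro _ ⟨x, hx, rfl⟩
      exact hG1 hx
    · rw [Set.image_image]
      ext y
      constructor
      · rintro ⟨x, hx, rfl⟩
        simp only [hG2 hx]; exact hx
      · intro hy
        exact ⟨y, hy, hG2 hy⟩
  refine ⟨C, hCc.1, hCs, fun μ hμ => ?_⟩
  have := pm_prob hμ
  have hs : Tendsto (fun N => ∑ n ∈ Finset.range N, (pm μ).real (A n)) atTop (nhds 1) := by
    have h0 := hasSum_integral_iUnion (μ := pm μ) (f := fun _ => (1:ℝ)) hAm hAdis
      (integrable_const _).integrableOn
    rw [hAu] at h0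
    simp only [Measure.restrict_univ, integral_const, MeasurableSet.univ, measureReal_restrict_apply,
      Set.univ_inter, probReal_univ, smul_eq_mul, mul_one] at h0
    exact h0.tendsto_sum_nat
  obtain ⟨N, hN⟩ := (hs.eventually (lt_mem_nhds (show 1 - ε < 1 by linarith))).exists
  have hcont : Continuous fun y : ℕ → ℝ => ∑ n ∈ Finset.range N, |F μ n - y n| := by fun_prop
  have hopen : IsOpen {y : ℕ → ℝ | ∑ n ∈ Finset.range N, |F μ n - y n| < ε} :=
    isOpen_lt hcont continuous_const
  obtain ⟨y, hy, hyt⟩ := mem_closure_iff.1 (htd ⟨μ, hμ, rfl⟩) _ hopen (by simpa using hε)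
  rw [← hCc.2] at hyt
  obtain ⟨ν, hν, rfl⟩ := hyt
  have := pm_prob (hCs hν)
  refine ⟨ν, hν, W_le fun g hg => ?_⟩
  have := sep_est hg (pm μ) (pm ν) hAm hAdis hε.le (fun n x hx y hy =>
    (Metric.dist_le_diam_of_mem (hAb n) hx hy).trans (hAd n)) N hN.le (le_of_lt hy)
  linarith

lemma separable (hd : 2 ≤ d) : ∃ D : ℕ → Measure (Vd d), (∀ n, D n ∈ boltzmannSphere d) ∧
      ∀ μ ∈ boltzmannSphere d, ∀ ε : ℝ, 0 < ε → ∃ n : ℕ, Wdist μ (D n) < ε := by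
  choose C hCc hCs hC using fun k : ℕ => step (d := d) (1 / ((k : ℝ) + 1)) (by positivity)
  have hcount : (⋃ k, C k).Countable := Set.countable_iUnion hCc
  have hne : (⋃ k, C k).Nonempty := by
    obtain ⟨μ, hμ⟩ := sphere_nonempty hd
    obtain ⟨ν, hν, -⟩ := hC 0 μ hμ
    exact ⟨ν, Set.mem_iUnion.2 ⟨0, hν⟩⟩
  obtain ⟨D, hD⟩ := hcount.exists_eq_range hne
  refine ⟨D, fun n => ?_, fun μ hμ ε hε => ?_⟩
  · have : D n ∈ ⋃ k, C k := hD ▸ Set.mem_range_self n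
    obtain ⟨k, hk⟩ := Set.mem_iUnion.1 this
    exact hCs k hk
  · obtain ⟨k, hk⟩ := exists_nat_one_div_lt (show 0 < ε / 12 by positivity)
    obtain ⟨ν, hν, h⟩ := hC k μ hμ
    have : ν ∈ Set.range D := hD ▸ Set.mem_iUnion.2 ⟨k, hν⟩
    obtain ⟨n, rfl⟩ := this
    exact ⟨n, by linarith⟩

end KacAux

/-- Proposition 8.1: W is a metric on the Boltzmann sphere, and (𝒮, W) is a
complete separable metric space. -/
theorem boltzmannSphere_complete_separable (d : ℕ) (hd : 2 ≤ d) :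
    (∀ μ ∈ boltzmannSphere d, ∀ ν ∈ boltzmannSphere d,
      0 ≤ Wdist μ ν ∧ (Wdist μ ν = 0 ↔ μ = ν) ∧ Wdist μ ν = Wdist ν μ) ∧
    (∀ μ ∈ boltzmannSphere d, ∀ ν ∈ boltzmannSphere d, ∀ ρ ∈ boltzmannSphere d,
      Wdist μ ρ ≤ Wdist μ ν + Wdist ν ρ) ∧
    (∀ u : ℕ → Measure (Vd d), (∀ n, u n ∈ boltzmannSphere d) →
      (∀ ε : ℝ, 0 < ε → ∃ K : ℕ, ∀ m n : ℕ, K ≤ m → K ≤ n →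
        Wdist (u m) (u n) < ε) →
      ∃ μ ∈ boltzmannSphere d,
        Filter.Tendsto (fun n => Wdist (u n) μ) Filter.atTop (nhds 0)) ∧
    (∃ D : ℕ → Measure (Vd d), (∀ n, D n ∈ boltzmannSphere d) ∧
      ∀ μ ∈ boltzmannSphere d, ∀ ε : ℝ, 0 < ε → ∃ n : ℕ, Wdist μ (D n) < ε) := by
  refine ⟨fun μ hμ ν hν => ⟨KacAux.W_nonneg hμ hν, ⟨KacAux.eq_of_W hμ hν, ?_⟩, ?_⟩,
    fun μ hμ ν hν ρ hρ => KacAux.W_tri hμ hν hρ, KacAux.complete, KacAux.separable hd⟩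
  · rintro rfl
    exact KacAux.W_self μ hμ
  · exact le_antisymm (KacAux.W_symm_le hμ hν) (KacAux.W_symm_le hν hμ)
end
end
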